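/- (Inhomogeneous Strichartz estimate for the vibrating plate equation) Let d ≥ 1, s ∈ ℝ with s - 2 > -d, and let (q,r) and (q̃,r̃) be admissible pairs. There is a constant C = C(d,q,r,q̃,r̃) > 0 such that for every interval I ⊆ [0,∞) containing 0 and every F ∈ 𝒮(ℝ × ℝ^d): ‖ ∫₀ᵗ (sin((t-σ)Δ)/Δ) F(σ,·) dσ ‖_{L^q_I Ẇ^{s,r}} ≤ C ‖F‖_{L^{q̃'}_I Ẇ^{s-2,r̃'}}, where q̃', r̃' are the conjugate exponents of q̃, r̃. -/

import Mathlib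

open MeasureTheory Complex Filter
open scoped ENNReal RealInnerProductSpace

noncomputable section

/-- `d`-dimensional Euclidean space. -/
abbrev Ed (d : ℕ) := EuclideanSpace ℝ (Fin d)

/-- Fourier transform: `f̂(ξ) = ∫ e^{-i x·ξ} f(x) dx`. -/
def FT (d : ℕ) (f : Ed d → ℂ) (ξ : Ed d) : ℂ :=
  ∫ x, Complex.exp (-Complex.I * (⟪x, ξ⟫ : ℝ)) * f x

/-- Inverse Fourier transform: `(F⁻¹ g)(x) = (2π)^{-d} ∫ e^{i x·ξ} g(ξ) dξ`. -/
def FTinv (d : ℕ) (g : Ed d → ℂ) (x : Ed d) : ℂ :=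
  (((2 * Real.pi) ^ d : ℝ) : ℂ)⁻¹ * ∫ ξ, Complex.exp (Complex.I * (⟪x, ξ⟫ : ℝ)) * g ξ

/-- Bessel-type fractional differentiation `⟨D⟩^s f = F⁻¹((1+|ξ|²)^{s/2} f̂(ξ))`. -/
def besselD (d : ℕ) (s : ℝ) (f : Ed d → ℂ) : Ed d → ℂ :=
  FTinv d fun ξ => (((1 + ‖ξ‖ ^ 2) ^ (s / 2) : ℝ) : ℂ) * FT d f ξ

/-- Riesz-type fractional differentiation `|D|^s f = F⁻¹(|ξ|^s f̂(ξ))`. -/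
def rieszD (d : ℕ) (s : ℝ) (f : Ed d → ℂ) : Ed d → ℂ :=
  FTinv d fun ξ => ((‖ξ‖ ^ s : ℝ) : ℂ) * FT d f ξ

/-- Homogeneous Sobolev seminorm `‖f‖_{Ẇ^{s,r}} = ‖|D|^s f‖_{L^r}`. -/
def sobNorm (d : ℕ) (s : ℝ) (r : ℝ≥0∞) (f : Ed d → ℂ) : ℝ≥0∞ :=
  eLpNorm (rieszD d s f) r volume

/-- The propagator `sin(tΔ)/Δ f = F⁻¹(|ξ|^{-2} sin(t|ξ|²) f̂(ξ))`. -/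
def sinLapDivLap (d : ℕ) (t : ℝ) (f : Ed d → ℂ) : Ed d → ℂ :=
  FTinv d fun ξ => ((Real.sin (t * ‖ξ‖ ^ 2) / ‖ξ‖ ^ 2 : ℝ) : ℂ) * FT d f ξ

/-- The propagator `cos(tΔ) f = F⁻¹(cos(t|ξ|²) f̂(ξ))`. -/
def cosLap (d : ℕ) (t : ℝ) (f : Ed d → ℂ) : Ed d → ℂ :=
  FTinv d fun ξ => ((Real.cos (t * ‖ξ‖ ^ 2) : ℝ) : ℂ) * FT d f ξ

/-- An admissible (Schrödinger) pair: `2 ≤ q,r ≤ ∞`, `2/q + d/r = d/2`, `(q,r,d) ≠ (2,∞,2)`. -/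
def Admissible (d : ℕ) (q r : ℝ≥0∞) : Prop :=
  2 ≤ q ∧ 2 ≤ r ∧ 2 / q + d / r = d / 2 ∧ ¬(q = 2 ∧ r = ∞ ∧ d = 2)

/-- Mixed space-time norm `‖u‖_{L^q_I X} = (∫_I (g t)^q dt)^{1/q}` where `g t = ‖u(t,·)‖_X`,
with the essential supremum modification when `q = ∞`. -/
def mixedNorm (q : ℝ≥0∞) (I : Set ℝ) (g : ℝ → ℝ≥0∞) : ℝ≥0∞ :=
  if q = ∞ then essSup g (volume.restrict I)
  else (∫⁻ t in I, g t ^ q.toReal) ^ (1 / q.toReal)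

section

/-- Young's inequality in trilinear form, with equal exponents on the two outer factors. -/
theorem lintegral_kernel_le {a : ℝ} (ha : 1 < a) (ha2 : a ≤ 2) {h c d : ℝ → ℝ≥0∞}
    (hh : Measurable h) (hc : Measurable c) (hd : Measurable d) :
    ∫⁻ p : ℝ × ℝ, h (p.2 - p.1) * (c p.1 * d p.2) ≤
      (∫⁻ x, h x ^ (1 / (2 * (1 - 1 / a)))) ^ (2 * (1 - 1 / a)) *
        ((∫⁻ s, c s ^ a) ^ (1 / a) * (∫⁻ t, d t ^ a) ^ (1 / a)) := by
  set β := 1 - 1 / a with hβ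
  have ha0 : 0 < a := by linarith
  have hβ0 : 0 < β := by
    rw [hβ]; have : 1 / a < 1 := by rw [div_lt_one ha0]; exact ha
    linarith
  have hβ2 : 2 * β ≤ 1 := by
    have : 1 / 2 ≤ 1 / a := one_div_le_one_div_of_le ha0 ha2
    linarith
  have hβa : a * (1 - β) = 1 := by rw [hβ]; field_simp; ring
  set Q := 1 / (2 * β) with hQ
  have hQβ : Q * (2 * β) = 1 := by rw [hQ]; field_simp
  have hQ0 : 0 < Q := by rw [hQ]; positivity
  set H := ∫⁻ x, h x ^ Q
  set Cc := ∫⁻ s, c s ^ a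
  set D := ∫⁻ t, d t ^ a
  have hm1 : Measurable fun p : ℝ × ℝ => h (p.2 - p.1) ^ Q := by fun_prop
  have hm2 : Measurable fun p : ℝ × ℝ => c p.1 ^ a := by fun_prop
  have hm3 : Measurable fun p : ℝ × ℝ => d p.2 ^ a := by fun_prop
  let f : Fin 3 → ℝ × ℝ → ℝ≥0∞ := ![fun p => h (p.2 - p.1) ^ Q * c p.1 ^ a,
    fun p => h (p.2 - p.1) ^ Q * d p.2 ^ a, fun p => c p.1 ^ a * d p.2 ^ a]
  let e : Fin 3 → ℝ := ![β, β, 1 - 2 * β]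
  have key := ENNReal.lintegral_prod_norm_pow_le (μ := (volume : Measure (ℝ × ℝ))) Finset.univ
    (f := f) (p := e) (by
      intro i _
      fin_cases i
      · exact (hm1.mul hm2).aemeasurable
      · exact (hm1.mul hm3).aemeasurable
      · exact (hm2.mul hm3).aemeasurable)
    (by simp [Fin.sum_univ_three, e]; ring)
    (by intro i _; fin_cases i <;> simp [e] <;> linarith)
  have e0 : ∫⁻ p, f 0 p = H * Cc := by
    change ∫⁻ p : ℝ × ℝ, h (p.2 - p.1) ^ Q * c p.1 ^ a = _
    rw [Measure.volume_eq_prod, lintegral_prod (fun p : ℝ × ℝ => h (p.2 - p.1) ^ Q * c p.1 ^ a)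
      (hm1.mul hm2).aemeasurable]
    have : ∀ s : ℝ, ∫⁻ t, h (t - s) ^ Q * c s ^ a = H * c s ^ a := fun s => by
      rw [lintegral_mul_const _ (by fun_prop), lintegral_sub_right_eq_self (fun x => h x ^ Q) s]
    simp only [this]
    rw [lintegral_const_mul _ (by fun_prop)]
  have e1 : ∫⁻ p, f 1 p = H * D := by
    change ∫⁻ p : ℝ × ℝ, h (p.2 - p.1) ^ Q * d p.2 ^ a = _
    rw [Measure.volume_eq_prod, lintegral_prod_symm
      (fun p : ℝ × ℝ => h (p.2 - p.1) ^ Q * d p.2 ^ a) (hm1.mul hm3).aemeasurable]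
    have : ∀ t : ℝ, ∫⁻ s, h (t - s) ^ Q * d t ^ a = H * d t ^ a := fun t => by
      rw [lintegral_mul_const _ (by fun_prop), lintegral_sub_left_eq_self (fun x => h x ^ Q) t]
    simp only [this]
    rw [lintegral_const_mul _ (by fun_prop)]
  have e2 : ∫⁻ p, f 2 p = Cc * D := by
    change ∫⁻ p : ℝ × ℝ, c p.1 ^ a * d p.2 ^ a = _
    rw [Measure.volume_eq_prod, lintegral_prod_mul (f := fun s => c s ^ a) (g := fun t => d t ^ a)
      (by fun_prop) (by fun_prop)]
  rw [Fin.prod_univ_three, e0, e1, e2] at key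
  have hl : ∀ p, ∏ i, f i p ^ e i = h (p.2 - p.1) * (c p.1 * d p.2) := by
    intro p
    rw [Fin.prod_univ_three]
    change (h (p.2 - p.1) ^ Q * c p.1 ^ a) ^ β * (h (p.2 - p.1) ^ Q * d p.2 ^ a) ^ β *
      (c p.1 ^ a * d p.2 ^ a) ^ (1 - 2 * β) = _
    have h1 : ∀ x : ℝ≥0∞, (x ^ Q) ^ β * (x ^ Q) ^ β = x := fun x => by
      rw [← ENNReal.rpow_add_of_nonneg _ _ hβ0.le hβ0.le, ← ENNReal.rpow_mul, ← two_mul, hQβ,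
        ENNReal.rpow_one]
    have h2 : ∀ x : ℝ≥0∞, (x ^ a) ^ β * (x ^ a) ^ (1 - 2 * β) = x := fun x => by
      rw [← ENNReal.rpow_add_of_nonneg _ _ hβ0.le (by linarith), ← ENNReal.rpow_mul,
        show a * (β + (1 - 2 * β)) = 1 by linear_combination hβa, ENNReal.rpow_one]
    rw [ENNReal.mul_rpow_of_nonneg _ _ hβ0.le, ENNReal.mul_rpow_of_nonneg _ _ hβ0.le,
      ENNReal.mul_rpow_of_nonneg _ _ (by linarith : 0 ≤ 1 - 2 * β)]
    conv_rhs => rw [← h1 (h (p.2 - p.1)), ← h2 (c p.1), ← h2 (d p.2)]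
    ring
  simp only [hl] at key
  refine key.trans (le_of_eq ?_)
  change (H * Cc) ^ β * (H * D) ^ β * (Cc * D) ^ (1 - 2 * β) = _
  rw [ENNReal.mul_rpow_of_nonneg _ _ hβ0.le, ENNReal.mul_rpow_of_nonneg _ _ hβ0.le,
      ENNReal.mul_rpow_of_nonneg _ _ (by linarith : 0 ≤ 1 - 2 * β),
      show 1 / a = β + (1 - 2 * β) by rw [hβ]; ring, two_mul β,
      ENNReal.rpow_add_of_nonneg _ _ hβ0.le hβ0.le,
      ENNReal.rpow_add_of_nonneg _ _ hβ0.le (by linarith : 0 ≤ 1 - (β + β)),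
      ENNReal.rpow_add_of_nonneg _ _ hβ0.le (by linarith : 0 ≤ 1 - (β + β))]
  ring

theorem lintegral_Ici_ofReal_rpow {e m : ℝ} (he : 1 < e) (hm : 0 < m) :
    ∫⁻ x in Set.Ici m, ENNReal.ofReal (x ^ (-e)) = ENNReal.ofReal (m ^ (1 - e) / (e - 1)) := by
  rw [setLIntegral_congr Ioi_ae_eq_Ici.symm, ← ofReal_integral_eq_lintegral_ofReal
    (integrableOn_Ioi_rpow_of_lt (by linarith) hm), integral_Ioi_rpow_of_lt (by linarith) hm]
  · congr 1
    rw [show -e + 1 = -(e - 1) by ring, neg_div_neg_eq, show -(e - 1) = 1 - e by ring]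
  · filter_upwards [ae_restrict_mem measurableSet_Ioi] with x hx
    exact Real.rpow_nonneg (hm.le.trans (le_of_lt hx)) _

theorem lintegral_abs_tail {e m : ℝ} (he : 1 < e) (hm : 0 < m) :
    ∫⁻ x : ℝ, (if m ≤ |x| then ENNReal.ofReal (|x| ^ (-e)) else 0) =
      ENNReal.ofReal (2 * (m ^ (1 - e) / (e - 1))) := by
  have hmeas : Measurable fun x : ℝ => ENNReal.ofReal (|x| ^ (-e)) := by fun_prop
  have h1 : ∀ x : ℝ, (if m ≤ |x| then ENNReal.ofReal (|x| ^ (-e)) else 0) =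
      (Set.Ici m).indicator (fun x => ENNReal.ofReal (x ^ (-e))) x +
      (Set.Ici m).indicator (fun x => ENNReal.ofReal (x ^ (-e))) (-x) := by
    intro x
    simp only [Set.indicator_apply, Set.mem_Ici]
    rcases le_total 0 x with hx | hx
    · rw [abs_of_nonneg hx]
      have : ¬ m ≤ -x := by linarith
      simp [this]
    · rw [abs_of_nonpos hx]
      have : ¬ m ≤ x := by linarith
      simp [this]
  have hmi : Measurable ((Set.Ici m).indicator (fun x : ℝ => ENNReal.ofReal (x ^ (-e)))) :=
    Measurable.indicator (by fun_prop) measurableSet_Ici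
  simp only [h1]
  rw [lintegral_add_left hmi, lintegral_neg_eq_self, lintegral_indicator measurableSet_Ici,
    lintegral_Ici_ofReal_rpow he hm, ← ENNReal.ofReal_add (by
      have := Real.rpow_nonneg hm.le (1 - e)
      exact div_nonneg this (by linarith)) (by
      have := Real.rpow_nonneg hm.le (1 - e)
      exact div_nonneg this (by linarith)), two_mul]

/-- Young's inequality for the truncated power kernel. -/
theorem lintegral_tail_kernel_le {a σ : ℝ} (ha : 1 < a) (ha2 : a ≤ 2)
    (hσ : 2 * (1 - 1 / a) < σ) : ∃ C : ℝ, 0 ≤ C ∧ ∀ m : ℝ, 0 < m → ∀ c d : ℝ → ℝ≥0∞,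
    Measurable c → Measurable d →
    ∫⁻ p : ℝ × ℝ, (if m ≤ |p.2 - p.1| then ENNReal.ofReal (|p.2 - p.1| ^ (-σ)) else 0) *
        (c p.1 * d p.2) ≤
      ENNReal.ofReal (C * m ^ (2 * (1 - 1 / a) - σ)) *
        ((∫⁻ s, c s ^ a) ^ (1 / a) * (∫⁻ t, d t ^ a) ^ (1 / a)) := by
  have ha0 : 0 < a := by linarith
  set β := 1 - 1 / a with hβ
  have hβ0 : 0 < β := by
    rw [hβ]; have : 1 / a < 1 := by rw [div_lt_one ha0]; exact ha
    linarith
  have he : 1 < σ * (1 / (2 * β)) := by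
    rw [mul_one_div, one_lt_div (by positivity)]; exact hσ
  refine ⟨(2 / (σ * (1 / (2 * β)) - 1)) ^ (2 * β), Real.rpow_nonneg (by
    apply div_nonneg <;> linarith) _, fun m hm c d hc hd => ?_⟩
  have hh : Measurable fun x : ℝ => if m ≤ |x| then ENNReal.ofReal (|x| ^ (-σ)) else 0 :=
    Measurable.ite (measurableSet_le measurable_const (by fun_prop)) (by fun_prop)
      measurable_const
  refine (lintegral_kernel_le ha ha2 hh hc hd).trans (mul_le_mul_left (le_of_eq ?_) _)
  rw [← hβ]
  have : ∀ x : ℝ, (if m ≤ |x| then ENNReal.ofReal (|x| ^ (-σ)) else 0) ^ (1 / (2 * β)) =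
      if m ≤ |x| then ENNReal.ofReal (|x| ^ (-(σ * (1 / (2 * β))))) else 0 := by
    intro x
    split_ifs with hx
    · rw [ENNReal.ofReal_rpow_of_nonneg (Real.rpow_nonneg (abs_nonneg _) _) (by positivity),
        ← Real.rpow_mul (abs_nonneg _), neg_mul]
    · exact ENNReal.zero_rpow_of_pos (by positivity)
  simp only [this]
  have h2 : 0 ≤ 2 / (σ * (1 / (2 * β)) - 1) := by apply div_nonneg <;> linarith
  rw [lintegral_abs_tail he hm, ENNReal.ofReal_rpow_of_nonneg (by
      have := Real.rpow_nonneg hm.le (1 - σ * (1 / (2 * β)))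
      have := div_nonneg this (by linarith : 0 ≤ σ * (1 / (2 * β)) - 1)
      linarith) (by positivity)]
  congr 1
  rw [show 2 * (m ^ (1 - σ * (1 / (2 * β))) / (σ * (1 / (2 * β)) - 1)) =
    2 / (σ * (1 / (2 * β)) - 1) * m ^ (1 - σ * (1 / (2 * β))) by ring,
    Real.mul_rpow h2 (Real.rpow_nonneg hm.le _), ← Real.rpow_mul hm.le]
  congr 2
  field_simp

/-- Young's inequality for the indicator kernel of an interval. -/
theorem lintegral_ball_kernel_le {a : ℝ} (ha : 1 < a) (ha2 : a ≤ 2) {m : ℝ} (hm : 0 < m)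
    {c d : ℝ → ℝ≥0∞} (hc : Measurable c) (hd : Measurable d) :
    ∫⁻ p : ℝ × ℝ, (if |p.2 - p.1| < m then 1 else 0) * (c p.1 * d p.2) ≤
      ENNReal.ofReal ((2 * m) ^ (2 * (1 - 1 / a))) *
        ((∫⁻ s, c s ^ a) ^ (1 / a) * (∫⁻ t, d t ^ a) ^ (1 / a)) := by
  have ha0 : 0 < a := by linarith
  set β := 1 - 1 / a with hβ
  have hβ0 : 0 < β := by
    rw [hβ]; have : 1 / a < 1 := by rw [div_lt_one ha0]; exact ha
    linarith
  have hms : MeasurableSet {x : ℝ | |x| < m} := measurableSet_lt (by fun_prop) measurable_const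
  have hh : Measurable fun x : ℝ => if |x| < m then (1 : ℝ≥0∞) else 0 :=
    Measurable.ite hms measurable_const measurable_const
  refine (lintegral_kernel_le ha ha2 hh hc hd).trans (mul_le_mul_left (le_of_eq ?_) _)
  rw [← hβ]
  have : ∀ x : ℝ, (if |x| < m then (1 : ℝ≥0∞) else 0) ^ (1 / (2 * β)) =
      (Set.Ioo (-m) m).indicator 1 x := by
    intro x
    simp only [Set.indicator_apply, Set.mem_Ioo, ← abs_lt]
    split_ifs with hx
    · simp
    · exact ENNReal.zero_rpow_of_pos (by positivity)
  simp only [this]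
  rw [lintegral_indicator_one measurableSet_Ioo, Real.volume_Ioo,
    ENNReal.ofReal_rpow_of_nonneg (by linarith) (by positivity)]
  congr 2; ring

/-- Hölder's inequality against local `L^a` averages. -/
theorem lintegral_mul_rpow_le {a : ℝ} (ha : 1 < a) (ha2 : a ≤ 2) {m N : ℝ≥0∞}
    {d K : ℝ → ℝ≥0∞} (hd : Measurable d) (hK : Measurable K) (hKN : ∀ t, K t ≤ N)
    (hKm : ∫⁻ t, K t ≤ m * N) :
    ∫⁻ t, d t * K t ^ (1 / a) ≤
      m ^ (1 - 1 / a) * (N ^ (1 / a) * (∫⁻ t, d t ^ a) ^ (1 / a)) := by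
  have ha0 : 0 < a := by linarith
  have hconj : a.HolderConjugate (a / (a - 1)) := by
    rw [Real.holderConjugate_iff]
    refine ⟨ha, ?_⟩
    have : a - 1 ≠ 0 := by linarith
    field_simp
    ring
  have hq1 : 1 ≤ 1 / (a - 1) := by rw [le_div_iff₀ (by linarith)]; linarith
  refine (ENNReal.lintegral_mul_le_Lp_mul_Lq volume hconj hd.aemeasurable
    (hK.pow_const (1 / a)).aemeasurable).trans ?_
  have h1 : ∫⁻ t, (K t ^ (1 / a)) ^ (a / (a - 1)) ≤ N ^ (1 / (a - 1)) * m := by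
    have : ∀ t, (K t ^ (1 / a)) ^ (a / (a - 1)) ≤ N ^ (1 / (a - 1) - 1) * K t := fun t => by
      rw [← ENNReal.rpow_mul, show 1 / a * (a / (a - 1)) = (1 / (a - 1) - 1) + 1 by
        field_simp; ring, ENNReal.rpow_add_of_nonneg _ _ (by linarith) zero_le_one,
        ENNReal.rpow_one]
      gcongr
      exact hKN t
    refine (lintegral_mono this).trans ?_
    rw [lintegral_const_mul _ hK]
    calc N ^ (1 / (a - 1) - 1) * ∫⁻ t, K t ≤ N ^ (1 / (a - 1) - 1) * (m * N) := by gcongr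
      _ = N ^ (1 / (a - 1) - 1 + 1) * m := by
        rw [ENNReal.rpow_add_of_nonneg _ _ (by linarith) zero_le_one, ENNReal.rpow_one]; ring
      _ = _ := by congr 2; ring
  have h2 : (∫⁻ t, (K t ^ (1 / a)) ^ (a / (a - 1))) ^ (1 / (a / (a - 1))) ≤
      m ^ (1 - 1 / a) * N ^ (1 / a) := by
    have hpos : 0 ≤ 1 / (a / (a - 1)) := by
      apply div_nonneg zero_le_one; apply div_nonneg <;> linarith
    refine (ENNReal.rpow_le_rpow h1 hpos).trans (le_of_eq ?_)
    have : a - 1 ≠ 0 := by linarith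
    rw [ENNReal.mul_rpow_of_nonneg _ _ hpos, ← ENNReal.rpow_mul, mul_comm]
    congr 2
    · field_simp
    · field_simp
  calc _ ≤ (∫⁻ t, d t ^ a) ^ (1 / a) * (m ^ (1 - 1 / a) * N ^ (1 / a)) := by gcongr
    _ = _ := by ring

end

section

variable {H : Type*} [NormedAddCommGroup H] [InnerProductSpace ℂ H]

theorem integrable_inner_prod {v w : ℝ → H} (hv : Integrable v) (hw : Integrable w) :
    Integrable (fun p : ℝ × ℝ => inner ℂ (v p.1) (w p.2)) := by
  rw [Measure.volume_eq_prod]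
  refine (hv.norm.mul_prod hw.norm).mono' ?_ ?_
  · exact (hv.1.comp_fst).inner (hw.1.comp_snd)
  · exact Eventually.of_forall fun p => norm_inner_le_norm _ _

theorem enorm_inner_le (x y : H) : ‖inner ℂ x y‖ₑ ≤ ‖x‖ₑ * ‖y‖ₑ := by
  rw [← ofReal_norm, ← ofReal_norm, ← ofReal_norm, ← ENNReal.ofReal_mul (norm_nonneg _)]
  exact ENNReal.ofReal_le_ofReal (norm_inner_le_norm _ _)

theorem inner_integral_integral [CompleteSpace H] {v w : ℝ → H} (hv : Integrable v) (hw : Integrable w) :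
    inner ℂ (∫ s, v s) (∫ t, w t) = ∫ p : ℝ × ℝ, inner ℂ (v p.1) (w p.2) := by
  rw [Measure.volume_eq_prod, integral_prod _ (by
    simpa [Measure.volume_eq_prod] using integrable_inner_prod hv hw)]
  simp only
  rw [← inner_conj_symm, ← integral_inner hv, ← integral_conj]
  refine integral_congr_ae (Eventually.of_forall fun s => ?_)
  simp only
  rw [inner_conj_symm, integral_inner hw]

theorem enorm_integral_sq_le [CompleteSpace H] {v : ℝ → H} (hv : Integrable v) :
    ‖∫ s, v s‖ₑ ^ 2 ≤ ∫⁻ p : ℝ × ℝ, ‖inner ℂ (v p.1) (v p.2)‖ₑ := by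
  have h : ‖∫ s, v s‖ₑ ^ 2 = ‖inner ℂ (∫ s, v s) (∫ s, v s)‖ₑ := by
    rw [inner_self_eq_norm_sq_to_K, ← ofReal_norm, ← ofReal_norm,
      ← ENNReal.ofReal_pow (norm_nonneg _)]
    simp
  rw [h, inner_integral_integral hv hv]
  exact enorm_integral_le_lintegral_enorm _

/-- `TT*` bound for a vector field localised at a single scale `ρ`. -/
theorem exists_enorm_integral_le_of_scale [CompleteSpace H] {a σ η β C₀ : ℝ} (ha : 1 < a) (ha2 : a ≤ 2)
    (hβ : β = 1 - 1 / a) (hβη : β = σ * (1 / 2 - η)) (hη : 0 < η) (hσ : 0 < σ) (hC₀ : 0 ≤ C₀) :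
    ∃ K : ℝ, 0 ≤ K ∧ ∀ ρ : ℝ, 0 < ρ → ∀ (v : ℝ → H) (c : ℝ → ℝ≥0∞), Integrable v →
      Measurable c → (∀ s, ‖v s‖ₑ ≤ ENNReal.ofReal (ρ ^ (-β)) * c s) →
      (∀ s s', s ≠ s' → ‖inner ℂ (v s) (v s')‖ₑ ≤
        ENNReal.ofReal (C₀ * ρ ^ (2 * σ * η) * |s' - s| ^ (-σ)) * (c s * c s')) →
      ‖∫ s, v s‖ₑ ≤ ENNReal.ofReal K * (∫⁻ s, c s ^ a) ^ (1 / a) := by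
  have hση : 0 < σ * η := by positivity
  obtain ⟨C, hC, hCt⟩ := lintegral_tail_kernel_le (σ := σ) ha ha2 (by rw [← hβ]; nlinarith)
  set K2 := (2:ℝ) ^ (2 * β) + C₀ * C with hK2
  have h2p : (0:ℝ) < 2 ^ (2 * β) := by positivity
  have hK20 : 0 ≤ K2 := by positivity
  refine ⟨K2 ^ (1 / 2 : ℝ), by positivity, fun ρ hρ v c hv hc h1 h2 => ?_⟩
  set N := (∫⁻ s, c s ^ a) ^ (1 / a) with hN
  have key : ‖∫ s, v s‖ₑ ^ 2 ≤ ENNReal.ofReal K2 * N ^ 2 := by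
    refine (enorm_integral_sq_le hv).trans ?_
    have hpt : ∀ p : ℝ × ℝ, ‖inner ℂ (v p.1) (v p.2)‖ₑ ≤
        ENNReal.ofReal (ρ ^ (-(2 * β))) * ((if |p.2 - p.1| < ρ then 1 else 0) * (c p.1 * c p.2)) +
        ENNReal.ofReal (C₀ * ρ ^ (2 * σ * η)) *
          ((if ρ ≤ |p.2 - p.1| then ENNReal.ofReal (|p.2 - p.1| ^ (-σ)) else 0) *
            (c p.1 * c p.2)) := by
      intro p
      by_cases hp : |p.2 - p.1| < ρ
      · rw [if_pos hp, if_neg (not_le.2 hp), zero_mul, mul_zero, add_zero, one_mul]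
        refine (enorm_inner_le _ _).trans ((mul_le_mul' (h1 _) (h1 _)).trans (le_of_eq ?_))
        rw [show -(2 * β) = -β + -β by ring, Real.rpow_add hρ,
          ENNReal.ofReal_mul (by positivity)]
        ring
      · rw [if_neg hp, if_pos (not_lt.1 hp), zero_mul, mul_zero, zero_add]
        have hne : p.1 ≠ p.2 := by
          rintro h; rw [h] at hp; simp at hp; linarith
        refine (h2 _ _ hne).trans (le_of_eq ?_)
        rw [ENNReal.ofReal_mul (by positivity)]
        ring
    refine (lintegral_mono hpt).trans ?_
    have hms : MeasurableSet {p : ℝ × ℝ | |p.2 - p.1| < ρ} :=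
      measurableSet_lt (by fun_prop) (by fun_prop)
    have hms' : MeasurableSet {p : ℝ × ℝ | ρ ≤ |p.2 - p.1|} :=
      measurableSet_le (by fun_prop) (by fun_prop)
    have hm1 : Measurable fun p : ℝ × ℝ =>
        ((if |p.2 - p.1| < ρ then 1 else 0 : ℝ≥0∞) * (c p.1 * c p.2)) :=
      (Measurable.ite hms (by fun_prop) (by fun_prop)).mul (by fun_prop)
    have hm2 : Measurable fun p : ℝ × ℝ =>
        ((if ρ ≤ |p.2 - p.1| then ENNReal.ofReal (|p.2 - p.1| ^ (-σ)) else 0 : ℝ≥0∞) *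
          (c p.1 * c p.2)) :=
      (Measurable.ite hms' (by fun_prop) (by fun_prop)).mul (by fun_prop)
    rw [lintegral_add_left (hm1.const_mul _), lintegral_const_mul _ hm1, lintegral_const_mul _ hm2,
      hK2, ENNReal.ofReal_add h2p.le (by positivity), add_mul]
    refine add_le_add ?_ ?_
    · refine (mul_le_mul_right (lintegral_ball_kernel_le ha ha2 hρ hc hc) _).trans (le_of_eq ?_)
      rw [← hN, ← hβ, ← mul_assoc, ← ENNReal.ofReal_mul (by positivity), sq]
      congr 2
      rw [Real.mul_rpow (by norm_num) hρ.le, Real.rpow_neg hρ.le]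
      field_simp
    · refine (mul_le_mul_right (hCt ρ hρ c c hc hc) _).trans (le_of_eq ?_)
      rw [← hN, ← hβ, ← mul_assoc, ← ENNReal.ofReal_mul (by positivity), sq]
      congr 2
      have : ρ ^ (2 * σ * η) * ρ ^ (2 * β - σ) = 1 := by
        rw [← Real.rpow_add hρ, hβη]
        ring_nf
        exact Real.rpow_zero _
      linear_combination C₀ * C * this
  have := ENNReal.rpow_le_rpow key (by norm_num : (0:ℝ) ≤ 1 / 2)
  rw [ENNReal.mul_rpow_of_nonneg _ _ (by norm_num), ← ENNReal.rpow_natCast,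
    ← ENNReal.rpow_natCast, ← ENNReal.rpow_mul, ← ENNReal.rpow_mul,
    ENNReal.ofReal_rpow_of_nonneg hK20 (by norm_num)] at this
  norm_num at this
  convert this using 3

end

section

variable {H : Type*} [NormedAddCommGroup H] [InnerProductSpace ℂ H]

/-- The strict upper triangle `{(s, t) | s < t}`. -/
def triangle : Set (ℝ × ℝ) := {p | p.1 < p.2}

theorem measurableSet_triangle : MeasurableSet triangle :=
  measurableSet_lt measurable_fst measurable_snd

theorem enorm_setIntegral_near_le [CompleteSpace H] {v w : ℝ → H} (hv : Integrable v)
    (hw : Integrable w) (m : ℝ) :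
    ‖∫ p in triangle ∩ {p : ℝ × ℝ | p.2 - p.1 < m}, inner ℂ (v p.1) (w p.2)‖ₑ ≤
      ∫⁻ t, ‖∫ s in Set.Ioo (t - m) t, v s‖ₑ * ‖w t‖ₑ := by
  have hS : MeasurableSet (triangle ∩ {p : ℝ × ℝ | p.2 - p.1 < m}) :=
    measurableSet_triangle.inter (measurableSet_lt (by fun_prop) (by fun_prop))
  have hintg := (integrable_inner_prod hv hw).indicator hS
  rw [← integral_indicator hS]
  rw [Measure.volume_eq_prod] at hintg ⊢
  rw [integral_prod_symm _ hintg]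
  refine (enorm_integral_le_lintegral_enorm _).trans (lintegral_mono fun t => ?_)
  have : ∫ s, (triangle ∩ {p : ℝ × ℝ | p.2 - p.1 < m}).indicator
      (fun p => inner ℂ (v p.1) (w p.2)) (s, t) =
      inner ℂ (∫ s in Set.Ioo (t - m) t, v s) (w t) := by
    rw [← inner_conj_symm, ← integral_inner hv.integrableOn, ← integral_conj,
      ← integral_indicator measurableSet_Ioo]
    refine integral_congr_ae (Eventually.of_forall fun s => ?_)
    simp only [Set.indicator_apply, triangle, Set.mem_inter_iff, Set.mem_ofPred_eq, Set.mem_Ioo,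
      inner_conj_symm]
    congr 1
    apply propext
    constructor
    · rintro ⟨h1, h2⟩; exact ⟨by linarith, h1⟩
    · rintro ⟨h1, h2⟩; exact ⟨h2, by linarith⟩
  rw [this]
  exact enorm_inner_le _ _

theorem exists_enorm_triangle_le_of_scale_le [CompleteSpace H] {a σ η β C₀ : ℝ} (ha : 1 < a)
    (ha2 : a ≤ 2) (hβ : β = 1 - 1 / a) (hβη : β = σ * (1 / 2 - η)) (hη : 0 < η) (hσ : 0 < σ)
    (hC₀ : 0 ≤ C₀) :
    ∃ K : ℝ, 0 ≤ K ∧ ∀ ρ ρ' : ℝ, 0 < ρ → ρ ≤ ρ' → ∀ (v w : ℝ → H) (c d : ℝ → ℝ≥0∞),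
      Integrable v → Integrable w → Measurable c → Measurable d →
      (∀ s, ‖v s‖ₑ ≤ ENNReal.ofReal (ρ ^ (-β)) * c s) →
      (∀ s, ‖w s‖ₑ ≤ ENNReal.ofReal (ρ' ^ (-β)) * d s) →
      (∀ s s', s ≠ s' → ‖inner ℂ (v s) (v s')‖ₑ ≤
        ENNReal.ofReal (C₀ * ρ ^ (2 * σ * η) * |s' - s| ^ (-σ)) * (c s * c s')) →
      (∀ s t, s ≠ t → ‖inner ℂ (v s) (w t)‖ₑ ≤
        ENNReal.ofReal (C₀ * (ρ * ρ') ^ (σ * η) * |t - s| ^ (-σ)) * (c s * d t)) →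
      ‖∫ p in triangle, inner ℂ (v p.1) (w p.2)‖ₑ ≤
        ENNReal.ofReal (K * (ρ / ρ') ^ min (β / 4) (σ * η / 2)) *
          ((∫⁻ s, c s ^ a) ^ (1 / a) * (∫⁻ s, d s ^ a) ^ (1 / a)) := by
  have hση : 0 < σ * η := by positivity
  have ha0 : 0 < a := by linarith
  have hβ0 : 0 < β := by
    rw [hβ]; have : 1 / a < 1 := by rw [div_lt_one ha0]; exact ha
    linarith
  obtain ⟨C, hC, hCt⟩ := lintegral_tail_kernel_le (σ := σ) ha ha2 (by rw [← hβ]; nlinarith)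
  obtain ⟨K, hK, hKv⟩ := exists_enorm_integral_le_of_scale (H := H) ha ha2 hβ hβη hη hσ hC₀
  refine ⟨K + C₀ * C, by positivity, fun ρ ρ' hρ hρρ v w c d hv hw hc hd h1 h2 h3 h4 => ?_⟩
  have hρ' : 0 < ρ' := hρ.trans_le hρρ
  set m := ρ ^ (1 / 4 : ℝ) * ρ' ^ (3 / 4 : ℝ) with hm
  have hm0 : 0 < m := by positivity
  set Nc := (∫⁻ s, c s ^ a) ^ (1 / a) with hNc
  set Nd := (∫⁻ s, d s ^ a) ^ (1 / a) with hNd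
  have hSm : MeasurableSet {p : ℝ × ℝ | p.2 - p.1 < m} :=
    measurableSet_lt (by fun_prop) (by fun_prop)
  have hsplit : ∫ p in triangle, inner ℂ (v p.1) (w p.2) =
      (∫ p in triangle ∩ {p : ℝ × ℝ | p.2 - p.1 < m}, inner ℂ (v p.1) (w p.2)) +
      ∫ p in triangle \ {p : ℝ × ℝ | p.2 - p.1 < m}, inner ℂ (v p.1) (w p.2) :=
    (integral_inter_add_sdiff hSm (integrable_inner_prod hv hw).integrableOn).symm
  have hr01 : ρ / ρ' ≤ 1 := by rw [div_le_one hρ']; exact hρρ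
  have hr0 : 0 < ρ / ρ' := by positivity
  -- the part near the diagonal
  have hnear : ‖∫ p in triangle ∩ {p : ℝ × ℝ | p.2 - p.1 < m}, inner ℂ (v p.1) (w p.2)‖ₑ ≤
      ENNReal.ofReal (K * (ρ / ρ') ^ (β / 4)) * (Nc * Nd) := by
    refine (enorm_setIntegral_near_le hv hw m).trans ?_
    have hJ : ∀ t, ‖∫ s in Set.Ioo (t - m) t, v s‖ₑ ≤ ENNReal.ofReal K *
        (∫⁻ s in Set.Ioo (t - m) t, c s ^ a) ^ (1 / a) := by
      intro t
      have := hKv ρ hρ ((Set.Ioo (t - m) t).indicator v) ((Set.Ioo (t - m) t).indicator c)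
        (hv.indicator measurableSet_Ioo) (hc.indicator measurableSet_Ioo) (by
          intro s
          by_cases hs : s ∈ Set.Ioo (t - m) t
          · simpa [hs] using h1 s
          · simp [hs]) (by
          intro s s' hss
          by_cases hs : s ∈ Set.Ioo (t - m) t
          · by_cases hs' : s' ∈ Set.Ioo (t - m) t
            · simpa [hs, hs'] using h3 s s' hss
            · simp [hs']
          · simp [hs])
      rw [integral_indicator measurableSet_Ioo] at this
      refine this.trans (le_of_eq ?_)
      rw [← lintegral_indicator measurableSet_Ioo]
      congr 2
      refine lintegral_congr fun s => ?_
      by_cases hs : s ∈ Set.Ioo (t - m) t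
      · simp [hs]
      · simp [hs, ha0]
    set Kf : ℝ → ℝ≥0∞ := fun t => ∫⁻ s in Set.Ioo (t - m) t, c s ^ a with hKf
    have hSK : MeasurableSet {q : ℝ × ℝ | q.1 - m < q.2 ∧ q.2 < q.1} :=
      (measurableSet_lt (measurable_fst.sub_const m) measurable_snd).inter
        (measurableSet_lt measurable_snd measurable_fst)
    have hKfun : ∀ t s, (Set.Ioo (t - m) t).indicator (fun s => c s ^ a) s =
        {q : ℝ × ℝ | q.1 - m < q.2 ∧ q.2 < q.1}.indicator (fun q => c q.2 ^ a) (t, s) := by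
      intro t s
      simp [Set.indicator_apply]
    have hmeas2 : Measurable ({q : ℝ × ℝ | q.1 - m < q.2 ∧ q.2 < q.1}.indicator
      (fun q => c q.2 ^ a)) := Measurable.indicator (by fun_prop) hSK
    have hKfi : ∀ t, Kf t = ∫⁻ s, {q : ℝ × ℝ | q.1 - m < q.2 ∧ q.2 < q.1}.indicator
        (fun q => c q.2 ^ a) (t, s) := by
      intro t
      rw [hKf]
      simp only
      rw [← lintegral_indicator measurableSet_Ioo]
      exact lintegral_congr fun s => hKfun t s
    have hKmeas : Measurable Kf := by
      rw [funext hKfi]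
      exact hmeas2.lintegral_prod_right'
    have hKN : ∀ t, Kf t ≤ ∫⁻ s, c s ^ a := fun t => setLIntegral_le_lintegral _ _
    have hKm : ∫⁻ t, Kf t ≤ ENNReal.ofReal m * ∫⁻ s, c s ^ a := by
      simp only [hKfi]
      rw [lintegral_lintegral_swap (f := fun t s =>
        {q : ℝ × ℝ | q.1 - m < q.2 ∧ q.2 < q.1}.indicator (fun q => c q.2 ^ a) (t, s))
        hmeas2.aemeasurable, ← lintegral_const_mul _ (by fun_prop)]
      refine lintegral_mono fun s => le_of_eq ?_
      have : ∀ t, {q : ℝ × ℝ | q.1 - m < q.2 ∧ q.2 < q.1}.indicator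
          (fun q => c q.2 ^ a) (t, s) = (Set.Ioo s (s + m)).indicator (fun _ => c s ^ a) t := by
        intro t
        simp only [Set.indicator_apply, Set.mem_ofPred_eq, Set.mem_Ioo]
        congr 1
        apply propext
        constructor
        · rintro ⟨h1, h2⟩; exact ⟨h2, by linarith⟩
        · rintro ⟨h1, h2⟩; exact ⟨by linarith, h1⟩
      simp only [this]
      rw [lintegral_indicator_const measurableSet_Ioo, Real.volume_Ioo, mul_comm]
      congr 2; ring
    calc ∫⁻ t, ‖∫ s in Set.Ioo (t - m) t, v s‖ₑ * ‖w t‖ₑ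
        ≤ ∫⁻ t, (ENNReal.ofReal K * ENNReal.ofReal (ρ' ^ (-β))) * (d t * Kf t ^ (1 / a)) := by
          refine lintegral_mono fun t => (mul_le_mul' (hJ t) (h2 t)).trans (le_of_eq ?_)
          ring
      _ = (ENNReal.ofReal K * ENNReal.ofReal (ρ' ^ (-β))) * ∫⁻ t, (d t * Kf t ^ (1 / a)) :=
          lintegral_const_mul _ (hd.mul (hKmeas.pow_const _))
      _ ≤ (ENNReal.ofReal K * ENNReal.ofReal (ρ' ^ (-β))) *
          (ENNReal.ofReal m ^ (1 - 1 / a) * (Nc * Nd)) :=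
          mul_le_mul_right (lintegral_mul_rpow_le ha ha2 hd hKmeas hKN hKm) _
      _ = _ := by
          rw [← hβ, ENNReal.ofReal_rpow_of_nonneg hm0.le hβ0.le, ← mul_assoc,
            ← ENNReal.ofReal_mul hK, ← ENNReal.ofReal_mul (by positivity), mul_assoc K]
          congr 3
          rw [hm, Real.mul_rpow (by positivity) (by positivity), ← Real.rpow_mul hρ.le,
            ← Real.rpow_mul hρ'.le, Real.div_rpow hρ.le hρ'.le, mul_left_comm,
            ← Real.rpow_add hρ', div_eq_mul_inv _ (ρ' ^ (β / 4)), ← Real.rpow_neg hρ'.le]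
          congr 2 <;> ring
  have hfar : ‖∫ p in triangle \ {p : ℝ × ℝ | p.2 - p.1 < m}, inner ℂ (v p.1) (w p.2)‖ₑ ≤
      ENNReal.ofReal (C₀ * C * (ρ / ρ') ^ (σ * η / 2)) * (Nc * Nd) := by
    refine (enorm_integral_le_lintegral_enorm _).trans ?_
    rw [← lintegral_indicator (measurableSet_triangle.diff hSm)]
    have hms' : MeasurableSet {p : ℝ × ℝ | m ≤ |p.2 - p.1|} :=
      measurableSet_le (by fun_prop) (by fun_prop)
    have hm2 : Measurable fun p : ℝ × ℝ =>
        ((if m ≤ |p.2 - p.1| then ENNReal.ofReal (|p.2 - p.1| ^ (-σ)) else 0 : ℝ≥0∞) *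
          (c p.1 * d p.2)) :=
      (Measurable.ite hms' (by fun_prop) (by fun_prop)).mul (by fun_prop)
    calc _ ≤ ∫⁻ p : ℝ × ℝ, ENNReal.ofReal (C₀ * (ρ * ρ') ^ (σ * η)) *
          ((if m ≤ |p.2 - p.1| then ENNReal.ofReal (|p.2 - p.1| ^ (-σ)) else 0 : ℝ≥0∞) *
          (c p.1 * d p.2)) := by
          refine lintegral_mono fun p => ?_
          classical
          rw [Set.indicator_apply]
          split_ifs with hp1 hp2
          · have hne : p.1 ≠ p.2 := ne_of_lt hp1.1
            refine (h4 _ _ hne).trans (le_of_eq ?_)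
            rw [ENNReal.ofReal_mul (by positivity)]
            ring
          · exfalso
            apply hp2
            have h5 : ¬ (p.2 - p.1 < m) := hp1.2
            exact (not_lt.1 h5).trans (le_abs_self _)
          · exact zero_le
          · exact zero_le
      _ ≤ ENNReal.ofReal (C₀ * (ρ * ρ') ^ (σ * η)) *
          (ENNReal.ofReal (C * m ^ (2 * (1 - 1 / a) - σ)) * (Nc * Nd)) := by
          rw [lintegral_const_mul _ hm2]
          exact mul_le_mul_right (hCt m hm0 c d hc hd) _
      _ = _ := by
          rw [← mul_assoc, ← ENNReal.ofReal_mul (by positivity)]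
          congr 2
          have : (ρ * ρ') ^ (σ * η) * m ^ (2 * (1 - 1 / a) - σ) = (ρ / ρ') ^ (σ * η / 2) := by
            rw [← hβ, show 2 * β - σ = -(2 * (σ * η)) by rw [hβη]; ring, hm,
              Real.mul_rpow (x := ρ ^ (1 / 4 : ℝ)) (by positivity) (by positivity),
              ← Real.rpow_mul hρ.le,
              ← Real.rpow_mul hρ'.le, Real.mul_rpow hρ.le hρ'.le, Real.div_rpow hρ.le hρ'.le,
              mul_mul_mul_comm, ← Real.rpow_add hρ, ← Real.rpow_add hρ',
              div_eq_mul_inv _ (ρ' ^ (σ * η / 2)), ← Real.rpow_neg hρ'.le]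
            congr 2 <;> ring
          linear_combination C₀ * C * this
  rw [hsplit]
  refine (enorm_add_le _ _).trans ((add_le_add hnear hfar).trans ?_)
  rw [← add_mul, ← ENNReal.ofReal_add (by positivity) (by positivity)]
  refine mul_le_mul_left (ENNReal.ofReal_le_ofReal ?_) _
  rw [add_mul]
  exact add_le_add
    (mul_le_mul_of_nonneg_left (Real.rpow_le_rpow_of_exponent_ge hr0 hr01 (min_le_left _ _)) hK)
    (mul_le_mul_of_nonneg_left (Real.rpow_le_rpow_of_exponent_ge hr0 hr01 (min_le_right _ _))
      (by positivity))

theorem setIntegral_triangle_reflect {v w : ℝ → H} :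
    ∫ p in triangle, inner ℂ (w (-p.1)) (v (-p.2)) =
      (starRingEnd ℂ) (∫ p in triangle, inner ℂ (v p.1) (w p.2)) := by
  have hmp : MeasurePreserving
      ((MeasurableEquiv.prodComm (α := ℝ) (β := ℝ)).trans (MeasurableEquiv.neg (ℝ × ℝ))) := by
    refine MeasurePreserving.trans (μb := (volume : Measure (ℝ × ℝ))) ?_ ?_
    · exact Measure.measurePreserving_swap
    · exact Measure.measurePreserving_neg volume
  rw [← hmp.setIntegral_preimage_emb (MeasurableEquiv.measurableEmbedding _), ← integral_conj]
  have : ((MeasurableEquiv.prodComm (α := ℝ) (β := ℝ)).trans (MeasurableEquiv.neg (ℝ × ℝ))) ⁻¹'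
      triangle = triangle := by
    ext p
    simp [triangle, MeasurableEquiv.prodComm, MeasurableEquiv.neg]
  rw [this]
  simp [MeasurableEquiv.prodComm, MeasurableEquiv.neg, inner_conj_symm]

/-- Interaction of two vector fields localised at scales `ρ` and `ρ'`: the retarded bilinear
form gains a power of the ratio of the scales. -/
theorem exists_enorm_triangle_le [CompleteSpace H] {a σ η β C₀ : ℝ} (ha : 1 < a)
    (ha2 : a ≤ 2) (hβ : β = 1 - 1 / a) (hβη : β = σ * (1 / 2 - η)) (hη : 0 < η) (hσ : 0 < σ)
    (hC₀ : 0 ≤ C₀) :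
    ∃ K : ℝ, 0 ≤ K ∧ ∀ ρ ρ' : ℝ, 0 < ρ → 0 < ρ' → ∀ (v w : ℝ → H) (c d : ℝ → ℝ≥0∞),
      Integrable v → Integrable w → Measurable c → Measurable d →
      (∀ s, ‖v s‖ₑ ≤ ENNReal.ofReal (ρ ^ (-β)) * c s) →
      (∀ s, ‖w s‖ₑ ≤ ENNReal.ofReal (ρ' ^ (-β)) * d s) →
      (∀ s s', s ≠ s' → ‖inner ℂ (v s) (v s')‖ₑ ≤
        ENNReal.ofReal (C₀ * ρ ^ (2 * σ * η) * |s' - s| ^ (-σ)) * (c s * c s')) →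
      (∀ s s', s ≠ s' → ‖inner ℂ (w s) (w s')‖ₑ ≤
        ENNReal.ofReal (C₀ * ρ' ^ (2 * σ * η) * |s' - s| ^ (-σ)) * (d s * d s')) →
      (∀ s t, s ≠ t → ‖inner ℂ (v s) (w t)‖ₑ ≤
        ENNReal.ofReal (C₀ * (ρ * ρ') ^ (σ * η) * |t - s| ^ (-σ)) * (c s * d t)) →
      ‖∫ p in triangle, inner ℂ (v p.1) (w p.2)‖ₑ ≤
        ENNReal.ofReal (K * min (ρ / ρ') (ρ' / ρ) ^ min (β / 4) (σ * η / 2)) *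
          ((∫⁻ s, c s ^ a) ^ (1 / a) * (∫⁻ s, d s ^ a) ^ (1 / a)) := by
  obtain ⟨K, hK, h⟩ := exists_enorm_triangle_le_of_scale_le (H := H) ha ha2 hβ hβη hη hσ hC₀
  refine ⟨K, hK, fun ρ ρ' hρ hρ' v w c d hv hw hc hd h1 h2 h3 h3' h4 => ?_⟩
  rcases le_total ρ ρ' with hle | hle
  · have : ρ / ρ' ≤ ρ' / ρ := by rw [div_le_div_iff₀ hρ' hρ]; nlinarith
    rw [min_eq_left this]
    exact h ρ ρ' hρ hle v w c d hv hw hc hd h1 h2 h3 h4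
  · have : ρ' / ρ ≤ ρ / ρ' := by rw [div_le_div_iff₀ hρ hρ']; nlinarith
    rw [min_eq_right this]
    have key := h ρ' ρ hρ' hle (fun x => w (-x)) (fun x => v (-x)) (fun x => d (-x))
      (fun x => c (-x)) hw.comp_neg hv.comp_neg (hd.comp measurable_neg) (hc.comp measurable_neg)
      (fun s => h2 (-s)) (fun s => h1 (-s)) (fun s s' hs => by
        have := h3' (-s) (-s') (by simpa using hs)
        rwa [show -s' - -s = -(s' - s) by ring, abs_neg] at this) (fun s t hs => by
        have := h4 (-t) (-s) (by simpa using hs.symm)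
        rw [show -s - -t = t - s by ring] at this
        rw [← inner_conj_symm, RCLike.enorm_conj, mul_comm ρ' ρ, mul_comm (d (-s))]
        exact this)
    rw [setIntegral_triangle_reflect, RCLike.enorm_conj,
      lintegral_neg_eq_self (fun x => d x ^ a), lintegral_neg_eq_self (fun x => c x ^ a)] at key
    rwa [mul_comm ((∫⁻ s, c s ^ a) ^ (1 / a))]

end

section

variable {d : ℕ}
variable {H : Type*} [NormedAddCommGroup H] [InnerProductSpace ℂ H]

/-- Bounded measurable functions on space-time with bounded support. -/
structure Nice (F : ℝ → Ed d → ℂ) : Prop where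
  meas : Measurable (Function.uncurry F)
  bdd : ∃ M : ℝ, 0 ≤ M ∧ ∀ s x, ‖F s x‖ ≤ M
  supp : ∃ R : ℝ, 0 ≤ R ∧ ∀ s x, F s x ≠ 0 → |s| ≤ R ∧ ‖x‖ ≤ R

/-- Restriction of a space-time function to a set. -/
def cut (S : Set (ℝ × Ed d)) (F : ℝ → Ed d → ℂ) : ℝ → Ed d → ℂ :=
  fun s x => S.indicator (Function.uncurry F) (s, x)

open Classical in
theorem cut_apply (S : Set (ℝ × Ed d)) (F : ℝ → Ed d → ℂ) (s : ℝ) (x : Ed d) :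
    cut S F s x = if (s, x) ∈ S then F s x else 0 := by
  simp [cut, Set.indicator_apply]

theorem norm_cut_le (S : Set (ℝ × Ed d)) (F : ℝ → Ed d → ℂ) (s : ℝ) (x : Ed d) :
    ‖cut S F s x‖ ≤ ‖F s x‖ := by
  classical
  rw [cut_apply]; split_ifs <;> simp

theorem enorm_cut_le (S : Set (ℝ × Ed d)) (F : ℝ → Ed d → ℂ) (s : ℝ) (x : Ed d) :
    ‖cut S F s x‖ₑ ≤ ‖F s x‖ₑ := by
  classical
  rw [cut_apply]; split_ifs <;> simp

theorem Nice.restrict {F : ℝ → Ed d → ℂ} (hF : Nice F) {S : Set (ℝ × Ed d)} (hS : MeasurableSet S) :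
    Nice (cut S F) := by
  obtain ⟨M, hM0, hM⟩ := hF.bdd
  obtain ⟨R, hR0, hR⟩ := hF.supp
  refine ⟨hF.meas.indicator hS, ⟨M, hM0, fun s x => (norm_cut_le _ _ _ _).trans (hM s x)⟩,
    ⟨R, hR0, fun s x h => hR s x fun h0 => h ?_⟩⟩
  have := norm_cut_le S F s x
  rw [h0, norm_zero] at this
  exact norm_le_zero_iff.1 this

theorem Nice.measurable_left {F : ℝ → Ed d → ℂ} (hF : Nice F) (s : ℝ) : Measurable (F s) :=
  hF.meas.comp measurable_prodMk_left

theorem Nice.memLp {F : ℝ → Ed d → ℂ} (hF : Nice F) (s : ℝ) (p : ℝ≥0∞) :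
    MemLp (F s) p volume := by
  obtain ⟨M, hM0, hM⟩ := hF.bdd
  obtain ⟨R, hR0, hR⟩ := hF.supp
  have h1 : MemLp (F s) p (volume.restrict (Metric.closedBall 0 R)) := by
    have : IsFiniteMeasure (volume.restrict (Metric.closedBall (0 : Ed d) R)) :=
      ⟨by simpa using measure_closedBall_lt_top⟩
    exact MemLp.of_bound (hF.measurable_left s).aestronglyMeasurable M
      (Eventually.of_forall fun x => hM s x)
  have h2 := (memLp_indicator_iff_restrict (Metric.isClosed_closedBall.measurableSet)).2 h1
  convert h2 using 1
  rw [Set.indicator_eq_self.2]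
  intro x hx
  simpa using (hR s x hx).2

open Classical in
/-- The class in `L²` of a function, with value `0` if the function is not in `L²`. -/
def toL2 (f : Ed d → ℂ) : Lp ℂ 2 (volume : Measure (Ed d)) :=
  if h : MemLp f 2 volume then h.toLp f else 0

theorem toL2_eq {f : Ed d → ℂ} (h : MemLp f 2 volume) : toL2 f = h.toLp f := by
  simp [toL2, h]

theorem toL2_add {f g : Ed d → ℂ} (hf : MemLp f 2 volume) (hg : MemLp g 2 volume) :
    toL2 (fun x => f x + g x) = toL2 f + toL2 g := by
  rw [toL2_eq hf, toL2_eq hg, show toL2 (fun x => f x + g x) = (hf.add hg).toLp _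
    from toL2_eq (hf.add hg)]
  rfl

theorem toL2_coe_ae {f : Ed d → ℂ} (h : MemLp f 2 volume) : toL2 f =ᵐ[volume] f := by
  rw [toL2_eq h]; exact h.coeFn_toLp

theorem enorm_toL2_le (f : Ed d → ℂ) : ‖toL2 f‖ₑ ≤ eLpNorm f 2 volume := by
  by_cases h : MemLp f 2 volume
  · rw [toL2_eq h, Lp.enorm_toLp]
  · simp [toL2, h]

/-- A family of contractions on `L²` satisfying a dispersive estimate of order `σ`. -/
structure Dispersive (σ C₀ : ℝ) (V : ℝ → Lp ℂ 2 (volume : Measure (Ed d)) →L[ℂ] H) : Prop where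
  cont : Continuous fun p : ℝ × Lp ℂ 2 (volume : Measure (Ed d)) => V p.1 p.2
  norm_le : ∀ s f, ‖V s f‖ ≤ ‖f‖
  disp : ∀ s t f g, s ≠ t → ‖inner ℂ (V s f) (V t g)‖ₑ ≤
    ENNReal.ofReal (C₀ * |t - s| ^ (-σ)) * (eLpNorm f 1 volume * eLpNorm g 1 volume)

theorem stronglyMeasurable_of_balls {α : Type*} [MeasurableSpace α] {Y : Type*} [MetricSpace Y]
    [SecondCountableTopology Y] {u : α → Y} (h : ∀ y r, MeasurableSet {a | dist (u a) y < r}) :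
    StronglyMeasurable u := by
  borelize Y
  refine Measurable.stronglyMeasurable (measurable_of_isOpen fun U hU => ?_)
  have hc : ∀ y : U, ∃ r : ℝ, 0 < r ∧ Metric.ball (y : Y) r ⊆ U := fun y =>
    Metric.isOpen_iff.1 hU y y.2
  choose r hr hrU using hc
  obtain ⟨T, hT, hTU⟩ := TopologicalSpace.isOpen_iUnion_countable
    (fun y : U => Metric.ball (y : Y) (r y)) fun _ => Metric.isOpen_ball
  have hUeq : U = ⋃ y ∈ T, Metric.ball (y : Y) (r y) := by
    rw [hTU]
    ext z
    simp only [Set.mem_iUnion]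
    exact ⟨fun hz => ⟨⟨z, hz⟩, Metric.mem_ball_self (hr _)⟩, fun ⟨y, hy⟩ => hrU y hy⟩
  rw [hUeq, Set.preimage_iUnion₂]
  exact MeasurableSet.biUnion hT fun y _ => h y (r y)

theorem stronglyMeasurable_toL2 {F : ℝ → Ed d → ℂ} (hF : Measurable (Function.uncurry F))
    (hF2 : ∀ s, MemLp (F s) 2 volume) : StronglyMeasurable fun s => toL2 (F s) := by
  have : Fact ((1 : ℝ≥0∞) ≤ 2) := ⟨by norm_num⟩
  have : SecondCountableTopology (Lp ℂ 2 (volume : Measure (Ed d))) := by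
    have : Fact ((2 : ℝ≥0∞) ≠ ∞) := ⟨by norm_num⟩
    infer_instance
  refine stronglyMeasurable_of_balls fun g r => ?_
  have hm : Measurable fun s => eLpNorm (fun x => F s x - g x) 2 volume := by
    simp only [eLpNorm_eq_lintegral_rpow_enorm_toReal (show (2:ℝ≥0∞) ≠ 0 by norm_num)
      (show (2:ℝ≥0∞) ≠ ∞ by norm_num)]
    refine Measurable.pow_const (Measurable.lintegral_prod_right'
      (f := fun p : ℝ × Ed d => ‖F p.1 p.2 - g p.2‖ₑ ^ (2:ℝ≥0∞).toReal) ?_) _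
    exact ((hF.sub ((Lp.stronglyMeasurable g).measurable.comp measurable_snd)).enorm).pow_const _
  have : {s | dist (toL2 (F s)) g < r} =
      {s | eLpNorm (fun x => F s x - g x) 2 volume < ENNReal.ofReal r} := by
    ext s
    simp only [Set.mem_ofPred_eq]
    rw [← edist_lt_ofReal, Lp.edist_def]
    have : eLpNorm (⇑(toL2 (F s)) - ⇑g) 2 volume = eLpNorm (fun x => F s x - g x) 2 volume := by
      refine eLpNorm_congr_ae ?_
      filter_upwards [toL2_coe_ae (hF2 s)] with x hx
      simp [hx]
    rw [this]
  rw [this]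
  exact measurableSet_lt hm measurable_const

/-- The vector field `s ↦ V s (F s)`. -/
def vfield (V : ℝ → Lp ℂ 2 (volume : Measure (Ed d)) →L[ℂ] H) (F : ℝ → Ed d → ℂ) (s : ℝ) : H :=
  V s (toL2 (F s))

variable {σ C₀ : ℝ} {V : ℝ → Lp ℂ 2 (volume : Measure (Ed d)) →L[ℂ] H}

theorem Dispersive.enorm_vfield_le (hV : Dispersive σ C₀ V) (F : ℝ → Ed d → ℂ) (s : ℝ) :
    ‖vfield V F s‖ₑ ≤ eLpNorm (F s) 2 volume := by
  refine le_trans ?_ (enorm_toL2_le (F s))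
  rw [← ofReal_norm, ← ofReal_norm]
  exact ENNReal.ofReal_le_ofReal (hV.norm_le _ _)

theorem Dispersive.enorm_inner_vfield_le (hV : Dispersive σ C₀ V) {F G : ℝ → Ed d → ℂ}
    (hF : Nice F) (hG : Nice G) {s t : ℝ} (hst : s ≠ t) :
    ‖inner ℂ (vfield V F s) (vfield V G t)‖ₑ ≤ ENNReal.ofReal (C₀ * |t - s| ^ (-σ)) *
      (eLpNorm (F s) 1 volume * eLpNorm (G t) 1 volume) := by
  have := hV.disp s t (toL2 (F s)) (toL2 (G t)) hst
  rwa [eLpNorm_congr_ae (toL2_coe_ae (hF.memLp s 2)),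
    eLpNorm_congr_ae (toL2_coe_ae (hG.memLp t 2))] at this

theorem measurable_eLpNorm_left {F : ℝ → Ed d → ℂ} (hF : Measurable (Function.uncurry F))
    {p : ℝ≥0∞} (hp0 : p ≠ 0) (hp : p ≠ ∞) : Measurable fun s => eLpNorm (F s) p volume := by
  simp only [eLpNorm_eq_lintegral_rpow_enorm_toReal hp0 hp]
  exact Measurable.pow_const (Measurable.lintegral_prod_right'
    (f := fun q : ℝ × Ed d => ‖F q.1 q.2‖ₑ ^ p.toReal) (hF.enorm.pow_const _)) _

theorem Nice.lintegral_eLpNorm_lt_top {F : ℝ → Ed d → ℂ} (hF : Nice F) :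
    ∫⁻ s, eLpNorm (F s) 2 volume < ∞ := by
  obtain ⟨M, hM0, hM⟩ := hF.bdd
  obtain ⟨R, hR0, hR⟩ := hF.supp
  set A : ℝ≥0∞ := volume (Metric.closedBall (0 : Ed d) R) with hA
  have hAf : A < ∞ := measure_closedBall_lt_top
  have hb : ∀ s, eLpNorm (F s) 2 volume ≤ (Set.Icc (-R) R).indicator
      (fun _ => ENNReal.ofReal M * A ^ (1 / (2:ℝ≥0∞).toReal)) s := by
    intro s
    by_cases hs : s ∈ Set.Icc (-R) R
    · rw [Set.indicator_of_mem hs]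
      have : F s = (Metric.closedBall (0 : Ed d) R).indicator (F s) := by
        rw [Set.indicator_eq_self.2]
        intro x hx
        simpa using (hR s x hx).2
      rw [this, eLpNorm_indicator_eq_eLpNorm_restrict Metric.isClosed_closedBall.measurableSet]
      refine (eLpNorm_le_of_ae_bound (Eventually.of_forall fun x => hM s x)).trans (le_of_eq ?_)
      rw [Measure.restrict_apply_univ, ← hA, mul_comm]
      simp
    · have : F s = 0 := by
        ext x
        by_contra hx
        exact hs (abs_le.1 (hR s x hx).1)
      rw [this]; simp
  refine (lintegral_mono hb).trans_lt ?_
  rw [lintegral_indicator_const measurableSet_Icc, Real.volume_Icc]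
  exact ENNReal.mul_lt_top (ENNReal.mul_lt_top ENNReal.ofReal_lt_top
    (ENNReal.rpow_lt_top_of_nonneg (by simp) hAf.ne)) ENNReal.ofReal_lt_top

theorem Dispersive.integrable_vfield (hV : Dispersive σ C₀ V) {F : ℝ → Ed d → ℂ} (hF : Nice F) :
    Integrable (vfield V F) := by
  have hm : StronglyMeasurable (vfield V F) :=
    hV.cont.comp_stronglyMeasurable
      (stronglyMeasurable_id.prodMk (stronglyMeasurable_toL2 hF.meas fun s => hF.memLp s 2))
  exact ⟨hm.aestronglyMeasurable,
    (lintegral_mono fun s => hV.enorm_vfield_le F s).trans_lt hF.lintegral_eLpNorm_lt_top⟩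

theorem vfield_add {F G : ℝ → Ed d → ℂ} (hF : Nice F) (hG : Nice G) (s : ℝ) :
    vfield V (fun s x => F s x + G s x) s = vfield V F s + vfield V G s := by
  rw [vfield, toL2_add (hF.memLp s 2) (hG.memLp s 2), map_add]; rfl

/-- The retarded bilinear form. -/
def retard (V : ℝ → Lp ℂ 2 (volume : Measure (Ed d)) →L[ℂ] H) (F G : ℝ → Ed d → ℂ) : ℂ :=
  ∫ p in triangle, inner ℂ (vfield V F p.1) (vfield V G p.2)

theorem Dispersive.retard_add_left (hV : Dispersive σ C₀ V) {F F' G : ℝ → Ed d → ℂ}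
    (hF : Nice F) (hF' : Nice F') (hG : Nice G) :
    retard V (fun s x => F s x + F' s x) G = retard V F G + retard V F' G := by
  rw [retard, retard, retard, ← integral_add
    (integrable_inner_prod (hV.integrable_vfield hF) (hV.integrable_vfield hG)).integrableOn
    (integrable_inner_prod (hV.integrable_vfield hF') (hV.integrable_vfield hG)).integrableOn]
  simp only [vfield_add hF hF', inner_add_left]

theorem Dispersive.retard_add_right (hV : Dispersive σ C₀ V) {F F' G : ℝ → Ed d → ℂ}
    (hF : Nice F) (hF' : Nice F') (hG : Nice G) :
    retard V G (fun s x => F s x + F' s x) = retard V G F + retard V G F' := by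
  rw [retard, retard, retard, ← integral_add
    (integrable_inner_prod (hV.integrable_vfield hG) (hV.integrable_vfield hF)).integrableOn
    (integrable_inner_prod (hV.integrable_vfield hG) (hV.integrable_vfield hF')).integrableOn]
  simp only [vfield_add hF hF', inner_add_right]

theorem Dispersive.enorm_retard_le (hV : Dispersive σ C₀ V) {F G : ℝ → Ed d → ℂ}
    (hF : Nice F) (hG : Nice G) :
    ‖retard V F G‖ₑ ≤ (∫⁻ s, eLpNorm (F s) 2 volume) * ∫⁻ s, eLpNorm (G s) 2 volume := by
  have hmF := measurable_eLpNorm_left hF.meas (p := 2) (by norm_num) (by norm_num)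
  have hmG := measurable_eLpNorm_left hG.meas (p := 2) (by norm_num) (by norm_num)
  calc ‖retard V F G‖ₑ ≤ ∫⁻ p in triangle, ‖inner ℂ (vfield V F p.1) (vfield V G p.2)‖ₑ :=
        enorm_integral_le_lintegral_enorm _
    _ ≤ ∫⁻ p : ℝ × ℝ, eLpNorm (F p.1) 2 volume * eLpNorm (G p.2) 2 volume :=
        (setLIntegral_le_lintegral _ _).trans (lintegral_mono fun p =>
          (enorm_inner_le _ _).trans (mul_le_mul' (hV.enorm_vfield_le _ _)
            (hV.enorm_vfield_le _ _)))
    _ = _ := by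
        rw [Measure.volume_eq_prod, lintegral_prod_mul
          (f := fun s => eLpNorm (F s) 2 volume) (g := fun s => eLpNorm (G s) 2 volume)
          hmF.aemeasurable hmG.aemeasurable]

end

section

variable {d : ℕ}
variable {H : Type*} [NormedAddCommGroup H] [InnerProductSpace ℂ H]

theorem sum_rpow_le_rpow_sum {ι : Type*} (s : Finset ι) (x : ι → ℝ≥0∞) {p : ℝ} (hp : 1 ≤ p) :
    ∑ i ∈ s, x i ^ p ≤ (∑ i ∈ s, x i) ^ p := by
  classical
  induction s using Finset.induction_on with
  | empty => simp
  | insert i s hi ih =>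
    rw [Finset.sum_insert hi, Finset.sum_insert hi]
    exact (add_le_add_right ih _).trans (ENNReal.add_rpow_le_rpow_add _ _ hp)

/-- Schur's test with a symmetric kernel, for finite sums. -/
theorem sum_sum_schur_le (s : Finset ℕ) (κ : ℕ → ℕ → ℝ≥0∞) (u w : ℕ → ℝ≥0∞) (S : ℝ≥0∞)
    (h1 : ∀ j ∈ s, ∑ l ∈ s, κ j l ≤ S) (h2 : ∀ l ∈ s, ∑ j ∈ s, κ j l ≤ S) :
    ∑ j ∈ s, ∑ l ∈ s, κ j l * (u j * w l) ≤
      S * ((∑ j ∈ s, u j ^ (2:ℝ)) ^ (1 / 2 : ℝ) * (∑ l ∈ s, w l ^ (2:ℝ)) ^ (1 / 2 : ℝ)) := by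
  have hh := ENNReal.inner_le_Lp_mul_Lq (s ×ˢ s) (fun p => κ p.1 p.2 ^ (1 / 2 : ℝ) * u p.1)
    (fun p => κ p.1 p.2 ^ (1 / 2 : ℝ) * w p.2) (p := 2) (q := 2)
    (by rw [Real.holderConjugate_iff]; norm_num)
  have hsq : ∀ x : ℝ≥0∞, (x ^ (1 / 2 : ℝ)) ^ (2:ℝ) = x := fun x => by
    rw [← ENNReal.rpow_mul]; norm_num
  have hsq' : ∀ x : ℝ≥0∞, x ^ (1 / 2 : ℝ) * x ^ (1 / 2 : ℝ) = x := fun x => by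
    rw [← ENNReal.rpow_add_of_nonneg _ _ (by norm_num) (by norm_num)]; norm_num
  have hA : ∑ p ∈ s ×ˢ s, (κ p.1 p.2 ^ (1 / 2 : ℝ) * u p.1) ^ (2:ℝ) ≤
      S * ∑ j ∈ s, u j ^ (2:ℝ) := by
    rw [Finset.sum_product, Finset.mul_sum]
    refine Finset.sum_le_sum fun j hj => ?_
    simp only [ENNReal.mul_rpow_of_nonneg _ _ (show (0:ℝ) ≤ 2 by norm_num), hsq]
    rw [← Finset.sum_mul]
    exact mul_le_mul_left (h1 j hj) _
  have hB : ∑ p ∈ s ×ˢ s, (κ p.1 p.2 ^ (1 / 2 : ℝ) * w p.2) ^ (2:ℝ) ≤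
      S * ∑ j ∈ s, w j ^ (2:ℝ) := by
    rw [Finset.sum_product_right, Finset.mul_sum]
    refine Finset.sum_le_sum fun j hj => ?_
    simp only [ENNReal.mul_rpow_of_nonneg _ _ (show (0:ℝ) ≤ 2 by norm_num), hsq]
    rw [← Finset.sum_mul]
    exact mul_le_mul_left (h2 j hj) _
  calc ∑ j ∈ s, ∑ l ∈ s, κ j l * (u j * w l)
      = ∑ p ∈ s ×ˢ s, κ p.1 p.2 ^ (1 / 2 : ℝ) * u p.1 * (κ p.1 p.2 ^ (1 / 2 : ℝ) * w p.2) := by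
        rw [Finset.sum_product]
        refine Finset.sum_congr rfl fun j _ => Finset.sum_congr rfl fun l _ => ?_
        rw [mul_mul_mul_comm, hsq']
    _ ≤ _ := hh
    _ ≤ (S * ∑ j ∈ s, u j ^ (2:ℝ)) ^ (1 / 2 : ℝ) * (S * ∑ j ∈ s, w j ^ (2:ℝ)) ^ (1 / 2 : ℝ) := by
        gcongr
    _ = _ := by
        rw [ENNReal.mul_rpow_of_nonneg _ _ (by norm_num), ENNReal.mul_rpow_of_nonneg _ _
          (by norm_num), mul_mul_mul_comm, hsq']

theorem sum_injOn_le_tsum (s : Finset ℕ) (g : ℕ → ℕ) (hg : Set.InjOn g s) (f : ℕ → ℝ≥0∞) :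
    ∑ l ∈ s, f (g l) ≤ ∑' n, f n := by
  classical
  rw [← Finset.sum_image (f := f) hg]
  exact ENNReal.sum_le_tsum _

theorem sum_pow_dist_le (θ : ℝ≥0∞) (s : Finset ℕ) (j : ℕ) :
    ∑ l ∈ s, θ ^ ((j - l) + (l - j)) ≤ 2 * (1 - θ)⁻¹ := by
  classical
  rw [← Finset.sum_filter_add_sum_filter_not s (fun l => l ≤ j), two_mul]
  rw [← ENNReal.tsum_geometric]
  refine add_le_add (sum_injOn_le_tsum _ (fun l => (j - l) + (l - j)) ?_ _)
    (sum_injOn_le_tsum _ (fun l => (j - l) + (l - j)) ?_ _)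
  · intro x hx y hy hxy
    simp only [Finset.coe_filter, Set.mem_ofPred_eq] at hx hy
    simp only at hxy
    omega
  · intro x hx y hy hxy
    simp only [Finset.coe_filter, Set.mem_ofPred_eq] at hx hy
    simp only at hxy
    omega

theorem sum_dyadic_lt_le (δ D : ℝ≥0∞) (L : ℕ) :
    ∑ j ∈ Finset.range L, (if δ * 2 ^ j < D then δ * 2 ^ j else 0) ≤ 2 * D := by
  induction L with
  | zero => simp
  | succ L ih =>
    rw [Finset.sum_range_succ]
    split_ifs with h
    · have : ∀ n : ℕ, ∑ j ∈ Finset.range n, (if δ * 2 ^ j < D then δ * 2 ^ j else 0) ≤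
          δ * 2 ^ n := by
        intro n
        induction n with
        | zero => simp
        | succ n ihn =>
          rw [Finset.sum_range_succ, pow_succ, ← mul_assoc, mul_two]
          refine add_le_add ihn ?_
          split_ifs
          · exact le_rfl
          · exact zero_le
      calc _ ≤ δ * 2 ^ L + δ * 2 ^ L := add_le_add_left (this L) _
        _ = 2 * (δ * 2 ^ L) := (two_mul _).symm
        _ ≤ _ := mul_le_mul_right h.le _
    · simpa using ih

/-- The decreasing rearrangement of `F s` at `τ`. -/
def lev (F : ℝ → Ed d → ℂ) (τ : ℝ≥0∞) (s : ℝ) : ℝ≥0∞ :=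
  sInf {l | volume {x | l < ‖F s x‖ₑ} ≤ τ}

theorem volume_lev_lt_le (F : ℝ → Ed d → ℂ) (τ : ℝ≥0∞) (s : ℝ) :
    volume {x | lev F τ s < ‖F s x‖ₑ} ≤ τ := by
  have hne : {l | volume {x | l < ‖F s x‖ₑ} ≤ τ}.Nonempty := ⟨∞, by simp⟩
  obtain ⟨u, hu, hut, hum⟩ := exists_seq_tendsto_sInf hne (OrderBot.bddBelow _)
  have : {x | lev F τ s < ‖F s x‖ₑ} = ⋃ n, {x | u n < ‖F s x‖ₑ} := by
    ext x
    simp only [Set.mem_ofPred_eq, Set.mem_iUnion]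
    constructor
    · intro hx
      exact (hut.eventually (gt_mem_nhds hx)).exists
    · rintro ⟨n, hn⟩
      exact (sInf_le (hum n)).trans_lt hn
  rw [this, Monotone.measure_iUnion]
  · exact iSup_le fun n => hum n
  · intro m n hmn x hx
    exact (hu hmn).trans_lt hx

theorem lev_le_iff (F : ℝ → Ed d → ℂ) (τ : ℝ≥0∞) (s : ℝ) (l : ℝ≥0∞) :
    lev F τ s ≤ l ↔ volume {x | l < ‖F s x‖ₑ} ≤ τ := by
  refine ⟨fun h => (measure_mono fun x hx => ?_).trans (volume_lev_lt_le F τ s), fun h => sInf_le h⟩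
  exact h.trans_lt hx

theorem measurable_lev {F : ℝ → Ed d → ℂ} (hF : Measurable (Function.uncurry F)) (τ : ℝ≥0∞) :
    Measurable (lev F τ) := by
  refine measurable_of_Iic fun l => ?_
  have : lev F τ ⁻¹' Set.Iic l = {s | volume {x | l < ‖F s x‖ₑ} ≤ τ} := by
    ext s; exact lev_le_iff F τ s l
  rw [this]
  refine measurableSet_le ?_ measurable_const
  exact measurable_measure_prodMk_left (ν := (volume : Measure (Ed d)))
    (s := {p : ℝ × Ed d | l < ‖F p.1 p.2‖ₑ}) (measurableSet_lt measurable_const hF.enorm)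

theorem lev_antitone (F : ℝ → Ed d → ℂ) (s : ℝ) : Antitone fun τ => lev F τ s := fun _ _ h =>
  (lev_le_iff _ _ _ _).2 ((volume_lev_lt_le _ _ _).trans h)

theorem sum_lev_rpow_le {F : ℝ → Ed d → ℂ} {b M : ℝ} (hb : 0 < b) (s : ℝ)
    (hm : Measurable (F s)) (hM : ∀ x, ‖F s x‖ ≤ M) (δ : ℝ≥0∞) (L : ℕ) :
    ∑ j ∈ Finset.range L, δ * 2 ^ j * lev F (δ * 2 ^ j) s ^ b ≤ 2 * ∫⁻ x, ‖F s x‖ₑ ^ b := by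
  have hlevfin : ∀ τ, lev F τ s ≠ ∞ := fun τ => by
    refine ne_top_of_le_ne_top (ENNReal.ofReal_ne_top (r := M)) ((lev_le_iff _ _ _ _).2 ?_)
    have : {x | ENNReal.ofReal M < ‖F s x‖ₑ} = ∅ := by
      ext x
      simp only [Set.mem_ofPred_eq, Set.mem_empty_iff_false, iff_false, not_lt]
      rw [← ofReal_norm]
      exact ENNReal.ofReal_le_ofReal (hM x)
    rw [this]; simp
  set ν : Measure ℝ := ∑ j ∈ Finset.range L,
    (δ * 2 ^ j) • Measure.dirac (lev F (δ * 2 ^ j) s).toReal with hν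
  have h1 := lintegral_rpow_eq_lintegral_meas_lt_mul ν (f := fun x => |x|)
    (Eventually.of_forall fun x => abs_nonneg x) (by fun_prop) hb
  have h2 := lintegral_rpow_eq_lintegral_meas_lt_mul (volume : Measure (Ed d))
    (f := fun x => ‖F s x‖) (Eventually.of_forall fun x => norm_nonneg _)
    (hm.norm.aemeasurable) hb
  have e1 : ∫⁻ x, ENNReal.ofReal (|x| ^ b) ∂ν =
      ∑ j ∈ Finset.range L, δ * 2 ^ j * lev F (δ * 2 ^ j) s ^ b := by
    rw [hν, lintegral_finsetSum_measure]
    refine Finset.sum_congr rfl fun j _ => ?_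
    rw [lintegral_smul_measure, lintegral_dirac' _ (by fun_prop), abs_of_nonneg
      ENNReal.toReal_nonneg, ← ENNReal.ofReal_rpow_of_nonneg ENNReal.toReal_nonneg hb.le,
      ENNReal.ofReal_toReal (hlevfin _), smul_eq_mul]
  have e2 : ∫⁻ x, ENNReal.ofReal (‖F s x‖ ^ b) = ∫⁻ x, ‖F s x‖ₑ ^ b := by
    refine lintegral_congr fun x => ?_
    rw [← ofReal_norm, ENNReal.ofReal_rpow_of_nonneg (norm_nonneg _) hb.le]
  rw [← e1, ← e2, h1, h2, mul_left_comm 2]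
  refine mul_le_mul_right ?_ _
  rw [← lintegral_const_mul' _ _ (by norm_num)]
  refine setLIntegral_mono' measurableSet_Ioi fun t ht => ?_
  rw [← mul_assoc]
  refine mul_le_mul_left (le_trans ?_ (sum_dyadic_lt_le δ (volume {x | t < ‖F s x‖}) L)) _
  rw [hν, Measure.finsetSum_apply]
  refine Finset.sum_le_sum fun j _ => ?_
  have hms : MeasurableSet {x : ℝ | t < |x|} := measurableSet_lt measurable_const (by fun_prop)
  rw [Measure.smul_apply, Measure.dirac_apply' _ hms, Set.indicator_apply]
  have htp : 0 < t := ht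
  have heq : {x | t < ‖F s x‖} = {x | ENNReal.ofReal t < ‖F s x‖ₑ} := by
    ext x
    simp only [Set.mem_ofPred_eq]
    rw [← ofReal_norm, ENNReal.ofReal_lt_ofReal_iff_of_nonneg htp.le]
  split_ifs with h3 h4 h4
  · simp
  · exfalso
    apply h4
    rw [heq]
    by_contra hcon
    have := (lev_le_iff F _ s _).2 (not_lt.1 hcon)
    have h5 : t < (lev F (δ * 2 ^ j) s).toReal := by
      simpa [abs_of_nonneg ENNReal.toReal_nonneg] using h3
    exact absurd (ENNReal.toReal_le_of_le_ofReal htp.le this) (not_le.2 h5)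
  · simp
  · simp

end

section

variable {d : ℕ}
variable {H : Type*} [NormedAddCommGroup H] [InnerProductSpace ℂ H]
variable {σ C₀ : ℝ} {V : ℝ → Lp ℂ 2 (volume : Measure (Ed d)) →L[ℂ] H}

/-- The mixed norm `L^a_t L^b_x` for finite exponents. -/
def nrm (a b : ℝ) (F : ℝ → Ed d → ℂ) : ℝ≥0∞ :=
  (∫⁻ s, (∫⁻ x, ‖F s x‖ₑ ^ b) ^ (a / b)) ^ (1 / a)

theorem measurable_lintegral_enorm_rpow {F : ℝ → Ed d → ℂ} (hF : Measurable (Function.uncurry F))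
    (b : ℝ) : Measurable fun s => ∫⁻ x, ‖F s x‖ₑ ^ b :=
  Measurable.lintegral_prod_right' (f := fun q : ℝ × Ed d => ‖F q.1 q.2‖ₑ ^ b)
    (hF.enorm.pow_const _)

theorem eLpNorm_le_of_support_le {f : Ed d → ℂ} {l τ : ℝ≥0∞} {A : Set (Ed d)}
    (hf : ∀ x, ‖f x‖ₑ ≤ l) (hA : ∀ x, f x ≠ 0 → x ∈ A) (hτ : volume A ≤ τ) {p : ℝ≥0∞}
    (hp0 : p ≠ 0) (hp : p ≠ ∞) : eLpNorm f p volume ≤ l * τ ^ (1 / p.toReal) := by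
  have hpp : 0 < p.toReal := ENNReal.toReal_pos hp0 hp
  rw [eLpNorm_eq_lintegral_rpow_enorm_toReal hp0 hp]
  have : ∫⁻ x, ‖f x‖ₑ ^ p.toReal ≤ l ^ p.toReal * τ := by
    calc _ ≤ ∫⁻ x, A.indicator (fun _ => l ^ p.toReal) x := by
          refine lintegral_mono fun x => ?_
          by_cases hx : f x = 0
          · simp [hx, hpp]
          · rw [Set.indicator_of_mem (hA x hx)]
            exact ENNReal.rpow_le_rpow (hf x) hpp.le
      _ ≤ _ := (lintegral_indicator_const_le _ _).trans (mul_le_mul_right hτ _)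
  refine (ENNReal.rpow_le_rpow this (by positivity)).trans (le_of_eq ?_)
  rw [ENNReal.mul_rpow_of_nonneg _ _ (by positivity), ← ENNReal.rpow_mul,
    mul_one_div_cancel hpp.ne', ENNReal.rpow_one]

def atomSet (F : ℝ → Ed d → ℂ) (δ : ℝ≥0∞) (j : ℕ) : Set (ℝ × Ed d) :=
  {p | lev F (δ * 2 ^ (j + 1)) p.1 < ‖F p.1 p.2‖ₑ ∧ ‖F p.1 p.2‖ₑ ≤ lev F (δ * 2 ^ j) p.1}

def midSet (F : ℝ → Ed d → ℂ) (δ : ℝ≥0∞) (L : ℕ) : Set (ℝ × Ed d) :=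
  {p | lev F (δ * 2 ^ L) p.1 < ‖F p.1 p.2‖ₑ ∧ ‖F p.1 p.2‖ₑ ≤ lev F δ p.1}

def topSet (F : ℝ → Ed d → ℂ) (δ : ℝ≥0∞) : Set (ℝ × Ed d) :=
  {p | lev F δ p.1 < ‖F p.1 p.2‖ₑ}

theorem measurableSet_lev_lt {F : ℝ → Ed d → ℂ} (hF : Measurable (Function.uncurry F))
    (τ : ℝ≥0∞) : MeasurableSet {p : ℝ × Ed d | lev F τ p.1 < ‖F p.1 p.2‖ₑ} :=
  measurableSet_lt ((measurable_lev hF τ).comp measurable_fst) hF.enorm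

theorem measurableSet_le_lev {F : ℝ → Ed d → ℂ} (hF : Measurable (Function.uncurry F))
    (τ : ℝ≥0∞) : MeasurableSet {p : ℝ × Ed d | ‖F p.1 p.2‖ₑ ≤ lev F τ p.1} :=
  measurableSet_le hF.enorm ((measurable_lev hF τ).comp measurable_fst)

theorem measurableSet_atomSet {F : ℝ → Ed d → ℂ} (hF : Measurable (Function.uncurry F))
    (δ : ℝ≥0∞) (j : ℕ) : MeasurableSet (atomSet F δ j) :=
  (measurableSet_lev_lt hF _).inter (measurableSet_le_lev hF _)

theorem measurableSet_midSet {F : ℝ → Ed d → ℂ} (hF : Measurable (Function.uncurry F))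
    (δ : ℝ≥0∞) (j : ℕ) : MeasurableSet (midSet F δ j) :=
  (measurableSet_lev_lt hF _).inter (measurableSet_le_lev hF _)

theorem cut_midSet_succ (F : ℝ → Ed d → ℂ) (δ : ℝ≥0∞) (L : ℕ) :
    cut (midSet F δ (L + 1)) F = fun s x => cut (midSet F δ L) F s x + cut (atomSet F δ L) F s x := by
  classical
  funext s x
  simp only [cut_apply, midSet, atomSet, Set.mem_ofPred_eq]
  have h1 : lev F (δ * 2 ^ (L + 1)) s ≤ lev F (δ * 2 ^ L) s := lev_antitone F s (by
    gcongr; norm_num; omega)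
  have h2 : lev F (δ * 2 ^ L) s ≤ lev F δ s := lev_antitone F s (by
    simpa using mul_le_mul_right (one_le_pow₀ (one_le_two : (1:ℝ≥0∞) ≤ 2) (n := L)) δ)
  by_cases h3 : lev F (δ * 2 ^ L) s < ‖F s x‖ₑ
  · simp [h3, h1.trans_lt h3, not_le.2 h3]
  · have h4 := not_lt.1 h3
    simp [h3, h4, h4.trans h2]

theorem cut_midSet_zero (F : ℝ → Ed d → ℂ) (δ : ℝ≥0∞) : cut (midSet F δ 0) F = fun _ _ => 0 := by
  classical
  funext s x
  simp only [cut_apply, midSet, Set.mem_ofPred_eq, pow_zero, mul_one]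
  rw [if_neg]
  rintro ⟨h1, h2⟩
  exact absurd h1 (not_lt.2 h2)

theorem eq_cut_midSet_add {F : ℝ → Ed d → ℂ} {δ : ℝ≥0∞} {L : ℕ}
    (hL : ∀ s, lev F (δ * 2 ^ L) s = 0) :
    F = fun s x => cut (topSet F δ) F s x + cut (midSet F δ L) F s x := by
  classical
  funext s x
  simp only [cut_apply, midSet, topSet, Set.mem_ofPred_eq, hL]
  by_cases h0 : F s x = 0
  · simp [h0]
  · by_cases h3 : lev F δ s < ‖F s x‖ₑ
    · simp [h3, not_le.2 h3]
    · simp [h0, h3, not_lt.1 h3]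

theorem Nice.exists_lev_eq_zero {F : ℝ → Ed d → ℂ} (hF : Nice F) {δ : ℝ≥0∞} (hδ : δ ≠ 0) :
    ∃ L₀ : ℕ, ∀ L, L₀ ≤ L → ∀ s, lev F (δ * 2 ^ L) s = 0 := by
  obtain ⟨R, hR0, hR⟩ := hF.supp
  have hAf : volume (Metric.closedBall (0 : Ed d) R) / δ ≠ ∞ :=
    ENNReal.div_ne_top measure_closedBall_lt_top.ne hδ
  obtain ⟨L₀, hL₀⟩ := ENNReal.exists_nat_gt hAf
  refine ⟨L₀, fun L hL s => ?_⟩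
  have h2 : ((L₀ : ℕ) : ℝ≥0∞) ≤ 2 ^ L := by
    calc ((L₀ : ℕ) : ℝ≥0∞) ≤ ((2 ^ L : ℕ) : ℝ≥0∞) := by
          exact_mod_cast (hL.trans (Nat.lt_two_pow_self).le)
      _ = 2 ^ L := by push_cast; rfl
  have h3 : volume (Metric.closedBall (0 : Ed d) R) ≤ δ * 2 ^ L := by
    rw [mul_comm]
    exact (ENNReal.div_le_iff_le_mul (Or.inl hδ) (Or.inr (by simp))).1
      (hL₀.le.trans h2)
  refine le_antisymm ((lev_le_iff _ _ _ _).2 ((measure_mono fun x hx => ?_).trans h3)) zero_le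
  have : F s x ≠ 0 := by
    intro h0
    simp [h0] at hx
  simpa using (hR s x this).2

theorem Nice.lintegral_topSet_le {F : ℝ → Ed d → ℂ} (hF : Nice F) :
    ∃ K : ℝ≥0∞, K ≠ ∞ ∧ ∀ δ, ∫⁻ s, eLpNorm (cut (topSet F δ) F s) 2 volume ≤
      K * δ ^ (1 / 2 : ℝ) := by
  classical
  obtain ⟨M, hM0, hM⟩ := hF.bdd
  obtain ⟨R, hR0, hR⟩ := hF.supp
  refine ⟨ENNReal.ofReal M * ENNReal.ofReal (R - -R), by finiteness, fun δ => ?_⟩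
  have hb : ∀ s, eLpNorm (cut (topSet F δ) F s) 2 volume ≤ (Set.Icc (-R) R).indicator
      (fun _ => ENNReal.ofReal M * δ ^ (1 / 2 : ℝ)) s := by
    intro s
    by_cases hs : s ∈ Set.Icc (-R) R
    · rw [Set.indicator_of_mem hs]
      have := eLpNorm_le_of_support_le (f := cut (topSet F δ) F s) (l := ENNReal.ofReal M)
        (A := {x | lev F δ s < ‖F s x‖ₑ}) (fun x => (enorm_cut_le _ _ _ _).trans (by
          rw [← ofReal_norm]; exact ENNReal.ofReal_le_ofReal (hM s x)))
        (fun x hx => by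
          rw [cut_apply] at hx
          by_contra hcon
          exact hx (if_neg hcon)) (volume_lev_lt_le F δ s) (p := 2) (by norm_num) (by norm_num)
      simpa using this
    · have : cut (topSet F δ) F s = 0 := by
        ext x
        by_contra hx
        refine hs (abs_le.1 (hR s x fun h0 => hx ?_).1)
        simp [cut_apply, h0]
      rw [this]; simp
  refine (lintegral_mono hb).trans ?_
  rw [lintegral_indicator_const measurableSet_Icc, Real.volume_Icc]
  exact le_of_eq (by ring)

theorem Dispersive.retard_cut_midSet_left (hV : Dispersive σ C₀ V) {F G : ℝ → Ed d → ℂ}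
    (hF : Nice F) (hG : Nice G) (δ : ℝ≥0∞) (L : ℕ) :
    retard V (cut (midSet F δ L) F) G =
      ∑ j ∈ Finset.range L, retard V (cut (atomSet F δ j) F) G := by
  induction L with
  | zero =>
    rw [cut_midSet_zero, Finset.sum_range_zero]
    have h0 : Nice (fun (_ : ℝ) (_ : Ed d) => (0:ℂ)) :=
      cut_midSet_zero F δ ▸ hF.restrict (measurableSet_midSet hF.meas δ 0)
    have := hV.retard_add_left h0 h0 hG
    simpa using this
  | succ L ih =>
    rw [cut_midSet_succ, hV.retard_add_left (hF.restrict (measurableSet_midSet hF.meas δ L))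
      (hF.restrict (measurableSet_atomSet hF.meas δ L)) hG, ih, Finset.sum_range_succ]

theorem Dispersive.retard_cut_midSet_right (hV : Dispersive σ C₀ V) {F G : ℝ → Ed d → ℂ}
    (hF : Nice F) (hG : Nice G) (δ : ℝ≥0∞) (L : ℕ) :
    retard V G (cut (midSet F δ L) F) =
      ∑ j ∈ Finset.range L, retard V G (cut (atomSet F δ j) F) := by
  induction L with
  | zero =>
    rw [cut_midSet_zero, Finset.sum_range_zero]
    have h0 : Nice (fun (_ : ℝ) (_ : Ed d) => (0:ℂ)) :=
      cut_midSet_zero F δ ▸ hF.restrict (measurableSet_midSet hF.meas δ 0)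
    have := hV.retard_add_right h0 h0 hG
    simpa using this
  | succ L ih =>
    rw [cut_midSet_succ, hV.retard_add_right (hF.restrict (measurableSet_midSet hF.meas δ L))
      (hF.restrict (measurableSet_atomSet hF.meas δ L)) hG, ih, Finset.sum_range_succ]

/-- The amplitude of the `j`-th atom. -/
def amp (b : ℝ) (F : ℝ → Ed d → ℂ) (δ : ℝ≥0∞) (j : ℕ) (s : ℝ) : ℝ≥0∞ :=
  2 * ((δ * 2 ^ j) ^ (1 / b) * lev F (δ * 2 ^ j) s)

theorem measurable_amp {F : ℝ → Ed d → ℂ} (hF : Measurable (Function.uncurry F)) (b : ℝ)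
    (δ : ℝ≥0∞) (j : ℕ) : Measurable (amp b F δ j) :=
  ((measurable_lev hF _).const_mul _).const_mul _

theorem sum_lintegral_amp_le {F : ℝ → Ed d → ℂ} (hF : Nice F) {a b : ℝ} (hb : 1 ≤ b) (hba : b ≤ a)
    (δ : ℝ≥0∞) (L : ℕ) :
    ∑ j ∈ Finset.range L, ∫⁻ s, amp b F δ j s ^ a ≤
      (2 ^ a * 2 ^ (a / b)) * ∫⁻ s, (∫⁻ x, ‖F s x‖ₑ ^ b) ^ (a / b) := by
  obtain ⟨M, hM0, hM⟩ := hF.bdd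
  have hb0 : 0 < b := by linarith
  have ha0 : 0 < a := by linarith
  rw [← lintegral_finsetSum _ (fun j _ => (measurable_amp hF.meas b δ j).pow_const a),
    ← lintegral_const_mul _ ((measurable_lintegral_enorm_rpow hF.meas b).pow_const _)]
  refine lintegral_mono fun s => ?_
  have h1 : ∀ j, amp b F δ j s ^ a =
      2 ^ a * (δ * 2 ^ j * lev F (δ * 2 ^ j) s ^ b) ^ (a / b) := by
    intro j
    rw [amp, ENNReal.mul_rpow_of_nonneg _ _ ha0.le, ENNReal.mul_rpow_of_nonneg _ _ ha0.le,
      ENNReal.mul_rpow_of_nonneg (δ * 2 ^ j) _ (by positivity), ← ENNReal.rpow_mul,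
      ← ENNReal.rpow_mul, show 1 / b * a = a / b by ring, show b * (a / b) = a by field_simp]
  simp only [h1]
  rw [← Finset.mul_sum, mul_assoc, ← ENNReal.mul_rpow_of_nonneg _ _ (by positivity)]
  refine mul_le_mul_right ?_ _
  refine (sum_rpow_le_rpow_sum _ _ (by rw [one_le_div hb0]; exact hba)).trans ?_
  gcongr
  exact sum_lev_rpow_le hb0 s (hF.measurable_left s) (hM s) δ L

end

section

variable {d : ℕ}
variable {H : Type*} [NormedAddCommGroup H] [InnerProductSpace ℂ H]
variable {σ C₀ : ℝ} {V : ℝ → Lp ℂ 2 (volume : Measure (Ed d)) →L[ℂ] H}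

theorem eLpNorm_atom_le (F : ℝ → Ed d → ℂ) {b δ : ℝ} (hδ : 0 < δ) (j : ℕ) (s : ℝ)
    {p : ℝ≥0∞} (hp1 : 1 ≤ p) (hp : p ≠ ∞) :
    eLpNorm (cut (atomSet F (ENNReal.ofReal δ) j) F s) p volume ≤
      ENNReal.ofReal ((δ * 2 ^ j) ^ (1 / p.toReal - 1 / b)) * amp b F (ENNReal.ofReal δ) j s := by
  classical
  set τ : ℝ := δ * 2 ^ j with hτ
  have hτ0 : 0 < τ := by positivity
  have hτe : ENNReal.ofReal δ * 2 ^ j = ENNReal.ofReal τ := by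
    rw [hτ, ENNReal.ofReal_mul hδ.le, ENNReal.ofReal_pow (by norm_num)]; simp
  have hp1' : 1 ≤ p.toReal := by
    simpa using ENNReal.toReal_mono hp hp1
  have hple : 1 / p.toReal ≤ 1 := by rw [div_le_one (by linarith)]; exact hp1'
  have hpnn : 0 ≤ 1 / p.toReal := by positivity
  have h := eLpNorm_le_of_support_le (f := cut (atomSet F (ENNReal.ofReal δ) j) F s)
    (l := lev F (ENNReal.ofReal τ) s)
    (A := {x | lev F (ENNReal.ofReal δ * 2 ^ (j + 1)) s < ‖F s x‖ₑ}) (fun x => by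
      rw [cut_apply]
      split_ifs with hx
      · rw [← hτe]; exact hx.2
      · simp) (fun x hx => by
      rw [cut_apply] at hx
      by_contra hcon
      exact hx (if_neg fun h => hcon h.1)) (volume_lev_lt_le F _ s) (p := p)
      (by positivity) hp
  refine h.trans ?_
  rw [amp, hτe, pow_succ, ← mul_assoc, hτe, ENNReal.mul_rpow_of_nonneg _ _ hpnn,
    ENNReal.ofReal_rpow_of_pos hτ0, ENNReal.ofReal_rpow_of_pos hτ0]
  have h2 : (2:ℝ≥0∞) ^ (1 / p.toReal) ≤ 2 := by
    calc (2:ℝ≥0∞) ^ (1 / p.toReal) ≤ 2 ^ (1:ℝ) :=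
          ENNReal.rpow_le_rpow_of_exponent_le (by norm_num) hple
      _ = 2 := ENNReal.rpow_one _
  calc lev F (ENNReal.ofReal τ) s * (ENNReal.ofReal (τ ^ (1 / p.toReal)) * 2 ^ (1 / p.toReal))
      ≤ lev F (ENNReal.ofReal τ) s * (ENNReal.ofReal (τ ^ (1 / p.toReal)) * 2) := by gcongr
    _ = lev F (ENNReal.ofReal τ) s * (ENNReal.ofReal (τ ^ (1 / p.toReal - 1 / b)) *
        ENNReal.ofReal (τ ^ (1 / b)) * 2) := by
        rw [← ENNReal.ofReal_mul (by positivity), ← Real.rpow_add hτ0, sub_add_cancel]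
    _ = _ := by ring

theorem Dispersive.exists_enorm_retard_atom_le [CompleteSpace H] (hV : Dispersive σ C₀ V)
    {a b : ℝ} (ha : 1 < a) (ha2 : a ≤ 2) (hb : 1 < b)
    (hab : 1 - 1 / a = σ * (1 / b - 1 / 2)) (hσ : 0 < σ) (hC₀ : 0 ≤ C₀) :
    ∃ K θ : ℝ, 0 ≤ K ∧ 0 ≤ θ ∧ θ < 1 ∧ ∀ F G : ℝ → Ed d → ℂ, Nice F → Nice G → ∀ δ : ℝ, 0 < δ →
      ∀ j l : ℕ, ‖retard V (cut (atomSet F (ENNReal.ofReal δ) j) F)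
          (cut (atomSet G (ENNReal.ofReal δ) l) G)‖ₑ ≤
        ENNReal.ofReal K * ENNReal.ofReal θ ^ ((j - l) + (l - j)) *
          ((∫⁻ s, amp b F (ENNReal.ofReal δ) j s ^ a) ^ (1 / a) *
            (∫⁻ s, amp b G (ENNReal.ofReal δ) l s ^ a) ^ (1 / a)) := by
  have hb0 : 0 < b := by linarith
  have ha0 : 0 < a := by linarith
  set η := 1 - 1 / b with hη
  have hη0 : 0 < η := by
    rw [hη]; have : 1 / b < 1 := by rw [div_lt_one hb0]; exact hb
    linarith
  set β := 1 - 1 / a with hβ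
  have hβ0 : 0 < β := by
    rw [hβ]; have : 1 / a < 1 := by rw [div_lt_one ha0]; exact ha
    linarith
  have hβη : β = σ * (1 / 2 - η) := by rw [hab, hη]; ring
  obtain ⟨K, hK, h⟩ := exists_enorm_triangle_le (H := H) ha ha2 hβ hβη hη0 hσ hC₀
  set ε := min (β / 4) (σ * η / 2) with hε
  have hε0 : 0 < ε := lt_min (by positivity) (by positivity)
  refine ⟨K, ((2:ℝ) ^ (1 / σ))⁻¹ ^ ε, hK, by positivity, ?_, fun F G hF hG δ hδ j l => ?_⟩
  · refine Real.rpow_lt_one (by positivity) (inv_lt_one_of_one_lt₀ ?_) hε0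
    exact Real.one_lt_rpow (by norm_num) (by positivity)
  set f := cut (atomSet F (ENNReal.ofReal δ) j) F with hf
  set g := cut (atomSet G (ENNReal.ofReal δ) l) G with hg
  have hfN : Nice f := hF.restrict (measurableSet_atomSet hF.meas _ _)
  have hgN : Nice g := hG.restrict (measurableSet_atomSet hG.meas _ _)
  have hpow1 : ∀ i : ℕ, (δ * 2 ^ i) ^ ((1:ℝ) - 1 / b) = ((δ * 2 ^ i) ^ (1 / σ)) ^ (σ * η) := by
    intro i
    rw [← Real.rpow_mul (by positivity)]
    congr 1; rw [← hη]; field_simp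
  have hpow2 : ∀ i : ℕ, (δ * 2 ^ i) ^ ((1:ℝ) / 2 - 1 / b) = ((δ * 2 ^ i) ^ (1 / σ)) ^ (-β) := by
    intro i
    rw [← Real.rpow_mul (by positivity)]
    congr 1; rw [hab]; field_simp; ring
  have hf2 : ∀ (F : ℝ → Ed d → ℂ) (i : ℕ) (s : ℝ),
      ‖vfield V (cut (atomSet F (ENNReal.ofReal δ) i) F) s‖ₑ ≤
      ENNReal.ofReal (((δ * 2 ^ i) ^ (1 / σ)) ^ (-β)) * amp b F (ENNReal.ofReal δ) i s := by
    intro F i s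
    refine (hV.enorm_vfield_le _ _).trans ?_
    have := eLpNorm_atom_le F (b := b) hδ i s (p := 2) (by norm_num) (by norm_num)
    rwa [show (2:ℝ≥0∞).toReal = 2 by norm_num, hpow2] at this
  have hf1 : ∀ (F : ℝ → Ed d → ℂ) (i : ℕ) (s : ℝ),
      eLpNorm (cut (atomSet F (ENNReal.ofReal δ) i) F s) 1 volume ≤
      ENNReal.ofReal (((δ * 2 ^ i) ^ (1 / σ)) ^ (σ * η)) * amp b F (ENNReal.ofReal δ) i s := by
    intro F i s
    have := eLpNorm_atom_le F (b := b) hδ i s (p := 1) (by norm_num) (by norm_num)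
    rwa [show (1:ℝ≥0∞).toReal = 1 by norm_num, div_one, hpow1] at this
  have hdisp : ∀ (F G : ℝ → Ed d → ℂ) (i k : ℕ), Nice F → Nice G → ∀ s t : ℝ, s ≠ t →
      ‖inner ℂ (vfield V (cut (atomSet F (ENNReal.ofReal δ) i) F) s)
        (vfield V (cut (atomSet G (ENNReal.ofReal δ) k) G) t)‖ₑ ≤
      ENNReal.ofReal (C₀ * (((δ * 2 ^ i) ^ (1 / σ)) ^ (σ * η) *
        ((δ * 2 ^ k) ^ (1 / σ)) ^ (σ * η)) * |t - s| ^ (-σ)) *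
        (amp b F (ENNReal.ofReal δ) i s * amp b G (ENNReal.ofReal δ) k t) := by
    intro F G i k hF hG s t hst
    refine (hV.enorm_inner_vfield_le (hF.restrict (measurableSet_atomSet hF.meas _ _))
      (hG.restrict (measurableSet_atomSet hG.meas _ _)) hst).trans ?_
    refine (mul_le_mul_right (mul_le_mul' (hf1 F i s) (hf1 G k t)) _).trans (le_of_eq ?_)
    rw [mul_mul_mul_comm (ENNReal.ofReal _), ← mul_assoc, ← ENNReal.ofReal_mul (by positivity),
      ← ENNReal.ofReal_mul (by positivity)]
    congr 2; ring
  have key := h ((δ * 2 ^ j) ^ (1 / σ)) ((δ * 2 ^ l) ^ (1 / σ)) (by positivity) (by positivity)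
    (vfield V f) (vfield V g) (amp b F (ENNReal.ofReal δ) j) (amp b G (ENNReal.ofReal δ) l)
    (hV.integrable_vfield hfN) (hV.integrable_vfield hgN) (measurable_amp hF.meas _ _ _)
    (measurable_amp hG.meas _ _ _) (hf2 F j) (hf2 G l)
    (fun s t hst => by
      have := hdisp F F j j hF hF s t hst
      rwa [← Real.rpow_add (by positivity), show σ * η + σ * η = 2 * σ * η by ring] at this)
    (fun s t hst => by
      have := hdisp G G l l hG hG s t hst
      rwa [← Real.rpow_add (by positivity), show σ * η + σ * η = 2 * σ * η by ring] at this)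
    (fun s t hst => by
      have := hdisp F G j l hF hG s t hst
      rwa [← Real.mul_rpow (by positivity) (by positivity)] at this)
  refine key.trans (mul_le_mul_left ?_ _)
  rw [ENNReal.ofReal_mul hK, ← ENNReal.ofReal_pow (by positivity)]
  refine mul_le_mul_right (ENNReal.ofReal_le_ofReal ?_) _
  rw [← Real.rpow_natCast (((2:ℝ) ^ (1 / σ))⁻¹ ^ ε), ← Real.rpow_mul (by positivity), mul_comm ε,
    Real.rpow_mul (by positivity), Real.rpow_natCast]
  refine Real.rpow_le_rpow (by positivity) ?_ hε0.le
  have hpos : (0:ℝ) < 2 ^ (1 / σ) := by positivity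
  have hratio : ∀ m n : ℕ, m ≤ n → (δ * 2 ^ m) ^ (1 / σ) / (δ * 2 ^ n) ^ (1 / σ) =
      ((2:ℝ) ^ (1 / σ))⁻¹ ^ (n - m) := by
    intro m n hmn
    obtain ⟨k, rfl⟩ := Nat.exists_eq_add_of_le hmn
    rw [Nat.add_sub_cancel_left, pow_add, ← mul_assoc,
      Real.mul_rpow (x := δ * 2 ^ m) (by positivity) (by positivity), div_mul_eq_div_div,
      div_self (by positivity), ← Real.rpow_natCast 2 k, ← Real.rpow_mul (by norm_num),
      mul_comm (k:ℝ), Real.rpow_mul (by norm_num), Real.rpow_natCast, one_div, inv_pow]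
  rcases le_total j l with hjl | hjl
  · refine (min_le_left _ _).trans (le_of_eq ?_)
    rw [hratio j l hjl, Nat.sub_eq_zero_of_le hjl, zero_add]
  · refine (min_le_right _ _).trans (le_of_eq ?_)
    rw [hratio l j hjl, Nat.sub_eq_zero_of_le hjl, add_zero]

theorem lintegral_eLpNorm_cut_le (F : ℝ → Ed d → ℂ) (S : Set (ℝ × Ed d)) :
    ∫⁻ s, eLpNorm (cut S F s) 2 volume ≤ ∫⁻ s, eLpNorm (F s) 2 volume :=
  lintegral_mono fun s => eLpNorm_mono fun x => norm_cut_le S F s x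

/-- Diagonal retarded estimate for pairs with `1 < b ≤ a`. -/
theorem Dispersive.exists_enorm_retard_le_of_atoms [CompleteSpace H] (hV : Dispersive σ C₀ V)
    {a b : ℝ} (ha2 : a ≤ 2) (hb : 1 < b) (hba : b ≤ a)
    (hab : 1 - 1 / a = σ * (1 / b - 1 / 2)) (hσ : 0 < σ) (hC₀ : 0 ≤ C₀) :
    ∃ C : ℝ≥0∞, C ≠ ∞ ∧ ∀ F G : ℝ → Ed d → ℂ, Nice F → Nice G →
      ‖retard V F G‖ₑ ≤ C * (nrm a b F * nrm a b G) := by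
  have ha : 1 < a := hb.trans_le hba
  have ha0 : 0 < a := by linarith
  obtain ⟨K, θ, hK, hθ0, hθ1, hat⟩ := hV.exists_enorm_retard_atom_le ha ha2 hb hab hσ hC₀
  set S : ℝ≥0∞ := ENNReal.ofReal K * (2 * (1 - ENNReal.ofReal θ)⁻¹) with hS
  set D : ℝ≥0∞ := (2 ^ a * 2 ^ (a / b)) ^ (1 / a) with hD
  refine ⟨S * (D * D), ?_, fun F G hF hG => ?_⟩
  · have h1 : (1 - ENNReal.ofReal θ)⁻¹ ≠ ∞ := by
      rw [ENNReal.inv_ne_top]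
      exact (tsub_pos_of_lt (ENNReal.ofReal_lt_one.2 hθ1)).ne'
    have hD' : D ≠ ∞ := by
      have hb0 : 0 < b := by linarith
      rw [hD]
      refine ENNReal.rpow_ne_top_of_nonneg (by positivity) (ENNReal.mul_ne_top ?_ ?_) <;>
      exact ENNReal.rpow_ne_top_of_nonneg (by positivity) (by norm_num)
    exact ENNReal.mul_ne_top (ENNReal.mul_ne_top (by simp) (ENNReal.mul_ne_top (by norm_num) h1))
      (ENNReal.mul_ne_top hD' hD')
  obtain ⟨KF, hKF, hKF'⟩ := hF.lintegral_topSet_le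
  obtain ⟨KG, hKG, hKG'⟩ := hG.lintegral_topSet_le
  set IF := ∫⁻ s, eLpNorm (F s) 2 volume with hIF
  set IG := ∫⁻ s, eLpNorm (G s) 2 volume with hIG
  have hIFf : IF ≠ ∞ := hF.lintegral_eLpNorm_lt_top.ne
  have hIGf : IG ≠ ∞ := hG.lintegral_eLpNorm_lt_top.ne
  have main : ∀ δ : ℝ, 0 < δ → ‖retard V F G‖ₑ ≤ S * (D * D) * (nrm a b F * nrm a b G) +
      (KF * IG + IF * KG) * ENNReal.ofReal δ ^ (1 / 2 : ℝ) := by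
    intro δ hδ
    have hδ' : ENNReal.ofReal δ ≠ 0 := by simpa using hδ
    obtain ⟨L1, hL1⟩ := hF.exists_lev_eq_zero hδ'
    obtain ⟨L2, hL2⟩ := hG.exists_lev_eq_zero hδ'
    set L := max L1 L2
    set Ft := cut (topSet F (ENNReal.ofReal δ)) F with hFt
    set Fm := cut (midSet F (ENNReal.ofReal δ) L) F with hFm
    set Gt := cut (topSet G (ENNReal.ofReal δ)) G with hGt
    set Gm := cut (midSet G (ENNReal.ofReal δ) L) G with hGm
    have hFtN : Nice Ft := hF.restrict (measurableSet_lev_lt hF.meas _)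
    have hGtN : Nice Gt := hG.restrict (measurableSet_lev_lt hG.meas _)
    have hFmN : Nice Fm := hF.restrict (measurableSet_midSet hF.meas _ _)
    have hGmN : Nice Gm := hG.restrict (measurableSet_midSet hG.meas _ _)
    have hFeq : F = fun s x => Ft s x + Fm s x := eq_cut_midSet_add (hL1 L (le_max_left _ _))
    have hGeq : G = fun s x => Gt s x + Gm s x := eq_cut_midSet_add (hL2 L (le_max_right _ _))
    have h1 : retard V F G = retard V Fm Gm + (retard V Ft G + retard V Fm Gt) := by
      calc retard V F G = retard V Ft G + retard V Fm G := by
            conv_lhs => rw [hFeq]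
            exact hV.retard_add_left hFtN hFmN hG
        _ = retard V Ft G + (retard V Fm Gt + retard V Fm Gm) := by
            congr 1
            conv_lhs => rw [hGeq]
            exact hV.retard_add_right hGtN hGmN hFmN
        _ = _ := by ring
    rw [h1]
    refine (enorm_add_le _ _).trans (add_le_add ?_ ((enorm_add_le _ _).trans ?_))
    · rw [hFm, hV.retard_cut_midSet_left hF hGmN]
      simp only [hGm]
      have : ∀ j, retard V (cut (atomSet F (ENNReal.ofReal δ) j) F)
          (cut (midSet G (ENNReal.ofReal δ) L) G) = ∑ l ∈ Finset.range L,
          retard V (cut (atomSet F (ENNReal.ofReal δ) j) F)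
            (cut (atomSet G (ENNReal.ofReal δ) l) G) := fun j =>
        hV.retard_cut_midSet_right hG (hF.restrict (measurableSet_atomSet hF.meas _ _)) _ _
      simp only [this]
      refine (enorm_sum_le _ _).trans ((Finset.sum_le_sum fun j _ =>
        (enorm_sum_le _ _).trans (Finset.sum_le_sum fun l _ => hat F G hF hG δ hδ j l)).trans ?_)
      set u := fun j => (∫⁻ s, amp b F (ENNReal.ofReal δ) j s ^ a) ^ (1 / a)
      set w := fun j => (∫⁻ s, amp b G (ENNReal.ofReal δ) j s ^ a) ^ (1 / a)
      refine (sum_sum_schur_le (Finset.range L)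
        (fun j l => ENNReal.ofReal K * ENNReal.ofReal θ ^ ((j - l) + (l - j))) u w S ?_ ?_).trans ?_
      · intro j _
        rw [← Finset.mul_sum]
        exact mul_le_mul_right (sum_pow_dist_le _ _ j) _
      · intro l _
        rw [← Finset.mul_sum]
        simp only [Nat.add_comm (_ - l)]
        exact mul_le_mul_right (sum_pow_dist_le _ _ l) _
      rw [mul_assoc S, mul_mul_mul_comm D]
      have hu : ∀ F : ℝ → Ed d → ℂ, Nice F → (∑ j ∈ Finset.range L,
          ((∫⁻ s, amp b F (ENNReal.ofReal δ) j s ^ a) ^ (1 / a)) ^ (2:ℝ)) ^ (1 / 2 : ℝ) ≤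
          D * nrm a b F := by
        intro F hF
        calc _ ≤ ((∑ j ∈ Finset.range L, ∫⁻ s, amp b F (ENNReal.ofReal δ) j s ^ a) ^
              (2 / a)) ^ (1 / 2 : ℝ) := by
              refine ENNReal.rpow_le_rpow ?_ (by norm_num)
              refine le_trans (le_of_eq ?_) (sum_rpow_le_rpow_sum _ _ (p := 2 / a)
                (by rw [le_div_iff₀ ha0]; linarith))
              refine Finset.sum_congr rfl fun j _ => ?_
              rw [← ENNReal.rpow_mul]
              congr 1; ring
          _ = (∑ j ∈ Finset.range L, ∫⁻ s, amp b F (ENNReal.ofReal δ) j s ^ a) ^ (1 / a) := by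
              rw [← ENNReal.rpow_mul]
              congr 1; ring
          _ ≤ _ := by
              rw [hD, nrm, ← ENNReal.mul_rpow_of_nonneg _ _ (by positivity)]
              exact ENNReal.rpow_le_rpow (sum_lintegral_amp_le hF hb.le hba _ L) (by positivity)
      exact mul_le_mul_right (mul_le_mul' (hu F hF) (hu G hG)) _
    · rw [add_mul]
      refine add_le_add ?_ ?_
      · refine (hV.enorm_retard_le hFtN hG).trans ((mul_le_mul_left (hKF' _) _).trans
          (le_of_eq ?_))
        ring
      · refine (hV.enorm_retard_le hFmN hGtN).trans ((mul_le_mul'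
          (lintegral_eLpNorm_cut_le _ _) (hKG' _)).trans (le_of_eq ?_))
        ring
  have hlim : Tendsto (fun n : ℕ => S * (D * D) * (nrm a b F * nrm a b G) +
      (KF * IG + IF * KG) * ENNReal.ofReal (1 / ((n:ℝ) + 1)) ^ (1 / 2 : ℝ)) atTop
      (nhds (S * (D * D) * (nrm a b F * nrm a b G) + (KF * IG + IF * KG) * 0)) := by
    refine tendsto_const_nhds.add (ENNReal.Tendsto.const_mul ?_ (Or.inr ?_))
    · have h0 : Tendsto (fun n : ℕ => ENNReal.ofReal (1 / ((n:ℝ) + 1))) atTop (nhds 0) := by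
        simpa using ENNReal.tendsto_ofReal tendsto_one_div_add_atTop_nhds_zero_nat
      have := h0.ennrpow_const (1 / 2 : ℝ)
      rwa [ENNReal.zero_rpow_of_pos (by norm_num)] at this
    · exact ENNReal.add_ne_top.2 ⟨ENNReal.mul_ne_top hKF hIGf, ENNReal.mul_ne_top hIFf hKG⟩
  rw [mul_zero, add_zero] at hlim
  exact ge_of_tendsto' hlim fun n => main _ (by positivity)

end

section

variable {d : ℕ}

theorem lintegral_enorm_rpow_cut_le_small {f : Ed d → ℂ} {h : ℝ≥0∞} {b c : ℝ} (hb : 0 < b)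
    (hbc : b < c) {g : Ed d → ℂ} (hg : ∀ x, g x ≠ 0 → g x = f x ∧ ‖f x‖ₑ ≤ h)
    (hf : Measurable f) :
    ∫⁻ x, ‖g x‖ₑ ^ c ≤ h ^ (c - b) * ∫⁻ x, ‖f x‖ₑ ^ b := by
  rw [← lintegral_const_mul _ (hf.enorm.pow_const _)]
  refine lintegral_mono fun x => ?_
  by_cases hx : g x = 0
  · simp [hx, ENNReal.zero_rpow_of_pos (hb.trans hbc)]
  · obtain ⟨h1, h2⟩ := hg x hx
    calc ‖g x‖ₑ ^ c = ‖f x‖ₑ ^ (c - b) * ‖f x‖ₑ ^ b := by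
          rw [h1, ← ENNReal.rpow_add_of_nonneg _ _ (by linarith) hb.le, sub_add_cancel]
      _ ≤ _ := by gcongr

theorem lintegral_enorm_rpow_cut_le_large {f : Ed d → ℂ} {h : ℝ≥0∞} {b c : ℝ} (hc : 0 < c)
    (hbc : c < b) {g : Ed d → ℂ} (hg : ∀ x, g x ≠ 0 → g x = f x ∧ h < ‖f x‖ₑ)
    (hf : Measurable f) :
    ∫⁻ x, ‖g x‖ₑ ^ c ≤ h ^ (c - b) * ∫⁻ x, ‖f x‖ₑ ^ b := by
  rw [← lintegral_const_mul _ (hf.enorm.pow_const _)]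
  refine lintegral_mono fun x => ?_
  by_cases hx : g x = 0
  · simp [hx, ENNReal.zero_rpow_of_pos hc]
  · obtain ⟨h1, h2⟩ := hg x hx
    have hf0 : ‖f x‖ₑ ≠ 0 := (zero_le.trans_lt h2).ne'
    calc ‖g x‖ₑ ^ c = ‖f x‖ₑ ^ (c - b) * ‖f x‖ₑ ^ b := by
          rw [h1, ← ENNReal.rpow_add _ _ hf0 enorm_ne_top, sub_add_cancel]
      _ ≤ _ := by
        refine mul_le_mul_left ?_ _
        rw [← neg_sub b c, ENNReal.rpow_neg, ENNReal.rpow_neg]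
        exact ENNReal.inv_le_inv.2 (ENNReal.rpow_le_rpow h2.le (by linarith))

theorem Nice.lintegral_rpow_ne_top {F : ℝ → Ed d → ℂ} (hF : Nice F) (s : ℝ) {b : ℝ} (hb : 0 < b) :
    ∫⁻ x, ‖F s x‖ₑ ^ b ≠ ∞ := by
  have := (hF.memLp s (ENNReal.ofReal b)).eLpNorm_lt_top
  rw [eLpNorm_eq_lintegral_rpow_enorm_toReal (by simpa using hb) (by simp),
    ENNReal.toReal_ofReal hb.le] at this
  exact ((ENNReal.rpow_lt_top_iff_of_pos (by positivity)).1 this).ne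

theorem Nice.nrm_ne_top {F : ℝ → Ed d → ℂ} (hF : Nice F) {a b : ℝ} (ha : 0 < a) (hb : 0 < b) :
    nrm a b F ≠ ∞ := by
  obtain ⟨M, hM0, hM⟩ := hF.bdd
  obtain ⟨R, hR0, hR⟩ := hF.supp
  have key : ∀ s, (∫⁻ x, ‖F s x‖ₑ ^ b) ^ (a / b) ≤ (Set.Icc (-R) R).indicator (fun _ =>
      (ENNReal.ofReal M ^ b * volume (Metric.closedBall (0 : Ed d) R)) ^ (a / b)) s := by
    intro s
    by_cases hs : s ∈ Set.Icc (-R) R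
    · rw [Set.indicator_of_mem hs]
      refine ENNReal.rpow_le_rpow ?_ (by positivity)
      rw [← lintegral_indicator_const Metric.isClosed_closedBall.measurableSet]
      refine lintegral_mono fun x => ?_
      by_cases hx : F s x = 0
      · simp [hx, hb]
      · rw [Set.indicator_of_mem (by simpa using (hR s x hx).2)]
        refine ENNReal.rpow_le_rpow ?_ hb.le
        rw [← ofReal_norm]; exact ENNReal.ofReal_le_ofReal (hM s x)
    · have : ∀ x, F s x = 0 := fun x => by
        by_contra hx
        exact hs (abs_le.1 (hR s x hx).1)
      rw [Set.indicator_of_notMem hs]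
      simp [this, hb, div_pos ha hb]
  refine ENNReal.rpow_ne_top_of_nonneg (by positivity) (ne_top_of_le_ne_top ?_ (lintegral_mono key))
  rw [lintegral_indicator_const measurableSet_Icc, Real.volume_Icc]
  have : volume (Metric.closedBall (0 : Ed d) R) ≠ ∞ := measure_closedBall_lt_top.ne
  exact ENNReal.mul_ne_top (ENNReal.rpow_ne_top_of_nonneg (by positivity) (ENNReal.mul_ne_top
    (ENNReal.rpow_ne_top_of_nonneg hb.le (by simp)) this)) (by simp)

/-- Real interpolation along the admissible line between `(1, 2)` and `(a₀, b₀)`. -/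
theorem le_nrm_of_le_nrm_of_le_nrm {Φ : (ℝ → Ed d → ℂ) → ℝ≥0∞}
    (hadd : ∀ F S, Nice F → MeasurableSet S → Φ F ≤ Φ (cut S F) + Φ (cut Sᶜ F))
    {a b a₀ b₀ σ : ℝ} {D₁ D₀ : ℝ≥0∞} (ha : 1 ≤ a) (ha₀ : 1 ≤ a₀) (hb₀ : 0 < b₀) (hb₀b : b₀ < b)
    (hb2 : b < 2) (hab : 1 - 1 / a = σ * (1 / b - 1 / 2))
    (hab₀ : 1 - 1 / a₀ = σ * (1 / b₀ - 1 / 2))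
    (h₁ : ∀ F, Nice F → Φ F ≤ D₁ * nrm 1 2 F) (h₀ : ∀ F, Nice F → Φ F ≤ D₀ * nrm a₀ b₀ F)
    {F : ℝ → Ed d → ℂ} (hF : Nice F) : Φ F ≤ (D₁ + D₀) * nrm a b F := by
  classical
  have hb : 0 < b := hb₀.trans hb₀b
  have ha0 : 0 < a := by linarith
  have ha₀0 : 0 < a₀ := by linarith
  set N := nrm a b F with hN
  have hNtop : N ≠ ∞ := hF.nrm_ne_top ha0 hb
  set J : ℝ → ℝ≥0∞ := fun s => ∫⁻ x, ‖F s x‖ₑ ^ b with hJ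
  have hJm : Measurable J := measurable_lintegral_enorm_rpow hF.meas b
  have hJtop : ∀ s, J s ≠ ∞ := fun s => hF.lintegral_rpow_ne_top s hb
  have hNa : N ^ a = ∫⁻ s, J s ^ (a / b) := by
    rw [hN, nrm, ← ENNReal.rpow_mul, one_div_mul_cancel ha0.ne', ENNReal.rpow_one]
  by_cases hN0 : N = 0
  · have h2 : ∀ᵐ s, J s = 0 := by
      have : ∫⁻ s, J s ^ (a / b) = 0 := by rw [← hNa, hN0, ENNReal.zero_rpow_of_pos ha0]
      filter_upwards [(lintegral_eq_zero_iff (hJm.pow_const _)).1 this] with s hs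
      exact ((ENNReal.rpow_eq_zero_iff_of_pos (by positivity)).1 hs)
    have h3 : nrm 1 2 F = 0 := by
      rw [nrm, ENNReal.rpow_eq_zero_iff_of_pos (by norm_num), lintegral_eq_zero_iff
        ((measurable_lintegral_enorm_rpow hF.meas 2).pow_const _)]
      filter_upwards [h2] with s hs
      have h4 := (lintegral_eq_zero_iff ((hF.measurable_left s).enorm.pow_const b)).1 hs
      have : ∫⁻ x, ‖F s x‖ₑ ^ (2:ℝ) = 0 := by
        rw [lintegral_eq_zero_iff ((hF.measurable_left s).enorm.pow_const _)]
        filter_upwards [h4] with x hx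
        have : ‖F s x‖ₑ = 0 := (ENNReal.rpow_eq_zero_iff_of_pos hb).1 hx
        simp [this]
      change (∫⁻ x, ‖F s x‖ₑ ^ (2:ℝ)) ^ ((1:ℝ) / 2) = 0
      rw [this, ENNReal.zero_rpow_of_pos (by norm_num)]
    refine (h₁ F hF).trans ?_
    rw [h3]; simp
  set e : ℝ := (2 * a - b) / (2 - b) with he
  have he0 : 0 < e := div_pos (by linarith) (by linarith)
  set x : ℝ := -(2 * (a - 1) / (2 - b)) with hx
  set h : ℝ → ℝ≥0∞ := fun s => N ^ x * J s ^ (e / b) with hh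
  have hhm : Measurable h := (hJm.pow_const _).const_mul _
  set S : Set (ℝ × Ed d) := {p | ‖F p.1 p.2‖ₑ ≤ h p.1} with hS
  have hSm : MeasurableSet S := measurableSet_le hF.meas.enorm (hhm.comp measurable_fst)
  have h2b : 2 - b ≠ 0 := by linarith
  have hσ : σ = 2 * b * (a - 1) / (a * (2 - b)) := by
    field_simp at hab ⊢; linarith
  have hrel : a * b₀ / a₀ = e * (b₀ - b) + b := by
    have : 1 / a₀ = 1 - σ * (1 / b₀ - 1 / 2) := by linarith
    rw [div_eq_mul_one_div, this, hσ, he]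
    field_simp; ring
  refine (hadd F S hF hSm).trans ?_
  rw [add_mul]
  refine add_le_add ((h₁ _ (hF.restrict hSm)).trans (mul_le_mul_right ?_ _))
    ((h₀ _ (hF.restrict hSm.compl)).trans (mul_le_mul_right ?_ _))
  · have hp : ∀ s, (∫⁻ y, ‖cut S F s y‖ₑ ^ (2:ℝ)) ^ ((1:ℝ) / 2) ≤
        N ^ (1 - a) * J s ^ (a / b) := by
      intro s
      have h5 := lintegral_enorm_rpow_cut_le_small (f := F s) (h := h s) (g := cut S F s) hb hb2
        (fun y hy => by
          rw [cut_apply] at hy ⊢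
          split_ifs at hy ⊢ with h6
          · exact ⟨rfl, h6⟩
          · exact absurd rfl hy) (hF.measurable_left s)
      refine (ENNReal.rpow_le_rpow h5 (by norm_num)).trans (le_of_eq ?_)
      change (h s ^ (2 - b) * J s) ^ ((1:ℝ) / 2) = _
      simp only [hh]
      rw [ENNReal.mul_rpow_of_nonneg (N ^ x) _ (by linarith : 0 ≤ 2 - b), ← ENNReal.rpow_mul,
        ← ENNReal.rpow_mul, mul_assoc]
      nth_rw 2 [← ENNReal.rpow_one (J s)]
      rw [← ENNReal.rpow_add_of_nonneg _ _ (mul_nonneg (by positivity) (by linarith)) (by norm_num),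
        ENNReal.mul_rpow_of_nonneg _ _ (by norm_num), ← ENNReal.rpow_mul, ← ENNReal.rpow_mul]
      congr 2
      · rw [hx]; field_simp; ring
      · rw [he]; field_simp; ring
    rw [nrm, show (1:ℝ) / 1 = 1 by norm_num, ENNReal.rpow_one]
    refine (lintegral_mono hp).trans (le_of_eq ?_)
    rw [lintegral_const_mul _ (hJm.pow_const _), ← hNa, ← ENNReal.rpow_add _ _ hN0 hNtop]
    simp
  · have hp : ∀ s, (∫⁻ y, ‖cut Sᶜ F s y‖ₑ ^ b₀) ^ (a₀ / b₀) ≤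
        N ^ (a₀ - a) * J s ^ (a / b) := by
      intro s
      have h5 := lintegral_enorm_rpow_cut_le_large (f := F s) (h := h s) (g := cut Sᶜ F s) hb₀ hb₀b
        (fun y hy => by
          rw [cut_apply] at hy ⊢
          split_ifs at hy ⊢ with h6
          · exact ⟨rfl, not_le.1 h6⟩
          · exact absurd rfl hy) (hF.measurable_left s)
      refine (ENNReal.rpow_le_rpow h5 (by positivity)).trans ?_
      change (h s ^ (b₀ - b) * J s) ^ (a₀ / b₀) ≤ _
      by_cases hJ0 : J s = 0
      · rw [hJ0, mul_zero, ENNReal.zero_rpow_of_pos (by positivity)]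
        exact zero_le
      refine le_of_eq ?_
      have hfin : N ^ x ≠ ∞ := ENNReal.rpow_ne_top_of_ne_zero hN0 hNtop
      have hJe : J s ^ (e / b) ≠ ∞ := ENNReal.rpow_ne_top_of_ne_zero hJ0 (hJtop s)
      simp only [hh]
      rw [ENNReal.mul_rpow_of_ne_top hfin hJe, ← ENNReal.rpow_mul, ← ENNReal.rpow_mul,
        mul_assoc]
      nth_rw 2 [← ENNReal.rpow_one (J s)]
      rw [← ENNReal.rpow_add _ _ hJ0 (hJtop s),
        ENNReal.mul_rpow_of_nonneg _ _ (by positivity), ← ENNReal.rpow_mul, ← ENNReal.rpow_mul]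
      congr 2
      · have : a = a₀ / b₀ * (e * (b₀ - b) + b) := by rw [← hrel]; field_simp
        have h7 : a₀ - a = a₀ * (1 - a / a₀) := by field_simp
        have h8 : a / a₀ = (e * (b₀ - b) + b) / b₀ := by rw [← hrel]; field_simp
        rw [h7, h8, hx, he]; field_simp; ring
      · have : a = a₀ / b₀ * (e * (b₀ - b) + b) := by rw [← hrel]; field_simp
        rw [this]; field_simp
    rw [nrm]
    refine (ENNReal.rpow_le_rpow (lintegral_mono hp) (by positivity)).trans (le_of_eq ?_)
    rw [lintegral_const_mul _ (hJm.pow_const _), ← hNa, ← ENNReal.rpow_add _ _ hN0 hNtop,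
      sub_add_cancel, ← ENNReal.rpow_mul, mul_one_div_cancel ha₀0.ne', ENNReal.rpow_one]

end

section

theorem lintegral_abs_lt_rpow_neg_half {m : ℝ} (hm : 0 < m) :
    ∫⁻ x : ℝ, (if |x| < m then ENNReal.ofReal (|x| ^ (-(1 / 2) : ℝ)) else 0) ≤
      ENNReal.ofReal (4 * m ^ (1 / 2 : ℝ)) := by
  have h0 : ∫⁻ x in Set.Ioc 0 m, ENNReal.ofReal (x ^ (-(1 / 2) : ℝ)) =
      ENNReal.ofReal (2 * m ^ (1 / 2 : ℝ)) := by
    rw [← ofReal_integral_eq_lintegral_ofReal]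
    · rw [← intervalIntegral.integral_of_le hm.le, integral_rpow (Or.inl (by norm_num))]
      congr 1
      rw [show (-(1 / 2) + 1 : ℝ) = 1 / 2 by norm_num, Real.zero_rpow (by norm_num)]
      ring
    · exact (intervalIntegrable_iff_integrableOn_Ioc_of_le hm.le).1
        (intervalIntegral.intervalIntegrable_rpow' (by norm_num))
    · filter_upwards [ae_restrict_mem measurableSet_Ioc] with x hx
      exact Real.rpow_nonneg hx.1.le _
  have h1 : ∀ᵐ x : ℝ, (if |x| < m then ENNReal.ofReal (|x| ^ (-(1 / 2) : ℝ)) else 0) ≤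
      (Set.Ioc 0 m).indicator (fun x => ENNReal.ofReal (x ^ (-(1 / 2) : ℝ))) x +
      (Set.Ioc 0 m).indicator (fun x => ENNReal.ofReal (x ^ (-(1 / 2) : ℝ))) (-x) := by
    filter_upwards [compl_mem_ae_iff.2 (measure_singleton (0:ℝ))] with x hx
    have hx0 : x ≠ 0 := hx
    split_ifs with h
    · rcases lt_or_gt_of_ne hx0 with h2 | h2
      · rw [abs_of_neg h2] at h ⊢
        rw [Set.indicator_of_mem (show -x ∈ Set.Ioc 0 m from ⟨by linarith, h.le⟩)]
        exact le_add_self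
      · rw [abs_of_pos h2] at h ⊢
        rw [Set.indicator_of_mem (show x ∈ Set.Ioc 0 m from ⟨by linarith, h.le⟩)]
        exact le_self_add
    · exact zero_le
  have hmeas : Measurable ((Set.Ioc 0 m).indicator
      fun x : ℝ => ENNReal.ofReal (x ^ (-(1 / 2) : ℝ))) :=
    Measurable.indicator (by fun_prop) measurableSet_Ioc
  refine (lintegral_mono_ae h1).trans ?_
  rw [lintegral_add_left hmeas, lintegral_neg_eq_self
    ((Set.Ioc 0 m).indicator (fun x => ENNReal.ofReal (x ^ (-(1 / 2) : ℝ)))),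
    lintegral_indicator measurableSet_Ioc, h0, ← ENNReal.ofReal_add (by positivity) (by positivity)]
  exact ENNReal.ofReal_le_ofReal (by linarith)

/-- The two one-variable bounds entering the Hardy–Littlewood–Sobolev inequality. -/
theorem hls_inner_le {ψ : ℝ → ℝ≥0∞} (hψ : Measurable ψ)
    (hψ1 : ∫⁻ t, ψ t ^ (4 / 3 : ℝ) ≤ 1) (s : ℝ) {y : ℝ} (hy : 0 < y) :
    ∫⁻ t, ((if y ^ (-(4 / 3) : ℝ) ≤ |t - s| then ENNReal.ofReal (|t - s| ^ (-(1 / 2) : ℝ)) else 0) *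
        (ENNReal.ofReal y * ψ t) +
      (if |t - s| < y ^ (-(4 / 3) : ℝ) then ENNReal.ofReal (|t - s| ^ (-(1 / 2) : ℝ)) else 0) *
        ENNReal.ofReal y ^ 2) ≤ 6 * ENNReal.ofReal y ^ (4 / 3 : ℝ) := by
  set ρ := y ^ (-(4 / 3) : ℝ) with hρ
  have hρ0 : 0 < ρ := by positivity
  have hk1 : Measurable fun t : ℝ => (if ρ ≤ |t - s| then
      ENNReal.ofReal (|t - s| ^ (-(1 / 2) : ℝ)) else 0) :=
    Measurable.ite (measurableSet_le (by fun_prop) (by fun_prop)) (by fun_prop) (by fun_prop)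
  have hk2 : Measurable fun t : ℝ => (if ρ ≤ |t - s| then
      ENNReal.ofReal (|t - s| ^ (-(1 / 2) : ℝ)) else 0) * (ENNReal.ofReal y * ψ t) :=
    hk1.mul (hψ.const_mul _)
  rw [lintegral_add_left hk2, lintegral_mul_const' _ _ (by simp)]
  have hA : ∫⁻ t, (if ρ ≤ |t - s| then ENNReal.ofReal (|t - s| ^ (-(1 / 2) : ℝ)) else 0) *
        (ENNReal.ofReal y * ψ t) ≤ 2 * ENNReal.ofReal y ^ (4 / 3 : ℝ) := by
    have hol := ENNReal.lintegral_mul_le_Lp_mul_Lq volume (p := 4) (q := 4 / 3)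
      (Real.holderConjugate_iff.2 ⟨by norm_num, by norm_num⟩) hk1.aemeasurable hψ.aemeasurable
    have h4 : ∫⁻ t, (if ρ ≤ |t - s| then ENNReal.ofReal (|t - s| ^ (-(1 / 2) : ℝ)) else 0) ^ (4:ℝ) =
        ENNReal.ofReal (2 * y ^ (4 / 3 : ℝ)) := by
      have : ∀ t, (if ρ ≤ |t - s| then ENNReal.ofReal (|t - s| ^ (-(1 / 2) : ℝ)) else 0) ^ (4:ℝ) =
          (fun x => if ρ ≤ |x| then ENNReal.ofReal (|x| ^ (-2 : ℝ)) else 0) (t - s) := by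
        intro t
        simp only
        split_ifs with h
        · have : 0 < |t - s| := hρ0.trans_le h
          rw [ENNReal.ofReal_rpow_of_pos (by positivity), ← Real.rpow_mul this.le]
          norm_num
        · rw [ENNReal.zero_rpow_of_pos (by norm_num)]
      simp only [this]
      rw [lintegral_sub_right_eq_self (fun x : ℝ => if ρ ≤ |x| then
        ENNReal.ofReal (|x| ^ (-2 : ℝ)) else 0) s, lintegral_abs_tail (by norm_num) hρ0, hρ,
        ← Real.rpow_mul hy.le]
      norm_num
    calc _ = ENNReal.ofReal y * ∫⁻ t, (if ρ ≤ |t - s| then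
          ENNReal.ofReal (|t - s| ^ (-(1 / 2) : ℝ)) else 0) * ψ t := by
          rw [← lintegral_const_mul' _ _ (by simp)]
          refine lintegral_congr fun t => ?_
          ring
      _ ≤ ENNReal.ofReal y * (ENNReal.ofReal (2 * y ^ (4 / 3 : ℝ)) ^ (1 / 4 : ℝ) * 1) := by
          refine mul_le_mul_right (hol.trans ?_) _
          rw [h4]
          refine mul_le_mul_right ?_ _
          exact ENNReal.rpow_le_one hψ1 (by norm_num)
      _ ≤ _ := by
          rw [mul_one, ENNReal.ofReal_rpow_of_pos (by positivity), ENNReal.ofReal_rpow_of_pos hy,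
            ← ENNReal.ofReal_mul hy.le, Real.mul_rpow (by norm_num) (by positivity),
            ← Real.rpow_mul hy.le, show (2:ℝ≥0∞) = ENNReal.ofReal 2 by simp,
            ← ENNReal.ofReal_mul (by norm_num)]
          refine ENNReal.ofReal_le_ofReal ?_
          have h2 : (2:ℝ) ^ (1 / 4 : ℝ) ≤ 2 := by
            calc (2:ℝ) ^ (1 / 4 : ℝ) ≤ 2 ^ (1:ℝ) :=
                  Real.rpow_le_rpow_of_exponent_le (by norm_num) (by norm_num)
              _ = 2 := Real.rpow_one _
          have h3 : y * y ^ (4 / 3 * (1 / 4) : ℝ) = y ^ (4 / 3 : ℝ) := by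
            nth_rw 1 [← Real.rpow_one y]
            rw [← Real.rpow_add hy]; norm_num
          calc _ = (2:ℝ) ^ (1 / 4 : ℝ) * (y * y ^ (4 / 3 * (1 / 4) : ℝ)) := by ring
            _ ≤ _ := by rw [h3]; gcongr
  have hB : (∫⁻ t, (if |t - s| < ρ then ENNReal.ofReal (|t - s| ^ (-(1 / 2) : ℝ)) else 0)) *
        ENNReal.ofReal y ^ 2 ≤ 4 * ENNReal.ofReal y ^ (4 / 3 : ℝ) := by
    rw [lintegral_sub_right_eq_self (fun x : ℝ => if |x| < ρ then
        ENNReal.ofReal (|x| ^ (-(1 / 2) : ℝ)) else 0) s]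
    refine (mul_le_mul_left (lintegral_abs_lt_rpow_neg_half hρ0) _).trans (le_of_eq ?_)
    rw [← ENNReal.ofReal_pow hy.le, ENNReal.ofReal_rpow_of_pos hy,
      ← ENNReal.ofReal_mul (by positivity), show (4:ℝ≥0∞) = ENNReal.ofReal 4 by simp,
            ← ENNReal.ofReal_mul (by norm_num), hρ, ← Real.rpow_mul hy.le, mul_assoc,
            ← Real.rpow_natCast, ← Real.rpow_add hy]
    norm_num
  refine (add_le_add hA hB).trans (le_of_eq ?_)
  rw [← add_mul]; norm_num

theorem hls_normalized {φ ψ : ℝ → ℝ} (hφ : Measurable φ) (hψ : Measurable ψ)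
    (hφ0 : ∀ s, 0 ≤ φ s) (hψ0 : ∀ s, 0 ≤ ψ s)
    (hφ1 : ∫⁻ t, ENNReal.ofReal (φ t) ^ (4 / 3 : ℝ) ≤ 1)
    (hψ1 : ∫⁻ t, ENNReal.ofReal (ψ t) ^ (4 / 3 : ℝ) ≤ 1) :
    ∫⁻ p : ℝ × ℝ, ENNReal.ofReal (|p.2 - p.1| ^ (-(1 / 2) : ℝ)) *
      (ENNReal.ofReal (φ p.1) * ENNReal.ofReal (ψ p.2)) ≤ 12 := by
  set J : (ℝ → ℝ) → (ℝ → ℝ) → ℝ × ℝ → ℝ≥0∞ := fun φ ψ p =>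
    (if φ p.1 ^ (-(4 / 3) : ℝ) ≤ |p.2 - p.1| then
      ENNReal.ofReal (|p.2 - p.1| ^ (-(1 / 2) : ℝ)) else 0) *
        (ENNReal.ofReal (φ p.1) * ENNReal.ofReal (ψ p.2)) +
      (if |p.2 - p.1| < φ p.1 ^ (-(4 / 3) : ℝ) then
        ENNReal.ofReal (|p.2 - p.1| ^ (-(1 / 2) : ℝ)) else 0) *
        ENNReal.ofReal (φ p.1) ^ 2 with hJ
  have hJm : ∀ φ ψ : ℝ → ℝ, Measurable φ → Measurable ψ → Measurable (J φ ψ) := by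
    intro φ ψ hφ hψ
    refine Measurable.add (Measurable.mul ?_ (by fun_prop)) (Measurable.mul ?_ (by fun_prop))
    · exact Measurable.ite (measurableSet_le (by fun_prop) (by fun_prop)) (by fun_prop)
        (by fun_prop)
    · exact Measurable.ite (measurableSet_lt (by fun_prop) (by fun_prop)) (by fun_prop)
        (by fun_prop)
  have hJi : ∀ φ ψ : ℝ → ℝ, Measurable φ → Measurable ψ → (∀ s, 0 ≤ φ s) →
      ∫⁻ t, ENNReal.ofReal (φ t) ^ (4 / 3 : ℝ) ≤ 1 →
      ∫⁻ t, ENNReal.ofReal (ψ t) ^ (4 / 3 : ℝ) ≤ 1 → ∫⁻ p, J φ ψ p ≤ 6 := by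
    intro φ ψ hφ hψ hφ0 hφ1 hψ1
    rw [Measure.volume_eq_prod, lintegral_prod _ (hJm φ ψ hφ hψ).aemeasurable]
    calc _ ≤ ∫⁻ s, 6 * ENNReal.ofReal (φ s) ^ (4 / 3 : ℝ) := by
          refine lintegral_mono fun s => ?_
          rcases (hφ0 s).eq_or_lt with h | h
          · simp [hJ, ← h]
          · exact hls_inner_le hψ.ennreal_ofReal hψ1 s h
      _ ≤ 6 * 1 := by
          rw [lintegral_const_mul _ (hφ.ennreal_ofReal.pow_const _)]
          exact mul_le_mul_right hφ1 _
      _ = 6 := mul_one _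
  have hpt : ∀ p : ℝ × ℝ, ENNReal.ofReal (|p.2 - p.1| ^ (-(1 / 2) : ℝ)) *
      (ENNReal.ofReal (φ p.1) * ENNReal.ofReal (ψ p.2)) ≤ J φ ψ p + J ψ φ p.swap := by
    intro p
    simp only [hJ, Prod.fst_swap, Prod.snd_swap, abs_sub_comm p.1 p.2]
    by_cases h1 : φ p.1 ^ (-(4 / 3) : ℝ) ≤ |p.2 - p.1|
    · rw [if_pos h1]
      exact le_self_add.trans le_self_add
    · by_cases h2 : ψ p.2 ^ (-(4 / 3) : ℝ) ≤ |p.2 - p.1|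
      · rw [if_pos h2, mul_comm (ENNReal.ofReal (φ p.1))]
        exact le_self_add.trans le_add_self
      · rw [if_pos (not_le.1 h1), if_pos (not_le.1 h2)]
        rcases le_total (φ p.1) (ψ p.2) with h | h
        · refine le_trans ?_ (le_add_self.trans le_add_self)
          rw [sq]; gcongr
        · refine le_trans ?_ (le_add_self.trans le_self_add)
          rw [sq]; gcongr
  calc _ ≤ ∫⁻ p, (J φ ψ p + J ψ φ p.swap) := lintegral_mono hpt
    _ = (∫⁻ p, J φ ψ p) + ∫⁻ p, J ψ φ p := by
        rw [lintegral_add_left (hJm φ ψ hφ hψ), Measure.volume_eq_prod,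
          lintegral_prod_swap (μ := (volume : Measure ℝ)) (ν := (volume : Measure ℝ)) (J ψ φ)]
    _ ≤ 6 + 6 := add_le_add (hJi φ ψ hφ hψ hφ0 hφ1 hψ1) (hJi ψ φ hψ hφ hψ0 hψ1 hφ1)
    _ = 12 := by norm_num

/-- The Hardy–Littlewood–Sobolev inequality on the line with kernel `|t - s| ^ (-1/2)`. -/
theorem hls_half {φ ψ : ℝ → ℝ} (hφ : Measurable φ) (hψ : Measurable ψ)
    (hφ0 : ∀ s, 0 ≤ φ s) (hψ0 : ∀ s, 0 ≤ ψ s) :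
    ∫⁻ p : ℝ × ℝ, ENNReal.ofReal (|p.2 - p.1| ^ (-(1 / 2) : ℝ)) *
      (ENNReal.ofReal (φ p.1) * ENNReal.ofReal (ψ p.2)) ≤
      12 * ((∫⁻ t, ENNReal.ofReal (φ t) ^ (4 / 3 : ℝ)) ^ (3 / 4 : ℝ) *
        (∫⁻ t, ENNReal.ofReal (ψ t) ^ (4 / 3 : ℝ)) ^ (3 / 4 : ℝ)) := by
  set A := (∫⁻ t, ENNReal.ofReal (φ t) ^ (4 / 3 : ℝ)) ^ (3 / 4 : ℝ) with hA
  set B := (∫⁻ t, ENNReal.ofReal (ψ t) ^ (4 / 3 : ℝ)) ^ (3 / 4 : ℝ) with hB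
  have hzero : ∀ φ : ℝ → ℝ, Measurable φ →
      (∫⁻ t, ENNReal.ofReal (φ t) ^ (4 / 3 : ℝ)) ^ (3 / 4 : ℝ) = 0 →
      ∀ᵐ t, ENNReal.ofReal (φ t) = 0 := by
    intro φ hφ h
    rw [ENNReal.rpow_eq_zero_iff_of_pos (by norm_num),
      lintegral_eq_zero_iff (hφ.ennreal_ofReal.pow_const _)] at h
    filter_upwards [h] with t ht
    exact (ENNReal.rpow_eq_zero_iff_of_pos (by norm_num)).1 ht
  have hLm : Measurable fun p : ℝ × ℝ => ENNReal.ofReal (|p.2 - p.1| ^ (-(1 / 2) : ℝ)) *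
      (ENNReal.ofReal (φ p.1) * ENNReal.ofReal (ψ p.2)) := by fun_prop
  by_cases hA0 : A = 0
  · rw [Measure.volume_eq_prod, lintegral_prod _ hLm.aemeasurable]
    refine le_trans (le_of_eq ?_) zero_le
    refine (lintegral_congr_ae ?_).trans lintegral_zero
    filter_upwards [hzero φ hφ hA0] with s hs
    simp [hs]
  by_cases hB0 : B = 0
  · rw [Measure.volume_eq_prod, lintegral_prod_symm _ hLm.aemeasurable]
    refine le_trans (le_of_eq ?_) zero_le
    refine (lintegral_congr_ae ?_).trans lintegral_zero
    filter_upwards [hzero ψ hψ hB0] with s hs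
    simp [hs]
  by_cases hAt : A = ∞
  · rw [hAt, ENNReal.top_mul hB0]; simp
  by_cases hBt : B = ∞
  · rw [hBt, ENNReal.mul_top hA0]; simp
  have hsc : ∀ (φ : ℝ → ℝ) (A : ℝ≥0∞), Measurable φ → A ≠ 0 → A ≠ ∞ →
      A = (∫⁻ t, ENNReal.ofReal (φ t) ^ (4 / 3 : ℝ)) ^ (3 / 4 : ℝ) →
      ∫⁻ t, ENNReal.ofReal (φ t / A.toReal) ^ (4 / 3 : ℝ) ≤ 1 := by
    intro φ A hφ hA0 hAt hA
    have h1 : ∀ t, ENNReal.ofReal (φ t / A.toReal) ^ (4 / 3 : ℝ) =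
        ENNReal.ofReal (φ t) ^ (4 / 3 : ℝ) * (A ^ (4 / 3 : ℝ))⁻¹ := by
      intro t
      rw [ENNReal.ofReal_div_of_pos (ENNReal.toReal_pos hA0 hAt), ENNReal.ofReal_toReal hAt,
        ENNReal.div_rpow_of_nonneg _ _ (by norm_num), div_eq_mul_inv]
    have h2 : A ^ (4 / 3 : ℝ) = ∫⁻ t, ENNReal.ofReal (φ t) ^ (4 / 3 : ℝ) := by
      rw [hA, ← ENNReal.rpow_mul]; norm_num
    simp only [h1]
    rw [lintegral_mul_const _ (hφ.ennreal_ofReal.pow_const _), ← h2]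
    exact ENNReal.mul_inv_le_one _
  have key := hls_normalized (φ := fun t => φ t / A.toReal) (ψ := fun t => ψ t / B.toReal)
    (by fun_prop) (by fun_prop) (fun s => div_nonneg (hφ0 s) ENNReal.toReal_nonneg)
    (fun s => div_nonneg (hψ0 s) ENNReal.toReal_nonneg) (hsc φ A hφ hA0 hAt hA)
    (hsc ψ B hψ hB0 hBt hB)
  calc _ = ∫⁻ p : ℝ × ℝ, (ENNReal.ofReal (|p.2 - p.1| ^ (-(1 / 2) : ℝ)) *
        (ENNReal.ofReal (φ p.1 / A.toReal) * ENNReal.ofReal (ψ p.2 / B.toReal))) * (A * B) := by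
        refine lintegral_congr fun p => ?_
        rw [ENNReal.ofReal_div_of_pos (ENNReal.toReal_pos hA0 hAt),
          ENNReal.ofReal_div_of_pos (ENNReal.toReal_pos hB0 hBt), ENNReal.ofReal_toReal hAt,
          ENNReal.ofReal_toReal hBt]
        nth_rw 1 [← ENNReal.div_mul_cancel hA0 hAt (b := ENNReal.ofReal (φ p.1)),
          ← ENNReal.div_mul_cancel hB0 hBt (b := ENNReal.ofReal (ψ p.2))]
        ring
    _ ≤ 12 * (A * B) := by
        rw [lintegral_mul_const _ (by fun_prop)]
        exact mul_le_mul_left key _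

end

section

variable {d : ℕ}
variable {H : Type*} [NormedAddCommGroup H] [InnerProductSpace ℂ H]
variable {σ C₀ : ℝ} {V : ℝ → Lp ℂ 2 (volume : Measure (Ed d)) →L[ℂ] H}

theorem lintegral_eLpNorm_two_eq_nrm (F : ℝ → Ed d → ℂ) :
    ∫⁻ s, eLpNorm (F s) 2 volume = nrm 1 2 F := by
  simp only [eLpNorm_eq_lintegral_rpow_enorm_toReal (show (2:ℝ≥0∞) ≠ 0 by norm_num)
      (show (2:ℝ≥0∞) ≠ ∞ by norm_num), nrm]
  simp

theorem nrm_cut_le {a b : ℝ} (ha : 0 ≤ a) (hb : 0 ≤ b) (S : Set (ℝ × Ed d)) (F : ℝ → Ed d → ℂ) :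
    nrm a b (cut S F) ≤ nrm a b F := by
  refine ENNReal.rpow_le_rpow (lintegral_mono fun s => ENNReal.rpow_le_rpow
    (lintegral_mono fun x => ENNReal.rpow_le_rpow (enorm_cut_le _ _ _ _) hb) ?_) ?_ <;> positivity

theorem cut_add_cut_compl (S : Set (ℝ × Ed d)) (F : ℝ → Ed d → ℂ) :
    F = fun s x => cut S F s x + cut Sᶜ F s x := by
  classical
  funext s x
  simp only [cut_apply, Set.mem_compl_iff]
  split_ifs <;> simp

/-- Estimate along the endpoint `(4/3, 1)` in dimension one. -/
theorem Dispersive.enorm_retard_le_of_half (hV : Dispersive (1 / 2) C₀ V) (hC₀ : 0 ≤ C₀)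
    {F G : ℝ → Ed d → ℂ} (hF : Nice F) (hG : Nice G) :
    ‖retard V F G‖ₑ ≤ ENNReal.ofReal C₀ * 12 * (nrm (4 / 3) 1 F * nrm (4 / 3) 1 G) := by
  have hm : ∀ F : ℝ → Ed d → ℂ, Nice F →
      Measurable fun s => (eLpNorm (F s) 1 volume).toReal := fun F hF =>
    (measurable_eLpNorm_left hF.meas (by norm_num) (by norm_num)).ennreal_toReal
  have hr : ∀ F : ℝ → Ed d → ℂ, Nice F → ∀ s,
      ENNReal.ofReal (eLpNorm (F s) 1 volume).toReal = eLpNorm (F s) 1 volume := fun F hF s =>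
    ENNReal.ofReal_toReal (hF.memLp s 1).eLpNorm_ne_top
  have hn : ∀ F : ℝ → Ed d → ℂ, Nice F → (∫⁻ t, ENNReal.ofReal
      (eLpNorm (F t) 1 volume).toReal ^ (4 / 3 : ℝ)) ^ (3 / 4 : ℝ) = nrm (4 / 3) 1 F := by
    intro F hF
    simp only [hr F hF]
    simp only [nrm, eLpNorm_one_eq_lintegral_enorm, ENNReal.rpow_one, div_one]
    norm_num
  have key := hls_half (hm F hF) (hm G hG) (fun _ => ENNReal.toReal_nonneg)
    (fun _ => ENNReal.toReal_nonneg)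
  rw [hn F hF, hn G hG] at key
  simp only [hr F hF, hr G hG] at key
  calc ‖retard V F G‖ₑ ≤ ∫⁻ p in triangle, ‖inner ℂ (vfield V F p.1) (vfield V G p.2)‖ₑ :=
        enorm_integral_le_lintegral_enorm _
    _ ≤ ∫⁻ p in triangle, ENNReal.ofReal C₀ * (ENNReal.ofReal (|p.2 - p.1| ^ (-(1 / 2) : ℝ)) *
          (eLpNorm (F p.1) 1 volume * eLpNorm (G p.2) 1 volume)) := by
        refine lintegral_mono_ae ?_
        filter_upwards [ae_restrict_mem measurableSet_triangle] with p hp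
        have := hV.enorm_inner_vfield_le hF hG (ne_of_lt hp)
        rwa [ENNReal.ofReal_mul hC₀, mul_assoc] at this
    _ ≤ ∫⁻ p : ℝ × ℝ, ENNReal.ofReal C₀ * (ENNReal.ofReal (|p.2 - p.1| ^ (-(1 / 2) : ℝ)) *
          (eLpNorm (F p.1) 1 volume * eLpNorm (G p.2) 1 volume)) := setLIntegral_le_lintegral _ _
    _ ≤ _ := by
        rw [lintegral_const_mul' _ _ (by simp), mul_assoc]
        exact mul_le_mul_right key _

theorem setIntegral_triangle_compl {v : ℝ → H} :
    ∫ p in triangleᶜ, inner ℂ (v p.1) (v p.2) =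
      (starRingEnd ℂ) (∫ p in triangle, inner ℂ (v p.1) (v p.2)) := by
  have hmp : MeasurePreserving (MeasurableEquiv.prodComm (α := ℝ) (β := ℝ)) :=
    Measure.measurePreserving_swap
  have hae : (triangleᶜ : Set (ℝ × ℝ)) =ᵐ[volume]
      (MeasurableEquiv.prodComm (α := ℝ) (β := ℝ)) ⁻¹' triangle := by
    have hdiag : volume {p : ℝ × ℝ | p.1 = p.2} = 0 := by
      rw [Measure.volume_eq_prod, Measure.measure_prod_null
        (measurableSet_eq_fun measurable_fst measurable_snd)]
      refine Eventually.of_forall fun x => ?_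
      have : Prod.mk x ⁻¹' {p : ℝ × ℝ | p.1 = p.2} = {x} := by
        ext y; simp [eq_comm]
      change volume (Prod.mk x ⁻¹' {p : ℝ × ℝ | p.1 = p.2}) = 0
      rw [this]; simp
    filter_upwards [compl_mem_ae_iff.2 hdiag] with p hp
    have hp' : p.1 ≠ p.2 := hp
    apply propext
    change ¬ (p.1 < p.2) ↔ p.2 < p.1
    rw [not_lt]
    exact ⟨fun h => lt_of_le_of_ne h hp'.symm, le_of_lt⟩
  rw [setIntegral_congr_set hae, ← integral_conj]
  rw [← hmp.setIntegral_preimage_emb (MeasurableEquiv.measurableEmbedding _)]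
  refine integral_congr_ae (Eventually.of_forall fun p => ?_)
  simp [MeasurableEquiv.prodComm]

theorem Dispersive.enorm_integral_vfield_le [CompleteSpace H] (hV : Dispersive σ C₀ V)
    {F : ℝ → Ed d → ℂ} (hF : Nice F) {C N : ℝ≥0∞} (h : ‖retard V F F‖ₑ ≤ C * (N * N)) :
    ‖∫ s, vfield V F s‖ₑ ≤ (2 * C) ^ (1 / 2 : ℝ) * N := by
  have hv := hV.integrable_vfield hF
  have hintg := integrable_inner_prod hv hv
  have h1 : ‖∫ s, vfield V F s‖ₑ ^ 2 ≤ 2 * C * N ^ 2 := by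
    have h : ‖∫ s, vfield V F s‖ₑ ^ 2 =
        ‖inner ℂ (∫ s, vfield V F s) (∫ s, vfield V F s)‖ₑ := by
      rw [inner_self_eq_norm_sq_to_K, ← ofReal_norm, ← ofReal_norm,
        ← ENNReal.ofReal_pow (norm_nonneg _)]
      simp
    rw [h, inner_integral_integral hv hv, ← integral_add_compl measurableSet_triangle hintg,
      setIntegral_triangle_compl]
    refine (enorm_add_le _ _).trans ?_
    rw [RCLike.enorm_conj]
    calc _ ≤ C * (N * N) + C * (N * N) := by
          have := ‹‖retard V F F‖ₑ ≤ _›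
          exact add_le_add this this
      _ = _ := by ring
  have h2 := ENNReal.rpow_le_rpow h1 (z := 1 / 2) (by norm_num)
  rw [ENNReal.mul_rpow_of_nonneg _ _ (by norm_num), ← ENNReal.rpow_natCast,
    ← ENNReal.rpow_natCast, ← ENNReal.rpow_mul, ← ENNReal.rpow_mul] at h2
  simpa using h2

theorem vfield_cut_prod (T : Set ℝ) (F : ℝ → Ed d → ℂ) :
    vfield V (cut (T ×ˢ Set.univ) F) = T.indicator (vfield V F) := by
  classical
  funext t
  by_cases ht : t ∈ T
  · rw [Set.indicator_of_mem ht, vfield, vfield]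
    congr 2
    funext x
    simp [cut_apply, ht]
  · rw [Set.indicator_of_notMem ht, vfield]
    have : cut (T ×ˢ Set.univ) F t = fun _ => 0 := by
      funext x; simp [cut_apply, ht]
    rw [this]
    have h0 : toL2 (fun _ : Ed d => (0:ℂ)) = 0 := by
      rw [toL2_eq MemLp.zero']; rfl
    rw [h0, map_zero]

theorem Dispersive.enorm_retard_le_right [CompleteSpace H] (hV : Dispersive σ C₀ V)
    {a b : ℝ} {C : ℝ≥0∞} (ha : 0 ≤ a) (hb : 0 ≤ b)
    (hom : ∀ G, Nice G → ‖∫ s, vfield V G s‖ₑ ≤ C * nrm a b G)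
    {F G : ℝ → Ed d → ℂ} (hF : Nice F) (hG : Nice G) :
    ‖retard V F G‖ₑ ≤ C * (nrm 1 2 F * nrm a b G) := by
  have hv := hV.integrable_vfield hF
  have hw := hV.integrable_vfield hG
  have hintg := (integrable_inner_prod hv hw).indicator measurableSet_triangle
  rw [retard, ← integral_indicator measurableSet_triangle]
  rw [Measure.volume_eq_prod] at hintg ⊢
  rw [integral_prod _ hintg]
  have h1 : ∀ s, ∫ t, triangle.indicator
      (fun p : ℝ × ℝ => inner ℂ (vfield V F p.1) (vfield V G p.2)) (s, t) =
      inner ℂ (vfield V F s) (∫ t, vfield V (cut (Set.Ioi s ×ˢ Set.univ) G) t) := by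
    intro s
    rw [vfield_cut_prod, ← integral_inner (hw.indicator measurableSet_Ioi)]
    refine integral_congr_ae (Eventually.of_forall fun t => ?_)
    by_cases hst : s < t
    · simp [triangle, hst]
    · simp [triangle, hst]
  simp only [h1]
  refine (enorm_integral_le_lintegral_enorm _).trans ?_
  calc _ ≤ ∫⁻ s, eLpNorm (F s) 2 volume * (C * nrm a b G) := by
        refine lintegral_mono fun s => (enorm_inner_le _ _).trans
          (mul_le_mul' (hV.enorm_vfield_le _ _) ?_)
        refine (hom _ (hG.restrict (measurableSet_Ioi.prod MeasurableSet.univ))).trans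
          (mul_le_mul_right (nrm_cut_le ha hb _ _) _)
    _ = _ := by
        rw [lintegral_mul_const _ (measurable_eLpNorm_left hF.meas (by norm_num) (by norm_num)),
          lintegral_eLpNorm_two_eq_nrm]
        ring

theorem Dispersive.enorm_retard_le_left [CompleteSpace H] (hV : Dispersive σ C₀ V)
    {a b : ℝ} {C : ℝ≥0∞} (ha : 0 ≤ a) (hb : 0 ≤ b)
    (hom : ∀ G, Nice G → ‖∫ s, vfield V G s‖ₑ ≤ C * nrm a b G)
    {F G : ℝ → Ed d → ℂ} (hF : Nice F) (hG : Nice G) :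
    ‖retard V F G‖ₑ ≤ C * (nrm a b F * nrm 1 2 G) := by
  have hv := hV.integrable_vfield hF
  have hw := hV.integrable_vfield hG
  have hintg := (integrable_inner_prod hv hw).indicator measurableSet_triangle
  rw [retard, ← integral_indicator measurableSet_triangle]
  rw [Measure.volume_eq_prod] at hintg ⊢
  rw [integral_prod_symm _ hintg]
  have h1 : ∀ t, ∫ s, triangle.indicator
      (fun p : ℝ × ℝ => inner ℂ (vfield V F p.1) (vfield V G p.2)) (s, t) =
      (starRingEnd ℂ) (inner ℂ (vfield V G t)
        (∫ s, vfield V (cut (Set.Iio t ×ˢ Set.univ) F) s)) := by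
    intro t
    rw [vfield_cut_prod, ← integral_inner (hv.indicator measurableSet_Iio), ← integral_conj]
    refine integral_congr_ae (Eventually.of_forall fun s => ?_)
    by_cases hst : s < t
    · simp [triangle, hst]
    · simp [triangle, hst]
  simp only [h1]
  refine (enorm_integral_le_lintegral_enorm _).trans ?_
  calc _ ≤ ∫⁻ t, eLpNorm (G t) 2 volume * (C * nrm a b F) := by
        refine lintegral_mono fun s => ?_
        rw [RCLike.enorm_conj]
        refine (enorm_inner_le _ _).trans (mul_le_mul' (hV.enorm_vfield_le _ _) ?_)
        refine (hom _ (hF.restrict (measurableSet_Iio.prod MeasurableSet.univ))).trans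
          (mul_le_mul_right (nrm_cut_le ha hb _ _) _)
    _ = _ := by
        rw [lintegral_mul_const _ (measurable_eLpNorm_left hG.meas (by norm_num) (by norm_num)),
          lintegral_eLpNorm_two_eq_nrm]
        ring

/-- Interpolation in one slot. -/
theorem le_nrm_of_endpoints {Φ : (ℝ → Ed d → ℂ) → ℝ≥0∞}
    (hadd : ∀ F S, Nice F → MeasurableSet S → Φ F ≤ Φ (cut S F) + Φ (cut Sᶜ F))
    {a b a₀ b₀ σ : ℝ} {D₁ D₀ : ℝ≥0∞} (ha : 1 ≤ a) (ha₀ : 1 ≤ a₀) (hb₀ : 0 < b₀) (hb₀b : b₀ ≤ b)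
    (hb2 : b ≤ 2) (hab : 1 - 1 / a = σ * (1 / b - 1 / 2))
    (hab₀ : 1 - 1 / a₀ = σ * (1 / b₀ - 1 / 2))
    (h₁ : ∀ F, Nice F → Φ F ≤ D₁ * nrm 1 2 F) (h₀ : ∀ F, Nice F → Φ F ≤ D₀ * nrm a₀ b₀ F)
    {F : ℝ → Ed d → ℂ} (hF : Nice F) : Φ F ≤ (D₁ + D₀) * nrm a b F := by
  rcases hb2.eq_or_lt with h2 | h2
  · have : a = 1 := by
      rw [h2] at hab
      have : 1 / a = 1 := by linarith
      have ha0 : a ≠ 0 := by linarith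
      field_simp at this; linarith
    subst h2; subst this
    exact (h₁ F hF).trans (mul_le_mul_left le_self_add _)
  rcases hb₀b.eq_or_lt with h3 | h3
  · have : a = a₀ := by
      rw [h3] at hab₀
      have : 1 / a = 1 / a₀ := by linarith
      simpa using this
    subst h3; subst this
    exact (h₀ F hF).trans (mul_le_mul_left le_add_self _)
  exact le_nrm_of_le_nrm_of_le_nrm hadd ha ha₀ hb₀ h3 h2 hab hab₀ h₁ h₀ hF

/-- Passing from one diagonal estimate to all pairs on the segment. -/
theorem Dispersive.exists_enorm_retard_le_of_base [CompleteSpace H] (hV : Dispersive σ C₀ V)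
    {a₀ b₀ a b a' b' : ℝ} (ha₀ : 1 ≤ a₀) (hb₀ : 0 < b₀) (hab₀ : 1 - 1 / a₀ = σ * (1 / b₀ - 1 / 2))
    (ha : 1 ≤ a) (hb₀b : b₀ ≤ b) (hb2 : b ≤ 2) (hab : 1 - 1 / a = σ * (1 / b - 1 / 2))
    (ha' : 1 ≤ a') (hb₀b' : b₀ ≤ b') (hb2' : b' ≤ 2) (hab' : 1 - 1 / a' = σ * (1 / b' - 1 / 2))
    (base : ∃ C : ℝ≥0∞, C ≠ ∞ ∧ ∀ F G : ℝ → Ed d → ℂ, Nice F → Nice G →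
      ‖retard V F G‖ₑ ≤ C * (nrm a₀ b₀ F * nrm a₀ b₀ G)) :
    ∃ C : ℝ≥0∞, C ≠ ∞ ∧ ∀ F G : ℝ → Ed d → ℂ, Nice F → Nice G →
      ‖retard V F G‖ₑ ≤ C * (nrm a b F * nrm a' b' G) := by
  obtain ⟨C, hC, hbase⟩ := base
  set C' := (2 * C) ^ (1 / 2 : ℝ) with hC'
  have hC't : C' ≠ ∞ := ENNReal.rpow_ne_top_of_nonneg (by norm_num)
    (ENNReal.mul_ne_top (by norm_num) hC)
  have hom : ∀ G : ℝ → Ed d → ℂ, Nice G → ‖∫ s, vfield V G s‖ₑ ≤ C' * nrm a₀ b₀ G :=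
    fun G hG => hV.enorm_integral_vfield_le hG (hbase G G hG hG)
  have ha₀0 : 0 ≤ a₀ := by linarith
  have hbase11 : ∀ F G : ℝ → Ed d → ℂ, Nice F → Nice G →
      ‖retard V F G‖ₑ ≤ nrm 1 2 F * nrm 1 2 G := fun F G hF hG => by
    simpa only [lintegral_eLpNorm_two_eq_nrm] using hV.enorm_retard_le hF hG
  have haddl : ∀ G : ℝ → Ed d → ℂ, Nice G → ∀ (F : ℝ → Ed d → ℂ) (S : Set (ℝ × Ed d)), Nice F →
      MeasurableSet S → ‖retard V F G‖ₑ ≤ ‖retard V (cut S F) G‖ₑ + ‖retard V (cut Sᶜ F) G‖ₑ := by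
    intro G hG F S hF hS
    have := hV.retard_add_left (hF.restrict hS) (hF.restrict hS.compl) hG
    rw [← cut_add_cut_compl] at this
    rw [this]
    exact enorm_add_le _ _
  have haddr : ∀ F : ℝ → Ed d → ℂ, Nice F → ∀ (G : ℝ → Ed d → ℂ) (S : Set (ℝ × Ed d)), Nice G →
      MeasurableSet S → ‖retard V F G‖ₑ ≤ ‖retard V F (cut S G)‖ₑ + ‖retard V F (cut Sᶜ G)‖ₑ := by
    intro F hF G S hG hS
    have := hV.retard_add_right (hG.restrict hS) (hG.restrict hS.compl) hF
    rw [← cut_add_cut_compl] at this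
    rw [this]
    exact enorm_add_le _ _
  have hL2 : ∀ F G : ℝ → Ed d → ℂ, Nice F → Nice G →
      ‖retard V F G‖ₑ ≤ (1 + C') * nrm 1 2 G * nrm a b F := by
    intro F G hF hG
    have := le_nrm_of_endpoints (Φ := fun F => ‖retard V F G‖ₑ) (D₁ := nrm 1 2 G)
      (D₀ := C' * nrm 1 2 G) (haddl G hG) ha ha₀ hb₀ hb₀b hb2 hab hab₀
      (fun F hF => (hbase11 F G hF hG).trans (le_of_eq (mul_comm _ _)))
      (fun F hF => (hV.enorm_retard_le_left ha₀0 hb₀.le hom hF hG).trans (le_of_eq (by ring))) hF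
    refine this.trans (le_of_eq (by ring))
  have hL0 : ∀ F G : ℝ → Ed d → ℂ, Nice F → Nice G →
      ‖retard V F G‖ₑ ≤ (C' + C) * nrm a₀ b₀ G * nrm a b F := by
    intro F G hF hG
    have := le_nrm_of_endpoints (Φ := fun F => ‖retard V F G‖ₑ) (D₁ := C' * nrm a₀ b₀ G)
      (D₀ := C * nrm a₀ b₀ G) (haddl G hG) ha ha₀ hb₀ hb₀b hb2 hab hab₀
      (fun F hF => (hV.enorm_retard_le_right ha₀0 hb₀.le hom hF hG).trans (le_of_eq (by ring)))
      (fun F hF => (hbase F G hF hG).trans (le_of_eq (by ring))) hF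
    refine this.trans (le_of_eq (by ring))
  refine ⟨(1 + C') + (C' + C), by finiteness, fun F G hF hG => ?_⟩
  have := le_nrm_of_endpoints (Φ := fun G => ‖retard V F G‖ₑ) (D₁ := (1 + C') * nrm a b F)
      (D₀ := (C' + C) * nrm a b F) (haddr F hF) ha' ha₀ hb₀ hb₀b' hb2' hab' hab₀
      (fun G hG => (hL2 F G hF hG).trans (le_of_eq (by ring)))
      (fun G hG => (hL0 F G hF hG).trans (le_of_eq (by ring))) hG
  exact this.trans (le_of_eq (by ring))

/-- The retarded bilinear estimate for all dual admissible exponents. -/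
theorem Dispersive.exists_enorm_retard_le [CompleteSpace H] (hd : 1 ≤ d)
    (hV : Dispersive (d / 2 : ℝ) C₀ V) (hC₀ : 0 ≤ C₀) {a b a' b' : ℝ}
    (ha : 1 ≤ a) (ha2 : a ≤ 2) (hb : 1 ≤ b) (hb2 : b ≤ 2)
    (hab : 1 - 1 / a = (d / 2 : ℝ) * (1 / b - 1 / 2))
    (ha' : 1 ≤ a') (ha2' : a' ≤ 2) (hb' : 1 ≤ b') (hb2' : b' ≤ 2)
    (hab' : 1 - 1 / a' = (d / 2 : ℝ) * (1 / b' - 1 / 2))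
    (h2 : d = 2 → 1 < b) (h2' : d = 2 → 1 < b') :
    ∃ C : ℝ≥0∞, C ≠ ∞ ∧ ∀ F G : ℝ → Ed d → ℂ, Nice F → Nice G →
      ‖retard V F G‖ₑ ≤ C * (nrm a b F * nrm a' b' G) := by
  rcases (show d = 1 ∨ d = 2 ∨ 3 ≤ d by omega) with h | h | h
  · subst h
    have hV' : Dispersive (1 / 2) C₀ V := by simpa using hV
    exact hV.exists_enorm_retard_le_of_base (a₀ := 4 / 3) (b₀ := 1) (by norm_num) (by norm_num)
      (by norm_num) ha hb hb2 hab ha' hb' hb2' hab' ⟨_, by finiteness,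
        fun F G hF hG => hV'.enorm_retard_le_of_half hC₀ hF hG⟩
  · have hb1 := h2 h
    have hb1' := h2' h
    subst h
    set b₀ : ℝ := min (min b b') (4 / 3) with hb₀
    have h1 : 1 < b₀ := lt_min (lt_min hb1 hb1') (by norm_num)
    have h3 : b₀ ≤ 4 / 3 := min_le_right _ _
    have hb₀0 : 0 < b₀ := by linarith
    have hi : 3 / 4 ≤ 1 / b₀ := by rw [le_div_iff₀ hb₀0]; linarith
    have hi1 : 1 / b₀ < 1 := by rw [div_lt_one hb₀0]; exact h1
    set a₀ : ℝ := 1 / (3 / 2 - 1 / b₀) with ha₀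
    have hden : 0 < 3 / 2 - 1 / b₀ := by linarith
    have hline : 1 - 1 / a₀ = ((2:ℕ) / 2 : ℝ) * (1 / b₀ - 1 / 2) := by
      rw [ha₀, one_div_one_div]; push_cast; ring
    have hba : b₀ ≤ a₀ := by
      rw [ha₀, le_div_iff₀ hden, mul_sub, mul_one_div_cancel hb₀0.ne']; linarith
    have ha₀2 : a₀ ≤ 2 := by
      rw [ha₀, div_le_iff₀ hden]; linarith
    exact hV.exists_enorm_retard_le_of_base (h1.le.trans hba) hb₀0 hline ha
      ((min_le_left _ _).trans (min_le_left _ _)) hb2 hab ha'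
      ((min_le_left _ _).trans (min_le_right _ _)) hb2' hab'
      (hV.exists_enorm_retard_le_of_atoms ha₀2 h1 hba hline (by norm_num) hC₀)
  · have hd3 : (3:ℝ) ≤ d := by exact_mod_cast h
    set b₀ : ℝ := 2 * d / (d + 2) with hb₀
    have h1 : 1 < b₀ := by rw [hb₀, lt_div_iff₀ (by linarith)]; linarith
    have h22 : b₀ ≤ 2 := by rw [hb₀, div_le_iff₀ (by linarith)]; linarith
    have hline : 1 - 1 / (2:ℝ) = (d / 2 : ℝ) * (1 / b₀ - 1 / 2) := by
      rw [hb₀]; field_simp; ring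
    have hle : ∀ a b : ℝ, 1 ≤ a → a ≤ 2 → 1 ≤ b → 1 - 1 / a = (d / 2 : ℝ) * (1 / b - 1 / 2) →
        b₀ ≤ b := by
      intro a b ha ha2 hb hab
      have : 1 / 2 ≤ 1 / a := one_div_le_one_div_of_le (by linarith) ha2
      have h5 : (d / 2 : ℝ) * (1 / b - 1 / 2) ≤ (d / 2 : ℝ) * (1 / b₀ - 1 / 2) := by linarith
      have h6 : 1 / b ≤ 1 / b₀ := by
        have := le_of_mul_le_mul_left h5 (by linarith)
        linarith
      exact (one_div_le_one_div (by linarith) (by linarith)).1 h6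
    exact hV.exists_enorm_retard_le_of_base (by norm_num) (by linarith) hline ha
      (hle a b ha ha2 hb hab) hb2 hab ha' (hle a' b' ha' ha2' hb' hab') hb2' hab'
      (hV.exists_enorm_retard_le_of_atoms le_rfl h1 h22 hline (by linarith) hC₀)

end

section

variable {d : ℕ}
variable {H : Type*} [NormedAddCommGroup H] [InnerProductSpace ℂ H]
variable {σ C₀ : ℝ} {V : ℝ → Lp ℂ 2 (volume : Measure (Ed d)) →L[ℂ] H}

/-- Dominated convergence in `L²`. -/
theorem tendsto_toL2_of_dominated {f : ℕ → Ed d → ℂ} {g : Ed d → ℂ}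
    (hf : ∀ n, AEStronglyMeasurable (f n) volume) (hg : MemLp g 2 volume) {B : Ed d → ℂ}
    (hB : MemLp B 2 volume) (hfB : ∀ n, ∀ᵐ x, ‖f n x‖ ≤ ‖B x‖)
    (hlim : ∀ᵐ x, Tendsto (fun n => f n x) atTop (nhds (g x))) :
    Tendsto (fun n => toL2 (f n)) atTop (nhds (toL2 g)) := by
  have : Fact ((1 : ℝ≥0∞) ≤ 2) := ⟨by norm_num⟩
  have hf2 : ∀ n, MemLp (f n) 2 volume := fun n => hB.of_le (hf n) (hfB n)
  have hgB : ∀ᵐ x, ‖g x‖ ≤ ‖B x‖ := by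
    filter_upwards [hlim, ae_all_iff.2 hfB] with x hx hx2
    exact le_of_tendsto hx.norm (Eventually.of_forall hx2)
  simp only [toL2_eq (hf2 _), toL2_eq hg]
  rw [Lp.tendsto_Lp_iff_tendsto_eLpNorm'']
  simp only [eLpNorm_eq_lintegral_rpow_enorm_toReal (show (2:ℝ≥0∞) ≠ 0 by norm_num)
      (show (2:ℝ≥0∞) ≠ ∞ by norm_num)]
  have hz : (0 : ℝ≥0∞) = (0 : ℝ≥0∞) ^ (1 / (2:ℝ≥0∞).toReal) := by simp
  rw [hz]
  refine (ENNReal.continuous_rpow_const.tendsto _).comp ?_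
  have h0 : (0 : ℝ≥0∞) = ∫⁻ _ : Ed d, 0 := by simp
  rw [h0]
  refine tendsto_lintegral_of_dominated_convergence' (fun x => (2 * ‖B x‖ₑ) ^ (2:ℝ≥0∞).toReal)
    (fun n => ((hf n).sub hg.1).enorm.pow_const _) (fun n => ?_) ?_ ?_
  · filter_upwards [hfB n, hgB] with x h1 h2
    refine ENNReal.rpow_le_rpow ?_ (by simp)
    refine (enorm_sub_le).trans ?_
    rw [two_mul]
    exact add_le_add (enorm_le_iff_norm_le.2 h1) (enorm_le_iff_norm_le.2 h2)
  · simp only [ENNReal.mul_rpow_of_nonneg _ _ (show 0 ≤ (2:ℝ≥0∞).toReal by simp)]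
    rw [lintegral_const_mul' _ _ (by simp)]
    exact ENNReal.mul_ne_top (by simp)
      (lintegral_rpow_enorm_lt_top_of_eLpNorm_lt_top (by norm_num) (by norm_num) hB.2).ne
  · filter_upwards [hlim] with x hx
    have h1 : Tendsto (fun n => ‖f n x - g x‖ₑ) atTop (nhds 0) := by
      have := (hx.sub_const (g x)).enorm
      simpa using this
    have := (ENNReal.continuous_rpow_const (y := (2:ℝ≥0∞).toReal)).tendsto 0 |>.comp h1
    simpa [Function.comp_def] using this

/-- Truncation region used to approximate `F` by nice functions. -/
def truncSet (F : ℝ → Ed d → ℂ) (n : ℕ) : Set (ℝ × Ed d) :=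
  {p | |p.1| ≤ n ∧ ‖p.2‖ ≤ n ∧ ‖F p.1 p.2‖ ≤ n}

theorem measurableSet_truncSet {F : ℝ → Ed d → ℂ} (hF : Measurable (Function.uncurry F)) (n : ℕ) :
    MeasurableSet (truncSet F n) := by
  have h3 : Measurable fun p : ℝ × Ed d => ‖F p.1 p.2‖ := hF.norm
  exact ((measurableSet_le (measurable_fst.norm) measurable_const).inter
    ((measurableSet_le (measurable_snd.norm) measurable_const).inter
      (measurableSet_le h3 measurable_const)))

theorem nice_cut_truncSet {F : ℝ → Ed d → ℂ} (hF : Measurable (Function.uncurry F)) (n : ℕ) :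
    Nice (cut (truncSet F n) F) := by
  classical
  refine ⟨hF.indicator (measurableSet_truncSet hF n), ⟨n, by positivity, fun s x => ?_⟩,
    ⟨n, by positivity, fun s x h => ?_⟩⟩
  · rw [cut_apply]; split_ifs with h
    · exact h.2.2
    · simp
  · rw [cut_apply] at h
    split_ifs at h with h'
    · exact ⟨h'.1, h'.2.1⟩
    · simp at h

theorem tendsto_cut_truncSet (F : ℝ → Ed d → ℂ) (s : ℝ) (x : Ed d) :
    ∀ᶠ n in atTop, cut (truncSet F n) F s x = F s x := by
  classical
  filter_upwards [eventually_ge_atTop ⌈|s|⌉₊, eventually_ge_atTop ⌈‖x‖⌉₊,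
    eventually_ge_atTop ⌈‖F s x‖⌉₊] with n h1 h2 h3
  rw [cut_apply, if_pos]
  exact ⟨Nat.ceil_le.1 h1, Nat.ceil_le.1 h2, Nat.ceil_le.1 h3⟩

theorem Dispersive.stronglyMeasurable_vfield (hV : Dispersive σ C₀ V) {F : ℝ → Ed d → ℂ}
    (hF : Measurable (Function.uncurry F)) (hF2 : ∀ s, MemLp (F s) 2 volume) :
    StronglyMeasurable (vfield V F) :=
  hV.cont.comp_stronglyMeasurable
      (stronglyMeasurable_id.prodMk (stronglyMeasurable_toL2 hF hF2))

/-- A bound for all truncations of `F` passes to `F`. -/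
theorem Dispersive.enorm_retard_le_of_cut (hV : Dispersive σ C₀ V) {F G : ℝ → Ed d → ℂ}
    (hF : Measurable (Function.uncurry F)) (hF2 : ∀ s, MemLp (F s) 2 volume)
    (hF1 : ∫⁻ s, eLpNorm (F s) 2 volume < ∞) (hG : Nice G) {N : ℝ≥0∞}
    (h : ∀ S, MeasurableSet S → Nice (cut S F) → ‖retard V (cut S F) G‖ₑ ≤ N) :
    ‖retard V F G‖ₑ ≤ N := by
  have hmF := measurable_eLpNorm_left hF (p := 2) (by norm_num) (by norm_num)
  have hmG := measurable_eLpNorm_left hG.meas (p := 2) (by norm_num) (by norm_num)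
  have hT : Tendsto (fun n => retard V (cut (truncSet F n) F) G) atTop (nhds (retard V F G)) := by
    have hvG := hV.integrable_vfield hG
    refine tendsto_integral_of_dominated_convergence
      (fun p : ℝ × ℝ => (eLpNorm (F p.1) 2 volume).toReal * (eLpNorm (G p.2) 2 volume).toReal)
      (fun n => ?_) ?_ (fun n => ?_) ?_
    · exact (integrable_inner_prod (hV.integrable_vfield (nice_cut_truncSet hF n))
        hvG).aestronglyMeasurable.restrict
    · refine Integrable.restrict ?_
      rw [Measure.volume_eq_prod]
      exact Integrable.mul_prod (f := fun s => (eLpNorm (F s) 2 volume).toReal)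
        (g := fun s => (eLpNorm (G s) 2 volume).toReal)
        (integrable_toReal_of_lintegral_ne_top hmF.aemeasurable hF1.ne)
        (integrable_toReal_of_lintegral_ne_top hmG.aemeasurable hG.lintegral_eLpNorm_lt_top.ne)
    · refine Eventually.of_forall fun p => ?_
      refine (norm_inner_le_norm _ _).trans (mul_le_mul ?_ ?_ (norm_nonneg _)
        ENNReal.toReal_nonneg)
      · rw [← toReal_enorm]
        refine ENNReal.toReal_mono (hF2 _).2.ne ((hV.enorm_vfield_le _ _).trans ?_)
        exact eLpNorm_mono fun x => norm_cut_le _ _ _ _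
      · rw [← toReal_enorm]
        exact ENNReal.toReal_mono (hG.memLp _ 2).2.ne (hV.enorm_vfield_le _ _)
    · refine Eventually.of_forall fun p => ?_
      refine Tendsto.inner (𝕜 := ℂ) ?_ tendsto_const_nhds
      refine ((V p.1).continuous.tendsto _).comp ?_
      refine tendsto_toL2_of_dominated (fun n =>
        ((nice_cut_truncSet hF n).measurable_left p.1).aestronglyMeasurable) (hF2 _) (hF2 p.1)
        (fun n => Eventually.of_forall fun x => norm_cut_le _ _ _ _)
        (Eventually.of_forall fun x => ?_)
      exact tendsto_nhds_of_eventually_eq (tendsto_cut_truncSet F p.1 x)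
  exact le_of_tendsto hT.enorm (Eventually.of_forall fun n =>
    h _ (measurableSet_truncSet hF n) (nice_cut_truncSet hF n))

end

section

open FourierTransform in
theorem integral_fourier_mul_flip {E : Type*} [NormedAddCommGroup E] [InnerProductSpace ℝ E]
    [FiniteDimensional ℝ E] [MeasurableSpace E] [BorelSpace E] {f g : E → ℂ}
    (hf : Integrable f) (hg : Integrable g) :
    ∫ ξ, 𝓕 f ξ * g ξ = ∫ x, f x * 𝓕 g x := by
  have := VectorFourier.integral_fourierIntegral_smul_eq_flip (e := Real.fourierChar)
    (μ := (volume : Measure E)) (ν := (volume : Measure E)) (L := innerₗ E) (f := f) (g := g)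
    Real.continuous_fourierChar continuous_inner hf hg
  rw [flip_innerₗ] at this
  exact this

variable {d : ℕ}

/-- The Fourier transform as an isometry of `L²`. -/
abbrev fourierL2 (d : ℕ) : Lp ℂ 2 (volume : Measure (Ed d)) ≃ₗᵢ[ℂ] Lp ℂ 2 (volume : Measure (Ed d)) :=
  Lp.fourierTransformₗᵢ (Ed d) ℂ

open FourierTransform in
/-- Identification of the `L²` Fourier transform by testing against Schwartz functions. -/
theorem fourier_Lp_ae_eq (f : Lp ℂ 2 (volume : Measure (Ed d))) {h : Ed d → ℂ}
    (hh : LocallyIntegrable h)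
    (H : ∀ φ : SchwartzMap (Ed d) ℂ, ∫ x, f x * 𝓕 (φ : Ed d → ℂ) x = ∫ x, h x * φ x) :
    fourierL2 d f =ᵐ[volume] h := by
  refine ae_eq_of_integral_contDiff_smul_eq ?_ hh fun g hg hgc => ?_
  · exact (Lp.memLp (fourierL2 d f)).locallyIntegrable (by norm_num)
  · have hc : ContDiff ℝ (⊤ : ℕ∞) (fun x => (g x : ℂ)) := ofRealCLM.contDiff.comp hg
    have hs : HasCompactSupport (fun x => (g x : ℂ)) :=
      hgc.comp_left (g := fun x : ℝ => (x : ℂ)) (by simp)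
    set φ : SchwartzMap (Ed d) ℂ := hs.toSchwartzMap hc with hφ
    have h1 := congrArg (fun T => T φ) (Lp.fourier_toTemperedDistribution_eq f)
    simp only [TemperedDistribution.fourier_apply, Lp.toTemperedDistribution_apply] at h1
    have h2 := H φ
    calc ∫ x, g x • fourierL2 d f x = ∫ x, φ x • fourierL2 d f x := rfl
      _ = ∫ x, (𝓕 φ) x • f x := h1.symm
      _ = ∫ x, f x * 𝓕 (φ : Ed d → ℂ) x := by
        congr 1; ext x; rw [smul_eq_mul, mul_comm]; first | done | rfl
      _ = ∫ x, h x * φ x := h2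
      _ = _ := by
        congr 1; ext x; rw [mul_comm]; rfl

open FourierTransform in
theorem fourier_toL2_ae_eq {f : Ed d → ℂ} (hf : Integrable f) (hf2 : MemLp f 2 volume) :
    fourierL2 d (toL2 f) =ᵐ[volume] 𝓕 f := by
  refine fourier_Lp_ae_eq _ ?_ fun φ => ?_
  · exact (VectorFourier.fourierIntegral_continuous Real.continuous_fourierChar
      (by exact continuous_inner) hf : Continuous (𝓕 f)).locallyIntegrable
  · rw [integral_fourier_mul_flip hf φ.integrable]
    refine integral_congr_ae ?_
    filter_upwards [toL2_coe_ae hf2] with x hx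
    rw [hx]

open FourierTransform in
theorem fourier_toL2_fourierInv_ae_eq {γ : Ed d → ℂ} (hγ : Integrable γ)
    (h2 : MemLp (𝓕⁻ γ) 2 volume) : fourierL2 d (toL2 (𝓕⁻ γ)) =ᵐ[volume] γ := by
  refine fourier_Lp_ae_eq _ hγ.locallyIntegrable fun φ => ?_
  have h1 : ∀ x, 𝓕⁻ γ x = 𝓕 (fun y => γ (-y)) x := fun x => by
    rw [Real.fourierInv_eq_fourier_neg, Real.fourier_eq', Real.fourier_eq',
      ← integral_neg_eq_self]
    simp
  have h3 : ∀ x, 𝓕 (𝓕 (φ : Ed d → ℂ)) (-x) = φ x := fun x => by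
    rw [← Real.fourierInv_eq_fourier_neg]
    exact congrFun (φ.continuous.fourierInv_fourier_eq φ.integrable (𝓕 φ).integrable) x
  calc ∫ x, (toL2 (𝓕⁻ γ) : Ed d → ℂ) x * 𝓕 (φ : Ed d → ℂ) x
      = ∫ x, 𝓕 (fun y => γ (-y)) x * 𝓕 (φ : Ed d → ℂ) x := by
        refine integral_congr_ae ?_
        filter_upwards [toL2_coe_ae h2] with x hx
        rw [hx, h1]
    _ = ∫ x, γ (-x) * 𝓕 (𝓕 (φ : Ed d → ℂ)) x :=
        integral_fourier_mul_flip hγ.comp_neg (𝓕 φ).integrable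
    _ = ∫ x, γ x * 𝓕 (𝓕 (φ : Ed d → ℂ)) (-x) := by
        rw [← integral_neg_eq_self]; simp
    _ = _ := by simp only [h3]

end

section

variable {d : ℕ}

/-- The unimodular multiplier `e^{i c |ξ|²}`. -/
def phase (c : ℝ) (ξ : Ed d) : ℂ := Complex.exp (Complex.I * (c * ‖ξ‖ ^ 2 : ℝ))

theorem norm_phase (c : ℝ) (ξ : Ed d) : ‖phase c ξ‖ = 1 := by
  rw [phase, mul_comm, Complex.norm_exp_ofReal_mul_I]

theorem continuous_uncurry_phase : Continuous fun p : ℝ × Ed d => phase p.1 p.2 := by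
  unfold phase; fun_prop

theorem continuous_phase (c : ℝ) : Continuous (phase c : Ed d → ℂ) := by
  unfold phase; fun_prop

theorem conj_phase (c : ℝ) (ξ : Ed d) : (starRingEnd ℂ) (phase c ξ) = phase (-c) ξ := by
  rw [phase, phase, ← Complex.exp_conj]
  congr 1
  simp

theorem phase_mul_phase (c c' : ℝ) (ξ : Ed d) : phase c ξ * phase c' ξ = phase (c + c') ξ := by
  rw [phase, phase, phase, ← Complex.exp_add]
  congr 1
  push_cast
  ring

theorem memLp_phase_mul (c : ℝ) {f : Ed d → ℂ} {p : ℝ≥0∞} (hf : MemLp f p volume) :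
    MemLp (fun ξ => phase c ξ * f ξ) p volume :=
  hf.of_le ((continuous_phase c).aestronglyMeasurable.mul hf.1)
    (Eventually.of_forall fun x => by rw [norm_mul, norm_phase, one_mul])

theorem norm_toL2_le (f : Ed d → ℂ) (g : Lp ℂ 2 (volume : Measure (Ed d)))
    (h : ∀ x, ‖f x‖ ≤ ‖g x‖) : ‖toL2 f‖ ≤ ‖g‖ := by
  rw [← enorm_le_iff_norm_le]
  refine (enorm_toL2_le f).trans ?_
  rw [Lp.enorm_def]
  exact eLpNorm_mono h

/-- Multiplication by `e^{i c |ξ|²}` on `L²`. -/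
def mulPhase (d : ℕ) (c : ℝ) :
    Lp ℂ 2 (volume : Measure (Ed d)) →L[ℂ] Lp ℂ 2 (volume : Measure (Ed d)) :=
  LinearMap.mkContinuous
    { toFun := fun f => toL2 fun ξ => phase c ξ * f ξ
      map_add' := fun f g => by
        rw [← toL2_add (memLp_phase_mul c (Lp.memLp f)) (memLp_phase_mul c (Lp.memLp g)),
          toL2_eq (memLp_phase_mul c (Lp.memLp (f + g))),
          show toL2 (fun x => phase c x * f x + phase c x * g x) = _ from
            toL2_eq ((memLp_phase_mul c (Lp.memLp f)).add (memLp_phase_mul c (Lp.memLp g)))]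
        refine (MemLp.toLp_eq_toLp_iff _ _).2 ?_
        filter_upwards [Lp.coeFn_add f g] with x hx
        rw [hx, Pi.add_apply, mul_add]; rfl
      map_smul' := fun a f => by
        rw [toL2_eq (memLp_phase_mul c (Lp.memLp (a • f))),
          toL2_eq (memLp_phase_mul c (Lp.memLp f)), RingHom.id_apply, ← MemLp.toLp_const_smul]
        refine (MemLp.toLp_eq_toLp_iff _ _).2 ?_
        filter_upwards [Lp.coeFn_smul a f] with x hx
        rw [hx, Pi.smul_apply, Pi.smul_apply, smul_eq_mul, smul_eq_mul]
        ring } 1 fun f => by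
    rw [one_mul]
    exact norm_toL2_le _ f fun x => by rw [norm_mul, norm_phase, one_mul]

theorem mulPhase_ae_eq (c : ℝ) (f : Lp ℂ 2 (volume : Measure (Ed d))) :
    mulPhase d c f =ᵐ[volume] fun ξ => phase c ξ * f ξ :=
  toL2_coe_ae (memLp_phase_mul c (Lp.memLp f))

theorem norm_mulPhase_le (c : ℝ) (f : Lp ℂ 2 (volume : Measure (Ed d))) :
    ‖mulPhase d c f‖ ≤ ‖f‖ :=
  norm_toL2_le _ f fun x => by rw [norm_mul, norm_phase, one_mul]

theorem continuous_mulPhase :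
    Continuous fun p : ℝ × Lp ℂ 2 (volume : Measure (Ed d)) => mulPhase d p.1 p.2 := by
  refine continuous_prod_of_continuous_lipschitzWith' _ 1 (fun c => ?_) fun f => ?_
  · refine LipschitzWith.of_dist_le_mul fun f g => ?_
    rw [dist_eq_norm, dist_eq_norm, ← map_sub, NNReal.coe_one, one_mul]
    exact norm_mulPhase_le _ _
  · refine continuous_iff_continuousAt.2 fun c => tendsto_of_seq_tendsto fun u hu => ?_
    refine tendsto_toL2_of_dominated (fun n => (memLp_phase_mul _ (Lp.memLp f)).1)
      (memLp_phase_mul _ (Lp.memLp f)) (Lp.memLp f)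
      (fun n => Eventually.of_forall fun x => by rw [norm_mul, norm_phase, one_mul])
      (Eventually.of_forall fun x => ?_)
    refine Tendsto.mul_const _ ?_
    exact ((continuous_uncurry_phase.comp (Continuous.prodMk_left x)).tendsto c).comp hu

/-- The Schrödinger evolution on the Fourier side. -/
def evol (d : ℕ) (θ s : ℝ) :
    Lp ℂ 2 (volume : Measure (Ed d)) →L[ℂ] Lp ℂ 2 (volume : Measure (Ed d)) :=
  (mulPhase d (θ * s)).comp (fourierL2 d).toContinuousLinearEquiv.toContinuousLinearMap

theorem evol_apply (θ s : ℝ) (f : Lp ℂ 2 (volume : Measure (Ed d))) :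
    evol d θ s f = mulPhase d (θ * s) (fourierL2 d f) := rfl

theorem inner_evol {f g : Lp ℂ 2 (volume : Measure (Ed d))} {f' g' : Ed d → ℂ}
    (hf : fourierL2 d f =ᵐ[volume] f') (hg : fourierL2 d g =ᵐ[volume] g') (θ s t : ℝ) :
    inner ℂ (evol d θ s f) (evol d θ t g) =
      ∫ ξ, phase (θ * (t - s)) ξ * ((starRingEnd ℂ) (f' ξ) * g' ξ) := by
  rw [L2.inner_def]
  refine integral_congr_ae ?_
  filter_upwards [hf, hg, mulPhase_ae_eq (θ * s) (fourierL2 d f),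
    mulPhase_ae_eq (θ * t) (fourierL2 d g)] with x h1 h2 h3 h4
  rw [evol_apply, evol_apply, h3, h4, h1, h2, RCLike.inner_apply, map_mul, conj_phase,
    show θ * (t - s) = -(θ * s) + θ * t by ring, ← phase_mul_phase]
  ring

end

section

variable {d : ℕ}

theorem continuous_fourier_of_integrable {f : Ed d → ℂ} (hf : Integrable f) :
    Continuous (FourierTransform.fourier f) :=
  VectorFourier.fourierIntegral_continuous Real.continuous_fourierChar
      (by exact continuous_inner) hf

theorem norm_fourier_le (f : Ed d → ℂ) (ξ : Ed d) :
    ‖FourierTransform.fourier f ξ‖ ≤ ∫ x, ‖f x‖ :=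
  VectorFourier.norm_fourierIntegral_le_integral_norm _ _ _ _ _

theorem integrable_cexp_neg_mul_sq_norm {z : ℂ} (hz : 0 < z.re) :
    Integrable fun ξ : Ed d => Complex.exp (-z * ‖ξ‖ ^ 2) := by
  simpa using GaussianFourier.integrable_cexp_neg_mul_sq_norm_add hz (0 : ℂ) (0 : Ed d)

theorem norm_fourier_gaussian_le {z : ℂ} (hz : 0 < z.re) (y w : Ed d) :
    ‖FourierTransform.fourier
      (fun v : Ed d => Complex.exp (-z * ‖v‖ ^ 2 + 2 * Real.pi * Complex.I * ⟪y, v⟫)) w‖ ≤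
      (Real.pi / ‖z‖) ^ (d / 2 : ℝ) := by
  rw [fourier_gaussian_innerProductSpace' hz, norm_mul]
  have hz0 : z ≠ 0 := fun h => by simp [h] at hz
  have h1 : ‖(Real.pi / z : ℂ) ^ ((Module.finrank ℝ (Ed d) : ℂ) / 2)‖ =
      (Real.pi / ‖z‖) ^ (d / 2 : ℝ) := by
    have : ((Module.finrank ℝ (Ed d) : ℂ) / 2) = ((d / 2 : ℝ) : ℂ) := by simp
    rw [this, Complex.norm_cpow_real, norm_div, Complex.norm_real, Real.norm_of_nonneg Real.pi_pos.le]
  have h2 : ‖Complex.exp (-(Real.pi : ℂ) ^ 2 * ‖y - w‖ ^ 2 / z)‖ ≤ 1 := by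
    rw [Complex.norm_exp, Real.exp_le_one_iff]
    have : (-(Real.pi : ℂ) ^ 2 * ‖y - w‖ ^ 2 / z) = ((-(Real.pi ^ 2 * ‖y - w‖ ^ 2) : ℝ) : ℂ) * z⁻¹ := by
      push_cast; ring
    rw [this, Complex.re_ofReal_mul, Complex.inv_re]
    refine mul_nonpos_of_nonpos_of_nonneg ?_ ?_
    · rw [neg_nonpos]; positivity
    · exact div_nonneg hz.le (Complex.normSq_nonneg _)
  rw [h1]
  exact mul_le_of_le_one_right (by positivity) h2

theorem conj_fourier (f : Ed d → ℂ) (ξ : Ed d) :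
    (starRingEnd ℂ) (FourierTransform.fourier f ξ) =
      FourierTransform.fourier (fun x => (starRingEnd ℂ) (f (-x))) ξ := by
  rw [Real.fourier_eq', Real.fourier_eq', ← integral_conj, ← integral_neg_eq_self]
  refine integral_congr_ae (Eventually.of_forall fun x => ?_)
  change (starRingEnd ℂ) (_ * f (-x)) = _ * (starRingEnd ℂ) (f (-x))
  rw [map_mul, ← Complex.exp_conj]
  congr 2
  rw [map_mul, Complex.conj_ofReal, Complex.conj_I, inner_neg_left]
  push_cast
  ring

theorem norm_integral_gaussian_mul_le {z : ℂ} (hz : 0 < z.re) {f g : Ed d → ℂ}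
    (hf : Integrable f) (hg : Integrable g) :
    ‖∫ ξ : Ed d, Complex.exp (-z * ‖ξ‖ ^ 2) * ((starRingEnd ℂ) (FourierTransform.fourier f ξ) *
      FourierTransform.fourier g ξ)‖ ≤
      (Real.pi / ‖z‖) ^ (d / 2 : ℝ) * ((∫ x, ‖f x‖) * ∫ x, ‖g x‖) := by
  set K := (Real.pi / ‖z‖) ^ (d / 2 : ℝ) with hK
  set f' : Ed d → ℂ := fun x => (starRingEnd ℂ) (f (-x)) with hf'
  have hf'i : Integrable f' := by
    have : Integrable fun x => f (-x) := hf.comp_neg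
    exact (LinearIsometryEquiv.integrable_comp_iff
      (Complex.conjLIE : ℂ ≃ₗᵢ[ℝ] ℂ)).2 this
  have hf'n : ∫ x, ‖f' x‖ = ∫ x, ‖f x‖ := by
    rw [← integral_neg_eq_self]
    simp [hf']
  set h : Ed d → ℂ := fun ξ => Complex.exp (-z * ‖ξ‖ ^ 2) * FourierTransform.fourier f' ξ with hh
  have hhi : Integrable h := by
    refine (integrable_cexp_neg_mul_sq_norm hz).mul_bdd (c := ∫ x, ‖f' x‖)
      (continuous_fourier_of_integrable hf'i).aestronglyMeasurable
      (Eventually.of_forall fun x => norm_fourier_le _ _)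
  have hb : ∀ y, ‖FourierTransform.fourier h y‖ ≤ K * ∫ x, ‖f x‖ := by
    intro y
    have h1 : FourierTransform.fourier h y = ∫ ξ, FourierTransform.fourier f' ξ *
        Complex.exp (-z * ‖ξ‖ ^ 2 + 2 * Real.pi * Complex.I * ⟪-y, ξ⟫) := by
      rw [Real.fourier_eq']
      refine integral_congr_ae (Eventually.of_forall fun ξ => ?_)
      simp only [hh, smul_eq_mul]
      rw [mul_left_comm, ← mul_assoc, ← Complex.exp_add, mul_comm]
      congr 2
      rw [add_comm, real_inner_comm, inner_neg_left]
      push_cast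
      ring
    have hintg : Integrable fun ξ : Ed d =>
        Complex.exp (-z * ‖ξ‖ ^ 2 + 2 * Real.pi * Complex.I * ⟪-y, ξ⟫) :=
      GaussianFourier.integrable_cexp_neg_mul_sq_norm_add hz _ _
    rw [h1, integral_fourier_mul_flip hf'i hintg]
    calc _ ≤ ∫ x, ‖f' x‖ * K := by
          refine norm_integral_le_of_norm_le (hf'i.norm.mul_const K)
            (Eventually.of_forall fun x => ?_)
          rw [norm_mul]
          exact mul_le_mul_of_nonneg_left (norm_fourier_gaussian_le hz _ _) (norm_nonneg _)
      _ = _ := by rw [integral_mul_const, hf'n, mul_comm]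
  calc _ = ‖∫ ξ, FourierTransform.fourier g ξ * h ξ‖ := by
        congr 2; ext ξ; rw [conj_fourier]; simp only [hh]; ring
    _ = ‖∫ x, g x * FourierTransform.fourier h x‖ := by
        rw [integral_fourier_mul_flip hg hhi]
    _ ≤ ∫ x, ‖g x‖ * (K * ∫ x, ‖f x‖) := by
        refine norm_integral_le_of_norm_le (hg.norm.mul_const _)
            (Eventually.of_forall fun x => ?_)
        rw [norm_mul]
        exact mul_le_mul_of_nonneg_left (hb _) (norm_nonneg _)
    _ = _ := by rw [integral_mul_const]; ring

theorem norm_integral_phase_mul_le {c : ℝ} (hc : c ≠ 0) {f g : Ed d → ℂ}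
    (hf : Integrable f) (hg : Integrable g)
    (hfg : Integrable fun ξ => (starRingEnd ℂ) (FourierTransform.fourier f ξ) *
      FourierTransform.fourier g ξ) :
    ‖∫ ξ : Ed d, phase c ξ * ((starRingEnd ℂ) (FourierTransform.fourier f ξ) *
      FourierTransform.fourier g ξ)‖ ≤
      (Real.pi / |c|) ^ (d / 2 : ℝ) * ((∫ x, ‖f x‖) * ∫ x, ‖g x‖) := by
  set ε : ℕ → ℝ := fun n => 1 / ((n : ℝ) + 1) with hε
  have hε0 : ∀ n, 0 < ε n := fun n => Nat.one_div_pos_of_nat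
  have hεl : Tendsto ε atTop (nhds 0) := tendsto_one_div_add_atTop_nhds_zero_nat
  set z : ℕ → ℂ := fun n => (ε n : ℂ) - Complex.I * c with hz
  have hzre : ∀ n, 0 < (z n).re := fun n => by simpa [hz] using hε0 n
  have hlim : Tendsto (fun n => ∫ ξ : Ed d, Complex.exp (-(z n) * ‖ξ‖ ^ 2) *
      ((starRingEnd ℂ) (FourierTransform.fourier f ξ) * FourierTransform.fourier g ξ)) atTop
      (nhds (∫ ξ : Ed d, phase c ξ * ((starRingEnd ℂ) (FourierTransform.fourier f ξ) *
      FourierTransform.fourier g ξ))) := by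
    refine tendsto_integral_of_dominated_convergence _ (fun n => ?_) hfg.norm
      (fun n => Eventually.of_forall fun ξ => ?_) (Eventually.of_forall fun ξ => ?_)
    · exact (by fun_prop : Continuous fun ξ : Ed d =>
        Complex.exp (-(z n) * ‖ξ‖ ^ 2)).aestronglyMeasurable.mul hfg.1
    · rw [norm_mul]
      refine mul_le_of_le_one_left (norm_nonneg _) ?_
      rw [Complex.norm_exp, Real.exp_le_one_iff]
      have : (-(z n) * (‖ξ‖ : ℂ) ^ 2) = ((‖ξ‖ ^ 2 : ℝ) : ℂ) * (-(z n)) := by push_cast; ring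
      rw [this, Complex.re_ofReal_mul, Complex.neg_re]
      exact mul_nonpos_of_nonneg_of_nonpos (by positivity) (by linarith [hzre n])
    · refine Tendsto.mul_const _ ?_
      have h1 : Tendsto (fun n => -(z n) * (‖ξ‖ : ℂ) ^ 2) atTop
          (nhds (Complex.I * (c * ‖ξ‖ ^ 2 : ℝ))) := by
        have h2 : Tendsto (fun n => (ε n : ℂ)) atTop (nhds ((0 : ℝ) : ℂ)) :=
          (Complex.continuous_ofReal.tendsto 0).comp hεl
        have h3 := ((h2.sub_const (Complex.I * c)).neg).mul_const ((‖ξ‖ : ℂ) ^ 2)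
        convert h3 using 2
        push_cast
        ring
      exact (Complex.continuous_exp.tendsto _).comp h1
  refine le_of_tendsto hlim.norm (Eventually.of_forall fun n => ?_)
  refine (norm_integral_gaussian_mul_le (hzre n) hf hg).trans ?_
  refine mul_le_mul_of_nonneg_right ?_ (by positivity)
  refine Real.rpow_le_rpow (by positivity) ?_ (by positivity)
  refine div_le_div_of_nonneg_left Real.pi_pos.le (abs_pos.2 hc) ?_
  have := Complex.abs_im_le_norm (z n)
  simpa [hz] using this

theorem integrable_conj_mul {f g : Ed d → ℂ} (hf : MemLp f 2 volume) (hg : MemLp g 2 volume) :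
    Integrable fun ξ => (starRingEnd ℂ) (f ξ) * g ξ := by
  have hf' : MemLp (fun ξ => (starRingEnd ℂ) (f ξ)) 2 volume :=
    hf.of_le (continuous_star.comp_aestronglyMeasurable hf.1)
      (Eventually.of_forall fun x => by simp)
  exact hf'.integrable_mul hg

theorem dispersive_evol {θ : ℝ} (hθ : θ ≠ 0) :
    Dispersive (d / 2 : ℝ) ((Real.pi / |θ|) ^ (d / 2 : ℝ)) (evol d θ) where
  cont := by
    refine continuous_mulPhase.comp (f := fun p : ℝ × Lp ℂ 2 (volume : Measure (Ed d)) =>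
      (θ * p.1, fourierL2 d p.2)) ?_
    exact (continuous_const.mul continuous_fst).prodMk
      ((fourierL2 d).continuous.comp continuous_snd)
  norm_le s f := (norm_mulPhase_le _ _).trans ((fourierL2 d).norm_map f).le
  disp s t f g hst := by
    by_cases hf0 : eLpNorm f 1 volume = 0
    · have : f = 0 := by
        rw [eLpNorm_eq_zero_iff (Lp.aestronglyMeasurable f) one_ne_zero] at hf0
        exact Lp.ext (hf0.trans (Lp.coeFn_zero _ _ _).symm)
      simp [this]
    by_cases hg0 : eLpNorm g 1 volume = 0
    · have : g = 0 := by
        rw [eLpNorm_eq_zero_iff (Lp.aestronglyMeasurable g) one_ne_zero] at hg0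
        exact Lp.ext (hg0.trans (Lp.coeFn_zero _ _ _).symm)
      simp [this]
    have hC : 0 < (Real.pi / |θ|) ^ (d / 2 : ℝ) * |t - s| ^ (-(d / 2 : ℝ)) := by
      have h1 : 0 < |θ| := abs_pos.2 hθ
      have h2 : 0 < |t - s| := abs_pos.2 (sub_ne_zero.2 hst.symm)
      have := Real.pi_pos
      positivity
    have hC' : ENNReal.ofReal ((Real.pi / |θ|) ^ (d / 2 : ℝ) * |t - s| ^ (-(d / 2 : ℝ))) ≠ 0 :=
      (ENNReal.ofReal_pos.2 hC).ne'
    by_cases hf1 : eLpNorm f 1 volume = ∞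
    · rw [hf1, ENNReal.top_mul hg0, ENNReal.mul_top hC']
      exact le_top
    by_cases hg1 : eLpNorm g 1 volume = ∞
    · rw [hg1, ENNReal.mul_top hf0, ENNReal.mul_top hC']
      exact le_top
    have hfi : Integrable f := memLp_one_iff_integrable.1
      ⟨Lp.aestronglyMeasurable f, lt_top_iff_ne_top.2 hf1⟩
    have hgi : Integrable g := memLp_one_iff_integrable.1
      ⟨Lp.aestronglyMeasurable g, lt_top_iff_ne_top.2 hg1⟩
    have hL : ∀ h : Lp ℂ 2 (volume : Measure (Ed d)), toL2 h = h := fun h => by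
      rw [toL2_eq (Lp.memLp h), Lp.toLp_coeFn]
    have hf' := fourier_toL2_ae_eq hfi (Lp.memLp f)
    have hg' := fourier_toL2_ae_eq hgi (Lp.memLp g)
    rw [hL] at hf' hg'
    have hc : θ * (t - s) ≠ 0 := mul_ne_zero hθ (sub_ne_zero.2 hst.symm)
    have key := norm_integral_phase_mul_le hc hfi hgi (integrable_conj_mul
      ((memLp_congr_ae hf').1 (Lp.memLp _)) ((memLp_congr_ae hg').1 (Lp.memLp _)))
    rw [inner_evol hf' hg', ← ofReal_norm]
    refine (ENNReal.ofReal_le_ofReal key).trans (le_of_eq ?_)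
    have e1 : ∀ h : Lp ℂ 2 (volume : Measure (Ed d)), Integrable h →
        ENNReal.ofReal (∫ x, ‖h x‖) = eLpNorm h 1 volume := fun h hh => by
      rw [eLpNorm_one_eq_lintegral_enorm, ofReal_integral_norm_eq_lintegral_enorm hh]
    rw [ENNReal.ofReal_mul (by positivity), ENNReal.ofReal_mul (by positivity), e1 f hfi, e1 g hgi]
    congr 2
    rw [abs_mul, ← div_div, Real.div_rpow (by positivity) (abs_nonneg _),
      Real.rpow_neg (abs_nonneg _), div_eq_mul_inv]

end

section

variable {d : ℕ}

theorem Nice.integrable {F : ℝ → Ed d → ℂ} (hF : Nice F) :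
    Integrable (Function.uncurry F) (volume : Measure (ℝ × Ed d)) := by
  obtain ⟨M, hM0, hM⟩ := hF.bdd
  obtain ⟨R, hR0, hR⟩ := hF.supp
  have hS : MeasurableSet (Set.Icc (-R) R ×ˢ Metric.closedBall (0 : Ed d) R) :=
    measurableSet_Icc.prod Metric.isClosed_closedBall.measurableSet
  have h1 : IntegrableOn (Function.uncurry F) (Set.Icc (-R) R ×ˢ Metric.closedBall (0 : Ed d) R) := by
    refine Measure.integrableOn_of_bounded (M := M) ?_ hF.meas.aestronglyMeasurable
      (Eventually.of_forall fun p => hM p.1 p.2)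
    rw [Measure.volume_eq_prod, Measure.prod_prod]
    exact ENNReal.mul_ne_top (by simp) measure_closedBall_lt_top.ne
  have h2 := (integrable_indicator_iff hS).2 h1
  rwa [Set.indicator_eq_self.2] at h2
  intro p hp
  have := hR p.1 p.2 hp
  exact ⟨abs_le.1 this.1, by simpa using this.2⟩

theorem Nice.exists_lintegral_rpow_le {F : ℝ → Ed d → ℂ} (hF : Nice F) {b : ℝ} (hb : 0 < b) :
    ∃ L : ℝ, 0 ≤ L ∧ ∀ s, ∫⁻ x, ‖F s x‖ₑ ^ b ≤ ENNReal.ofReal L := by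
  obtain ⟨M, hM0, hM⟩ := hF.bdd
  obtain ⟨R, hR0, hR⟩ := hF.supp
  have hf : ENNReal.ofReal M ^ b * volume (Metric.closedBall (0 : Ed d) R) ≠ ∞ :=
    ENNReal.mul_ne_top (ENNReal.rpow_ne_top_of_nonneg hb.le ENNReal.ofReal_ne_top)
      measure_closedBall_lt_top.ne
  refine ⟨(ENNReal.ofReal M ^ b * volume (Metric.closedBall (0 : Ed d) R)).toReal,
    ENNReal.toReal_nonneg, fun s => ?_⟩
  rw [ENNReal.ofReal_toReal hf]
  rw [← setLIntegral_const, ← lintegral_indicator Metric.isClosed_closedBall.measurableSet]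
  refine lintegral_mono fun x => ?_
  by_cases hx : F s x = 0
  · simp [hx, hb]
  · rw [Set.indicator_of_mem (by simpa using (hR s x hx).2)]
    refine ENNReal.rpow_le_rpow ?_ hb.le
    rw [← ofReal_norm]
    exact ENNReal.ofReal_le_ofReal (hM s x)

theorem nrm_le_of_dual_of_le {W : ℝ → Ed d → ℂ} (hW : Nice W) {a b Q R : ℝ}
    (ha : a.HolderConjugate Q) (hb : b.HolderConjugate R) (hR2 : 2 ≤ R) {N : ℝ≥0∞} {δ : ℝ}
    (hδ0 : 0 < δ)
    (hδ : ∀ t, ∫⁻ x, ‖W t x‖ₑ ^ R = 0 ∨ ENNReal.ofReal δ ≤ ∫⁻ x, ‖W t x‖ₑ ^ R)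
    (h : ∀ g, Nice g → (∀ t x, W t x = 0 → g t x = 0) →
      ‖∫ p : ℝ × Ed d, W p.1 p.2 * g p.1 p.2‖ₑ ≤ N * nrm a b g) :
    nrm Q R W ≤ N := by
  have hR0 : 0 < R := by linarith
  have hQ0 : 0 < Q := ha.symm.pos
  have ha0 := ha.pos
  have hb0 := hb.pos
  obtain ⟨L, hL0, hL⟩ := hW.exists_lintegral_rpow_le hR0
  obtain ⟨M, hM0, hM⟩ := hW.bdd
  obtain ⟨T, hT0, hT⟩ := hW.supp
  set J : ℝ → ℝ≥0∞ := fun t => ∫⁻ x, ‖W t x‖ₑ ^ R with hJ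
  have hJm : Measurable J := measurable_lintegral_enorm_rpow hW.meas R
  have hJf : ∀ t, J t ≠ ∞ := fun t => hW.lintegral_rpow_ne_top t hR0
  set e : ℝ := (Q - R) / R with he
  set j : ℝ → ℝ := fun t => (J t).toReal with hj
  have hjb : ∀ t, j t ^ e ≤ max (L ^ e) (δ ^ e) := by
    intro t
    rcases le_or_gt 0 e with h0 | h0
    · refine (Real.rpow_le_rpow ENNReal.toReal_nonneg ?_ h0).trans (le_max_left _ _)
      exact ENNReal.toReal_le_of_le_ofReal hL0 (hL t)
    · rcases hδ t with h1 | h1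
      · have : j t = 0 := by simp only [hj, hJ, h1, ENNReal.toReal_zero]
        rw [this, Real.zero_rpow h0.ne]
        exact (Real.rpow_nonneg hL0 _).trans (le_max_left _ _)
      · refine le_trans ?_ (le_max_right _ _)
        exact Real.rpow_le_rpow_of_nonpos hδ0 ((ENNReal.ofReal_le_iff_le_toReal (hJf t)).1 h1) h0.le
  set g : ℝ → Ed d → ℂ := fun t x =>
    (starRingEnd ℂ) (W t x) * ((‖W t x‖ ^ (R - 2) * j t ^ e : ℝ) : ℂ) with hg
  have hgW : ∀ t x, W t x = 0 → g t x = 0 := fun t x h => by simp [hg, h]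
  have hWm : Measurable fun p : ℝ × Ed d => W p.1 p.2 := hW.meas
  have hjm : Measurable fun p : ℝ × Ed d => j p.1 ^ e :=
    (hJm.ennreal_toReal.pow_const e).comp measurable_fst
  have hgN : Nice g := by
    refine ⟨?_, ⟨M * (M ^ (R - 2) * max (L ^ e) (δ ^ e)), by positivity, fun t x => ?_⟩,
      ⟨T, hT0, fun t x h => hT t x fun h0 => h (hgW t x h0)⟩⟩
    · exact (Complex.continuous_conj.measurable.comp hWm).mul (Complex.measurable_ofReal.comp
        (((hWm.norm).pow_const _).mul hjm))
    · rw [norm_mul, RCLike.norm_conj, Complex.norm_real, Real.norm_of_nonneg (by positivity)]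
      refine mul_le_mul (hM t x) (mul_le_mul ?_ (hjb t) (by positivity) (by positivity))
        (by positivity) hM0
      exact Real.rpow_le_rpow (norm_nonneg _) (hM t x) (by linarith)
  set X : ℝ≥0∞ := ∫⁻ t, J t ^ (Q / R) with hX
  have hXnrm : nrm Q R W = X ^ (1 / Q) := rfl
  have hXf : X ≠ ∞ := by
    have := hW.nrm_ne_top hQ0 hR0
    rw [hXnrm] at this
    intro h
    rw [h, ENNReal.top_rpow_of_pos (by positivity)] at this
    exact this rfl
  have hQR : Q / R = 1 + e := by rw [he]; field_simp; ring
  have hWg : ∀ t x, W t x * g t x = ((‖W t x‖ ^ R * j t ^ e : ℝ) : ℂ) := by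
    intro t x
    simp only [hg]
    rw [← mul_assoc, Complex.mul_conj, Complex.normSq_eq_norm_sq, ← Complex.ofReal_mul,
      ← mul_assoc]
    congr 2
    rcases eq_or_ne ‖W t x‖ 0 with h0 | h0
    · rw [h0, Real.zero_rpow hR0.ne']; simp
    · rw [← Real.rpow_natCast, ← Real.rpow_add (by positivity)]
      congr 1; push_cast; ring
  have hpair : ‖∫ p : ℝ × Ed d, W p.1 p.2 * g p.1 p.2‖ₑ = X := by
    have hintg : Integrable (fun p : ℝ × Ed d => W p.1 p.2 * g p.1 p.2) :=
      hgN.integrable.bdd_mul (c := M) hWm.aestronglyMeasurable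
        (Eventually.of_forall fun p => hM p.1 p.2)
    have hintg' : Integrable (fun p : ℝ × Ed d => ‖W p.1 p.2‖ ^ R * j p.1 ^ e) := by
      refine hintg.norm.congr (Eventually.of_forall fun p => ?_)
      change ‖W p.1 p.2 * g p.1 p.2‖ = _
      rw [hWg, Complex.norm_real, Real.norm_of_nonneg (by positivity)]
    simp only [hWg]
    rw [integral_complex_ofReal, ← ofReal_norm, Complex.norm_real, Real.norm_of_nonneg
      (integral_nonneg fun p => by positivity), ofReal_integral_eq_lintegral_ofReal hintg'
      (Eventually.of_forall fun p => by positivity), Measure.volume_eq_prod,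
      lintegral_prod (fun p : ℝ × Ed d => ENNReal.ofReal (‖W p.1 p.2‖ ^ R * j p.1 ^ e))
      (Measurable.aemeasurable ((hWm.norm.pow_const R).mul hjm).ennreal_ofReal)]
    refine lintegral_congr fun t => ?_
    have : ∀ x, ENNReal.ofReal (‖W t x‖ ^ R * j t ^ e) =
        ‖W t x‖ₑ ^ R * ENNReal.ofReal (j t ^ e) := fun x => by
      rw [ENNReal.ofReal_mul (by positivity), ← ENNReal.ofReal_rpow_of_nonneg (norm_nonneg _) hR0.le,
        ofReal_norm]
    simp only [this]
    rw [lintegral_mul_const _ ((hW.measurable_left t).enorm.pow_const _)]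
    change J t * _ = _
    rcases eq_or_ne (J t) 0 with h0 | h0
    · rw [h0, zero_mul, ENNReal.zero_rpow_of_pos (by positivity)]
    · rw [← ENNReal.ofReal_rpow_of_pos (ENNReal.toReal_pos h0 (hJf t)),
        ENNReal.ofReal_toReal (hJf t), hQR, ENNReal.rpow_add _ _ h0 (hJf t), ENNReal.rpow_one]
  have hbR : (R - 1) * b = R := hb.symm.sub_one_mul_conj
  have haQ : (Q - 1) * a = Q := ha.symm.sub_one_mul_conj
  have hgnrm : nrm a b g = X ^ (1 / a) := by
    rw [nrm]
    congr 1
    refine lintegral_congr fun t => ?_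
    rcases eq_or_ne (J t) 0 with h0 | h0
    · have h1 : ∀ᵐ x, W t x = 0 := by
        have := (lintegral_eq_zero_iff ((hW.measurable_left t).enorm.pow_const R)).1 h0
        filter_upwards [this] with x hx
        simpa [hR0.not_gt, hR0] using hx
      have h2 : ∫⁻ x, ‖g t x‖ₑ ^ b = 0 := by
        rw [lintegral_eq_zero_iff ((hgN.measurable_left t).enorm.pow_const b)]
        filter_upwards [h1] with x hx
        simp [hgW t x hx, hb0]
      rw [h2, h0, ENNReal.zero_rpow_of_pos (by positivity), ENNReal.zero_rpow_of_pos (by positivity)]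
    · have h1 : ∀ x, ‖g t x‖ₑ ^ b = ‖W t x‖ₑ ^ R * J t ^ (e * b) := by
        intro x
        have hge : ‖g t x‖ₑ = ‖W t x‖ₑ ^ (R - 1) * J t ^ e := by
          rw [← ofReal_norm, ← ofReal_norm, ENNReal.ofReal_rpow_of_nonneg (norm_nonneg _)
            (by linarith), ← ENNReal.ofReal_toReal (hJf t), ENNReal.ofReal_rpow_of_pos
            (ENNReal.toReal_pos h0 (hJf t)), ← ENNReal.ofReal_mul (by positivity)]
          congr 1
          simp only [hg]
          rw [norm_mul, RCLike.norm_conj, Complex.norm_real, Real.norm_of_nonneg (by positivity),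
            ← mul_assoc]
          congr 1
          rcases eq_or_ne ‖W t x‖ 0 with h0 | h0
          · rw [h0, Real.zero_rpow (by linarith : 0 < R - 1).ne']; simp
          · nth_rewrite 1 [← Real.rpow_one ‖W t x‖]
            rw [← Real.rpow_add (by positivity)]
            congr 1; ring
        rw [hge, ENNReal.mul_rpow_of_nonneg _ _ hb0.le, ← ENNReal.rpow_mul, ← ENNReal.rpow_mul, hbR]
      simp only [h1]
      rw [lintegral_mul_const _ ((hW.measurable_left t).enorm.pow_const _)]
      change (J t * _) ^ _ = _
      nth_rewrite 1 [← ENNReal.rpow_one (J t)]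
      rw [← ENNReal.rpow_add _ _ h0 (hJf t), ← ENNReal.rpow_mul]
      congr 1
      have h2 : Q = a * (Q - 1) := by linarith
      have h3 : R = b * (R - 1) := by linarith
      rw [he]
      field_simp
      nlinarith
  have key := h g hgN hgW
  rw [hpair, hgnrm] at key
  rw [hXnrm]
  rcases eq_or_ne X 0 with h0 | h0
  · rw [h0, ENNReal.zero_rpow_of_pos (by positivity)]; exact bot_le
  · have h1 : X ^ (1 / Q) * X ^ (1 / a) = X := by
      rw [← ENNReal.rpow_add _ _ h0 hXf, add_comm, one_div, one_div, ha.inv_add_inv_eq_one,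
        ENNReal.rpow_one]
    have h2 : X ^ (1 / a) ≠ 0 := by simp [h0, hXf]
    have h3 : X ^ (1 / a) ≠ ∞ := ENNReal.rpow_ne_top_of_nonneg (by positivity) hXf
    replace key : X ^ (1 / Q) * X ^ (1 / a) ≤ N * X ^ (1 / a) := h1.trans_le key
    exact (ENNReal.mul_le_mul_iff_left h2 h3).1 key

end

section

variable {d : ℕ}

theorem nrm_le_of_eventually_eq {W : ℝ → Ed d → ℂ} {Wn : ℕ → ℝ → Ed d → ℂ}
    (hWn : ∀ n, Measurable (Function.uncurry (Wn n))) {Q R : ℝ} (hQ : 0 < Q) {N : ℝ≥0∞}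
    (hlim : ∀ t, ∀ᶠ n in atTop, Wn n t = W t) (hN : ∀ n, nrm Q R (Wn n) ≤ N) :
    nrm Q R W ≤ N := by
  have h1 : ∀ F : ℝ → Ed d → ℂ,
      nrm Q R F ≤ N ↔ ∫⁻ t, (∫⁻ x, ‖F t x‖ₑ ^ R) ^ (Q / R) ≤ N ^ Q := fun F => by
    rw [nrm, one_div, ENNReal.rpow_inv_le_iff hQ]
  rw [h1]
  calc _ ≤ ∫⁻ t, liminf (fun n => (∫⁻ x, ‖Wn n t x‖ₑ ^ R) ^ (Q / R)) atTop := by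
        refine lintegral_mono fun t => ?_
        refine le_liminf_of_le (by isBoundedDefault) ?_
        filter_upwards [hlim t] with n hn
        rw [hn]
    _ ≤ liminf (fun n => ∫⁻ t, (∫⁻ x, ‖Wn n t x‖ₑ ^ R) ^ (Q / R)) atTop :=
        lintegral_liminf_le fun n => (measurable_lintegral_enorm_rpow (hWn n) R).pow_const _
    _ ≤ N ^ Q := by
        refine liminf_le_of_le (by isBoundedDefault) fun b hb => ?_
        obtain ⟨n, hn⟩ := hb.exists
        exact hn.trans ((h1 _).1 (hN n))

theorem nrm_le_of_dual {W : ℝ → Ed d → ℂ} (hW : Nice W) {a b Q R : ℝ}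
    (ha : a.HolderConjugate Q) (hb : b.HolderConjugate R) (hR2 : 2 ≤ R) {N : ℝ≥0∞}
    (h : ∀ g, Nice g → (∀ t x, W t x = 0 → g t x = 0) →
      ‖∫ p : ℝ × Ed d, W p.1 p.2 * g p.1 p.2‖ₑ ≤ N * nrm a b g) :
    nrm Q R W ≤ N := by
  classical
  have hR0 : 0 < R := by linarith
  set J : ℝ → ℝ≥0∞ := fun t => ∫⁻ x, ‖W t x‖ₑ ^ R with hJ
  have hJm : Measurable J := measurable_lintegral_enorm_rpow hW.meas R
  set T : ℕ → Set ℝ := fun n => {t | J t = 0 ∨ ENNReal.ofReal (1 / ((n : ℝ) + 1)) ≤ J t} with hT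
  have hTm : ∀ n, MeasurableSet (T n) := fun n =>
    (measurableSet_eq_fun hJm measurable_const).union (measurableSet_le measurable_const hJm)
  have hTm' : ∀ n, MeasurableSet (T n ×ˢ (Set.univ : Set (Ed d))) := fun n =>
    (hTm n).prod MeasurableSet.univ
  have hc : ∀ n t, t ∈ T n → cut (T n ×ˢ Set.univ) W t = W t := fun n t ht => by
    funext x; rw [cut_apply, if_pos ⟨ht, trivial⟩]
  have hc' : ∀ n t, t ∉ T n → cut (T n ×ˢ Set.univ) W t = 0 := fun n t ht => by
    funext x; rw [cut_apply, if_neg fun h => ht h.1]; rfl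
  refine nrm_le_of_eventually_eq (Wn := fun n => cut (T n ×ˢ Set.univ) W)
    (fun n => (hW.restrict (hTm' n)).meas) ha.symm.pos (fun t => ?_) fun n => ?_
  · rcases eq_or_ne (J t) 0 with h0 | h0
    · exact Eventually.of_forall fun n => hc n t (Or.inl h0)
    · have hl : Tendsto (fun n : ℕ => ENNReal.ofReal (1 / ((n : ℝ) + 1))) atTop (nhds 0) := by
        have := (ENNReal.continuous_ofReal.tendsto 0).comp
          (tendsto_one_div_add_atTop_nhds_zero_nat (𝕜 := ℝ))
        simpa [Function.comp_def] using this
      filter_upwards [hl.eventually_le_const (pos_iff_ne_zero.2 h0)] with n hn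
      exact hc n t (Or.inr hn)
  · refine nrm_le_of_dual_of_le (hW.restrict (hTm' n)) ha hb hR2
      (show (0 : ℝ) < 1 / ((n : ℝ) + 1) from Nat.one_div_pos_of_nat) (fun t => ?_)
      fun g hg hgW => ?_
    · by_cases ht : t ∈ T n
      · rw [hc n t ht]; exact ht
      · left; rw [hc' n t ht]; simp [hR0]
    · have : ∀ p : ℝ × Ed d, cut (T n ×ˢ Set.univ) W p.1 p.2 * g p.1 p.2 =
          W p.1 p.2 * g p.1 p.2 := fun p => by
        by_cases ht : p.1 ∈ T n
        · rw [hc n _ ht]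
        · rw [hgW p.1 p.2 (by rw [hc' n _ ht]; rfl), mul_zero, mul_zero]
      simp only [this]
      refine h g hg fun t x hx => hgW t x ?_
      have := norm_cut_le (T n ×ˢ Set.univ) W t x
      rw [hx, norm_zero] at this
      exact norm_le_zero_iff.1 this

theorem lintegral_rpow_le_of_support {α : Type*} [MeasurableSpace α] {μ : Measure α}
    {f : α → ℝ≥0∞} (hf : Measurable f) {S : Set α} (hS : MeasurableSet S)
    (hfS : ∀ x, f x ≠ 0 → x ∈ S) {p q : ℝ} (hp : 0 < p) (hpq : p ≤ q) :
    (∫⁻ x, f x ^ p ∂μ) ^ (1 / p) ≤ (∫⁻ x, f x ^ q ∂μ) ^ (1 / q) * μ S ^ (1 / p - 1 / q) := by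
  have h1 : ∀ r : ℝ, 0 < r → ∫⁻ x, f x ^ r ∂μ = ∫⁻ x in S, f x ^ r ∂μ := fun r hr => by
    rw [← lintegral_indicator hS]
    refine lintegral_congr fun x => ?_
    by_cases hx : f x = 0
    · by_cases hxS : x ∈ S <;> simp [hx, hxS, hr]
    · rw [Set.indicator_of_mem (hfS x hx)]
  rw [h1 p hp, h1 q (hp.trans_le hpq)]
  have := eLpNorm'_le_eLpNorm'_mul_rpow_measure_univ (μ := μ.restrict S) hp hpq
    hf.aestronglyMeasurable
  simpa [eLpNorm'] using this

theorem nrm_le_of_support {g : ℝ → Ed d → ℂ} (hg : Measurable (Function.uncurry g))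
    {S : Set ℝ} {B : Set (Ed d)} (hS : MeasurableSet S) (hB : MeasurableSet B)
    (hgS : ∀ t x, g t x ≠ 0 → t ∈ S ∧ x ∈ B) {a a' b b' : ℝ} (ha : 0 < a) (haa' : a ≤ a')
    (hb : 0 < b) (hbb' : b ≤ b') :
    nrm a b g ≤ nrm a' b' g * (volume B ^ (1 / b - 1 / b') * volume S ^ (1 / a - 1 / a')) := by
  have ha' := ha.trans_le haa'
  have hb' := hb.trans_le hbb'
  have hnrm : ∀ a b : ℝ, 0 < a → 0 < b →
      nrm a b g = (∫⁻ t, ((∫⁻ x, ‖g t x‖ₑ ^ b) ^ (1 / b)) ^ a) ^ (1 / a) := fun a b _ _ => by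
    rw [nrm]
    congr 1
    refine lintegral_congr fun t => ?_
    rw [← ENNReal.rpow_mul]
    congr 1; ring
  have hm : ∀ b : ℝ, Measurable fun t => (∫⁻ x, ‖g t x‖ₑ ^ b) ^ (1 / b) := fun b =>
    (measurable_lintegral_enorm_rpow hg b).pow_const _
  rw [hnrm a b ha hb, hnrm a' b' ha' hb']
  set D := volume B ^ (1 / b - 1 / b')
  calc (∫⁻ t, ((∫⁻ x, ‖g t x‖ₑ ^ b) ^ (1 / b)) ^ a) ^ (1 / a)
      ≤ (∫⁻ t, ((∫⁻ x, ‖g t x‖ₑ ^ b') ^ (1 / b') * D) ^ a) ^ (1 / a) := by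
        refine ENNReal.rpow_le_rpow (lintegral_mono fun t => ENNReal.rpow_le_rpow ?_ ha.le)
          (by positivity)
        exact lintegral_rpow_le_of_support (hg.comp measurable_prodMk_left).enorm hB
          (fun x hx => (hgS t x (by simpa using hx)).2) hb hbb'
    _ = (∫⁻ t, ((∫⁻ x, ‖g t x‖ₑ ^ b') ^ (1 / b')) ^ a) ^ (1 / a) * D := by
        simp only [ENNReal.mul_rpow_of_nonneg _ _ ha.le]
        rw [lintegral_mul_const _ ((hm b').pow_const _), ENNReal.mul_rpow_of_nonneg _ _ (by positivity),
          ← ENNReal.rpow_mul, mul_one_div_cancel ha.ne', ENNReal.rpow_one]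
    _ ≤ ((∫⁻ t, ((∫⁻ x, ‖g t x‖ₑ ^ b') ^ (1 / b')) ^ a') ^ (1 / a') *
          volume S ^ (1 / a - 1 / a')) * D := by
        refine mul_le_mul_left (lintegral_rpow_le_of_support (hm b') hS (fun t ht => ?_) ha haa') _
        by_contra hc
        refine ht ?_
        have : ∀ x, g t x = 0 := fun x => by
          by_contra hx; exact hc (hgS t x hx).1
        simp [this, hb']
    _ = _ := by ring

end

section

variable {d : ℕ}

theorem liminf_rpow_ennreal (u : ℕ → ℝ≥0∞) {p : ℝ} (hp : 0 < p) :
    liminf u atTop ^ p = liminf (fun n => u n ^ p) atTop :=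
  OrderIso.liminf_apply (g := ENNReal.orderIsoRpow p hp) (f := atTop) (u := u)
    (by isBoundedDefault) (by isBoundedDefault) (by isBoundedDefault) (by isBoundedDefault)

theorem eLpNorm_le_liminf {α : Type*} [MeasurableSpace α] {μ : Measure α} {f : α → ℝ≥0∞}
    {fn : ℕ → α → ℝ≥0∞} (hfn : ∀ n, Measurable (fn n))
    (hf : ∀ x, f x ≤ liminf (fun n => fn n x) atTop) {Q : ℝ≥0∞} (hQ0 : Q ≠ 0) {p : ℕ → ℝ}
    (hp : ∀ n, 0 < p n) (hQ : Q ≠ ∞ → ∀ n, p n = Q.toReal)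
    (hQ' : Q = ∞ → Tendsto p atTop atTop) :
    eLpNorm f Q μ ≤ liminf (fun n => (∫⁻ x, fn n x ^ p n ∂μ) ^ (1 / p n)) atTop := by
  by_cases hQi : Q = ∞
  · subst hQi
    rw [eLpNorm_exponent_top, eLpNormEssSup]
    simp only [enorm_eq_self]
    refine le_of_forall_lt_imp_le_of_dense fun l hl => ?_
    have hl' : μ {x | l < f x} ≠ 0 := fun h0 => by
      refine absurd hl (not_lt.2 (essSup_le_of_ae_le _ ?_))
      have : ∀ᵐ x ∂μ, ¬ l < f x := by rw [ae_iff]; simpa using h0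
      filter_upwards [this] with x hx using not_lt.1 hx
    set A : ℕ → Set α := fun k => {x | ∀ j, k ≤ j → l < fn j x} with hA
    have hsub : {x | l < f x} ⊆ ⋃ k, A k := fun x hx => by
      have h1 : l < liminf (fun n => fn n x) atTop := lt_of_lt_of_le hx (hf x)
      have := eventually_lt_of_lt_liminf h1
      obtain ⟨k, hk⟩ := eventually_atTop.1 this
      exact Set.mem_iUnion.2 ⟨k, hk⟩
    have hk : ∃ k, μ (A k) ≠ 0 := by
      by_contra! hc
      exact hl' (measure_mono_null hsub (measure_iUnion_null hc))
    obtain ⟨k, hk⟩ := hk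
    have hlt : l ≠ ∞ := ne_top_of_lt hl
    set m := min (μ (A k)) 1 with hm
    have hm0 : m ≠ 0 := by
      rw [hm]; exact (lt_min (pos_iff_ne_zero.2 hk) one_pos).ne'
    have hmt : m ≠ ∞ := ne_top_of_le_ne_top ENNReal.one_ne_top (min_le_right _ _)
    have hlim : Tendsto (fun n => l * m ^ (1 / p n)) atTop (nhds l) := by
      have h1 : Tendsto (fun n => 1 / p n) atTop (nhds 0) :=
        tendsto_const_nhds.div_atTop (hQ' rfl)
      have h2 : Tendsto (fun n => m ^ (1 / p n)) atTop (nhds 1) := by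
        have h3 : Tendsto (fun n => (m.toNNReal : NNReal) ^ (1 / p n)) atTop (nhds 1) := by
          have := (NNReal.continuousAt_rpow (x := m.toNNReal) (y := 0)
            (Or.inl (by simpa [ENNReal.toNNReal_eq_zero_iff] using ⟨hm0, hmt⟩))).tendsto.comp
              (tendsto_const_nhds.prodMk_nhds h1)
          simpa [Function.comp_def] using this
        have h4 := ENNReal.tendsto_coe.2 h3
        refine (tendsto_congr fun n => ?_).1 h4
        rw [ENNReal.coe_rpow_of_ne_zero, ENNReal.coe_toNNReal hmt]
        simpa [ENNReal.toNNReal_eq_zero_iff] using ⟨hm0, hmt⟩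
      simpa using ENNReal.Tendsto.const_mul h2 (Or.inr hlt)
    rw [← hlim.liminf_eq]
    refine liminf_le_liminf ?_
    filter_upwards [eventually_ge_atTop k] with n hn
    have hAm : MeasurableSet (A k) := by
      have : A k = ⋂ j, ⋂ (_ : k ≤ j), {x | l < fn j x} := by ext x; simp [hA]
      rw [this]
      exact MeasurableSet.iInter fun j => MeasurableSet.iInter fun _ =>
        measurableSet_lt measurable_const (hfn j)
    calc l * m ^ (1 / p n) = (l ^ p n * m) ^ (1 / p n) := by
          rw [ENNReal.mul_rpow_of_nonneg _ _ (one_div_nonneg.2 (hp n).le), ← ENNReal.rpow_mul,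
            mul_one_div_cancel (hp n).ne', ENNReal.rpow_one]
      _ ≤ (∫⁻ x, fn n x ^ p n ∂μ) ^ (1 / p n) := by
          refine ENNReal.rpow_le_rpow ?_ (one_div_nonneg.2 (hp n).le)
          calc l ^ p n * m ≤ l ^ p n * μ (A k) := by gcongr; exact min_le_left _ _
            _ = ∫⁻ x in A k, l ^ p n ∂μ := by rw [setLIntegral_const]
            _ ≤ ∫⁻ x in A k, fn n x ^ p n ∂μ :=
                setLIntegral_mono' hAm fun x hx =>
                  ENNReal.rpow_le_rpow (hx n hn).le (hp n).le
            _ ≤ _ := setLIntegral_le_lintegral _ _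
  · have hp' := hQ hQi
    have hq : 0 < Q.toReal := ENNReal.toReal_pos hQ0 hQi
    rw [eLpNorm_eq_lintegral_rpow_enorm_toReal hQ0 hQi]
    simp only [hp', enorm_eq_self]
    rw [← liminf_rpow_ennreal _ (one_div_pos.2 hq)]
    refine ENNReal.rpow_le_rpow ?_ (one_div_nonneg.2 hq.le)
    refine le_trans (lintegral_mono fun x => ?_)
      (lintegral_liminf_le fun n => (hfn n).pow_const _)
    show f x ^ Q.toReal ≤ _
    rw [← liminf_rpow_ennreal _ hq]
    exact ENNReal.rpow_le_rpow (hf x) hq.le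

theorem exists_exponents {Q : ℝ≥0∞} (hQ : 2 ≤ Q) {K : ℕ → ℝ≥0∞} (hK : ∀ n, K n ≠ ∞) :
    ∃ p : ℕ → ℝ, (∀ n, 2 ≤ p n) ∧ (∀ n, 1 / Q.toReal ≤ 1 / p n) ∧
      (Q ≠ ∞ → ∀ n, p n = Q.toReal) ∧ (Q = ∞ → Tendsto p atTop atTop) ∧
      ∀ n, K n ^ (1 / p n - 1 / Q.toReal) ≤ 2 := by
  by_cases hQi : Q = ∞
  · subst hQi
    have h1 : ∀ n, ∃ m : ℕ, K n ≤ 2 ^ m := fun n => by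
      obtain ⟨m, hm⟩ := pow_unbounded_of_one_lt (K n).toNNReal (one_lt_two (α := NNReal))
      refine ⟨m, ?_⟩
      rw [← ENNReal.coe_toNNReal (hK n)]
      exact_mod_cast hm.le
    choose m hm using h1
    have hpos : ∀ n, (0 : ℝ) < 2 + n + m n := fun n => by positivity
    refine ⟨fun n => 2 + n + m n, fun n => ?_, fun n => ?_, fun h => absurd rfl h, fun _ => ?_,
      fun n => ?_⟩
    · have : (0 : ℝ) ≤ n + m n := by positivity
      linarith
    · simpa using (hpos n).le
    · refine tendsto_atTop_mono (fun n => ?_) tendsto_natCast_atTop_atTop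
      have : (0 : ℝ) ≤ m n := by positivity
      linarith
    · simp only [ENNReal.toReal_top, div_zero, sub_zero]
      rw [one_div, ENNReal.rpow_inv_le_iff (hpos n)]
      refine (hm n).trans ?_
      rw [← ENNReal.rpow_natCast]
      refine ENNReal.rpow_le_rpow_of_exponent_le (by norm_num) ?_
      have : (0 : ℝ) ≤ n := by positivity
      linarith
  · refine ⟨fun _ => Q.toReal, fun _ => ?_, fun _ => le_rfl, fun _ _ => rfl,
      fun h => absurd h hQi, fun n => ?_⟩
    · have := ENNReal.toReal_mono hQi hQ
      simpa using this
    · simp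

theorem mixedNorm_eq_eLpNorm {q : ℝ≥0∞} (hq : q ≠ 0) (I : Set ℝ) (g : ℝ → ℝ≥0∞) :
    mixedNorm q I g = eLpNorm g q (volume.restrict I) := by
  rw [mixedNorm]
  split_ifs with h
  · rw [h, eLpNorm_exponent_top, eLpNormEssSup]; simp
  · rw [eLpNorm_eq_lintegral_rpow_enorm_toReal hq h]; simp

end

section

variable {d : ℕ}

theorem mixedNorm_le_of_dual {W : ℝ → Ed d → ℂ} (hW : Measurable (Function.uncurry W))
    {Q R : ℝ≥0∞} (hQ : 2 ≤ Q) (hR : 2 ≤ R) {a b : ℝ} (ha0 : 0 < a) (hb0 : 0 < b)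
    (ha : 1 / a = 1 - 1 / Q.toReal) (hb : 1 / b = 1 - 1 / R.toReal) {T : Set ℝ}
    (hT : MeasurableSet T) {N : ℝ≥0∞}
    (h : ∀ g, Nice g → (∀ t x, g t x ≠ 0 → t ∈ T) →
      ‖∫ p : ℝ × Ed d, W p.1 p.2 * g p.1 p.2‖ₑ ≤ N * nrm a b g) :
    mixedNorm Q T (fun t => eLpNorm (W t) R volume) ≤ 4 * N := by
  classical
  have hQ0 : Q ≠ 0 := (lt_of_lt_of_le two_pos hQ).ne'
  have hR0 : R ≠ 0 := (lt_of_lt_of_le two_pos hR).ne'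
  obtain ⟨p, hp2, hpQ, hpf, hpi, hpK⟩ := exists_exponents hQ
    (K := fun n : ℕ => volume (Set.Icc (-(n : ℝ)) n)) (fun n => by simp)
  obtain ⟨r, hr2, hrR, hrf, hri, hrK⟩ := exists_exponents hR
    (K := fun n : ℕ => volume (Metric.closedBall (0 : Ed d) n))
    (fun n => measure_closedBall_lt_top.ne)
  have hp0 : ∀ n, 0 < p n := fun n => by linarith [hp2 n]
  have hr0 : ∀ n, 0 < r n := fun n => by linarith [hr2 n]
  have hpa : ∀ n, (p n).conjExponent.HolderConjugate (p n) := fun n =>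
    (Real.HolderConjugate.conjExponent (by linarith [hp2 n])).symm
  have hrb : ∀ n, (r n).conjExponent.HolderConjugate (r n) := fun n =>
    (Real.HolderConjugate.conjExponent (by linarith [hr2 n])).symm
  have hpa' : ∀ n, 1 / (p n).conjExponent = 1 - 1 / p n := fun n => by
    have := (hpa n).inv_add_inv_eq_one
    rw [one_div, one_div]; linarith
  have hrb' : ∀ n, 1 / (r n).conjExponent = 1 - 1 / r n := fun n => by
    have := (hrb n).inv_add_inv_eq_one
    rw [one_div, one_div]; linarith
  set Wn : ℕ → ℝ → Ed d → ℂ := fun n => cut (T ×ˢ Set.univ) (cut (truncSet W n) W) with hWn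
  have hnice : ∀ n, Nice (Wn n) := fun n =>
    (nice_cut_truncSet hW n).restrict (hT.prod MeasurableSet.univ)
  have happ : ∀ n t x, Wn n t x = if t ∈ T ∧ (t, x) ∈ truncSet W n then W t x else 0 :=
    fun n t x => by
      simp only [hWn, cut_apply, Set.mem_prod, Set.mem_univ, and_true]
      split_ifs <;> simp_all
  have hmain : ∀ n, nrm (p n) (r n) (Wn n) ≤ 4 * N := fun n => by
    refine nrm_le_of_dual (hnice n) (hpa n) (hrb n) (hr2 n) fun g hg hgW => ?_
    have hmem : ∀ t x, g t x ≠ 0 → t ∈ T ∧ (t, x) ∈ truncSet W n := fun t x hgx => by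
      by_contra hc
      exact hgx (hgW t x (by rw [happ, if_neg hc]))
    have heq : ∀ q : ℝ × Ed d, Wn n q.1 q.2 * g q.1 q.2 = W q.1 q.2 * g q.1 q.2 := fun q => by
      by_cases hq : g q.1 q.2 = 0
      · rw [hq, mul_zero, mul_zero]
      · rw [happ, if_pos (hmem _ _ hq)]
    simp only [heq]
    have haa : a ≤ (p n).conjExponent := by
      rw [← one_div_le_one_div (hpa n).pos ha0, hpa', ha]
      linarith [hpQ n]
    have hbb : b ≤ (r n).conjExponent := by
      rw [← one_div_le_one_div (hrb n).pos hb0, hrb', hb]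
      linarith [hrR n]
    have hgS : ∀ t x, g t x ≠ 0 →
        t ∈ Set.Icc (-(n : ℝ)) n ∧ x ∈ Metric.closedBall (0 : Ed d) n := fun t x hgx =>
      ⟨abs_le.1 (hmem t x hgx).2.1, by simpa using (hmem t x hgx).2.2.1⟩
    have hsup := nrm_le_of_support hg.meas measurableSet_Icc
      Metric.isClosed_closedBall.measurableSet hgS ha0 haa hb0 hbb
    have e1 : 1 / a - 1 / (p n).conjExponent = 1 / p n - 1 / Q.toReal := by
      rw [hpa', ha]; ring
    have e2 : 1 / b - 1 / (r n).conjExponent = 1 / r n - 1 / R.toReal := by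
      rw [hrb', hb]; ring
    rw [e1, e2] at hsup
    have hsup' := hsup.trans (mul_le_mul_right (mul_le_mul' (hrK n) (hpK n)) _)
    refine (h g hg fun t x hgx => (hmem t x hgx).1).trans ?_
    refine (mul_le_mul_right hsup' N).trans_eq ?_
    rw [show (2 * 2 : ℝ≥0∞) = 4 by norm_num]; ring
  have hfn : ∀ n, Measurable fun t => (∫⁻ x, ‖Wn n t x‖ₑ ^ r n) ^ (1 / r n) := fun n =>
    (measurable_lintegral_enorm_rpow (hnice n).meas (r n)).pow_const _
  rw [mixedNorm_eq_eLpNorm hQ0]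
  have hind : eLpNorm (fun t => eLpNorm (W t) R volume) Q (volume.restrict T) =
      eLpNorm (T.indicator fun t => eLpNorm (W t) R volume) Q (volume.restrict T) := by
    refine eLpNorm_congr_ae ?_
    filter_upwards [ae_restrict_mem hT] with t ht
    rw [Set.indicator_of_mem ht]
  rw [hind]
  refine (eLpNorm_le_liminf hfn (fun t => ?_) hQ0 hp0 hpf hpi).trans ?_
  · by_cases ht : t ∈ T
    · rw [Set.indicator_of_mem ht, ← eLpNorm_enorm]
      refine eLpNorm_le_liminf (f := fun x => ‖W t x‖ₑ) (fn := fun n x => ‖Wn n t x‖ₑ)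
        (fun n => ((hnice n).measurable_left t).enorm) (fun x => ?_) hR0 hr0 hrf hri
      refine le_liminf_of_le (by isBoundedDefault) ?_
      filter_upwards [tendsto_cut_truncSet W t x] with n hn
      rw [happ]
      rw [cut_apply] at hn
      simp only [ht, true_and]
      rw [hn]
    · rw [Set.indicator_of_notMem ht]; exact bot_le
  · refine liminf_le_of_le (by isBoundedDefault) fun c hc => ?_
    obtain ⟨n, hn⟩ := hc.exists
    refine hn.trans (le_trans ?_ (hmain n))
    rw [nrm]
    refine ENNReal.rpow_le_rpow ((setLIntegral_le_lintegral _ _).trans_eq ?_)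
      (one_div_nonneg.2 (hp0 n).le)
    refine lintegral_congr fun t => ?_
    rw [← ENNReal.rpow_mul]
    congr 1; ring

end

section

variable {d : ℕ}

open FourierTransform

/-- A measurable field of spectral densities with a common integrable majorant. -/
structure SpecField (γ : ℝ → Ed d → ℂ) (Γ : Ed d → ℝ) : Prop where
  meas : Measurable (Function.uncurry γ)
  int : Integrable Γ
  le : ∀ σ η, ‖γ σ η‖ ≤ Γ η

theorem SpecField.integrable {γ : ℝ → Ed d → ℂ} {Γ : Ed d → ℝ} (h : SpecField γ Γ) (σ : ℝ) :
    Integrable (γ σ) :=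
  h.int.mono' (h.meas.comp measurable_prodMk_left).aestronglyMeasurable
    (Eventually.of_forall (h.le σ))

theorem SpecField.nonneg {γ : ℝ → Ed d → ℂ} {Γ : Ed d → ℝ} (h : SpecField γ Γ) (η : Ed d) :
    0 ≤ Γ η := (norm_nonneg _).trans (h.le 0 η)

theorem measurable_fourier_left {γ : ℝ → Ed d → ℂ} (h : Measurable (Function.uncurry γ)) :
    Measurable (Function.uncurry fun σ => 𝓕 (γ σ)) := by
  have h1 : StronglyMeasurable fun q : (ℝ × Ed d) × Ed d =>
      Complex.exp (((-2 * Real.pi * ⟪q.2, q.1.2⟫ : ℝ) : ℂ) * Complex.I) • γ q.1.1 q.2 := by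
    refine Measurable.stronglyMeasurable ?_
    have hc : Measurable fun q : (ℝ × Ed d) × Ed d =>
        Complex.exp (((-2 * Real.pi * ⟪q.2, q.1.2⟫ : ℝ) : ℂ) * Complex.I) := by fun_prop
    refine hc.smul ?_
    exact h.comp (measurable_fst.fst.prodMk measurable_snd)
  have h2 := (h1.integral_prod_right' (ν := (volume : Measure (Ed d)))).measurable
  convert h2 using 1
  funext p
  simp only [Function.uncurry, Real.fourier_eq']

theorem fourierInv_eq_fourier_neg (f : Ed d → ℂ) : 𝓕⁻ f = 𝓕 fun x => f (-x) := by
  funext ξ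
  rw [Real.fourierInv_eq_fourier_neg, Real.fourier_eq', Real.fourier_eq', ← integral_neg_eq_self]
  simp

theorem measurable_fourierInv_left {γ : ℝ → Ed d → ℂ} (h : Measurable (Function.uncurry γ)) :
    Measurable (Function.uncurry fun σ => 𝓕⁻ (γ σ)) := by
  simp only [fourierInv_eq_fourier_neg]
  exact measurable_fourier_left (h.comp (measurable_fst.prodMk measurable_snd.neg))

theorem norm_fourierInv_le (f : Ed d → ℂ) (ξ : Ed d) : ‖𝓕⁻ f ξ‖ ≤ ∫ x, ‖f x‖ := by
  rw [Real.fourierInv_eq_fourier_neg]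
  exact norm_fourier_le f _

theorem integral_fourierInv_mul_flip {f g : Ed d → ℂ} (hf : Integrable f) (hg : Integrable g) :
    ∫ ξ, 𝓕⁻ f ξ * g ξ = ∫ x, f x * 𝓕⁻ g x := by
  rw [fourierInv_eq_fourier_neg, integral_fourier_mul_flip hf.comp_neg hg, ← integral_neg_eq_self]
  simp only [neg_neg, Real.fourierInv_eq_fourier_neg]

theorem fourierInv_eq_conj_fourier (f : Ed d → ℂ) (ξ : Ed d) :
    𝓕⁻ f ξ = (starRingEnd ℂ) (𝓕 (fun x => (starRingEnd ℂ) (f x)) ξ) := by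
  rw [conj_fourier, fourierInv_eq_fourier_neg]
  simp

/-- The spectral density of the half-wave Duhamel integral. -/
def duhamel (γ : ℝ → Ed d → ℂ) (t : ℝ) (η : Ed d) : ℂ :=
  ∫ σ in Set.Ioc 0 t, (Real.sin (4 * Real.pi ^ 2 * (t - σ) * ‖η‖ ^ 2) : ℂ) * γ σ η

theorem measurable_duhamel {γ : ℝ → Ed d → ℂ} (h : Measurable (Function.uncurry γ)) :
    Measurable (Function.uncurry (duhamel γ)) := by
  have h1 : StronglyMeasurable fun q : (ℝ × Ed d) × ℝ =>
      {q : (ℝ × Ed d) × ℝ | q.2 ∈ Set.Ioc 0 q.1.1}.indicator (fun q =>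
      (Real.sin (4 * Real.pi ^ 2 * (q.1.1 - q.2) * ‖q.1.2‖ ^ 2) : ℂ) * γ q.2 q.1.2) q := by
    refine Measurable.stronglyMeasurable (Measurable.indicator ?_ ?_)
    · refine Measurable.mul (by fun_prop) ?_
      exact h.comp (measurable_snd.prodMk measurable_fst.snd)
    · exact (measurableSet_lt measurable_const measurable_snd).inter
        (measurableSet_le measurable_snd measurable_fst.fst)
  have h2 := (h1.integral_prod_right' (ν := (volume : Measure ℝ))).measurable
  convert h2 using 1
  funext p
  simp only [Function.uncurry, duhamel]
  rw [← integral_indicator measurableSet_Ioc]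
  rfl

theorem norm_sin_mul_le (x : ℝ) (z : ℂ) : ‖(Real.sin x : ℂ) * z‖ ≤ ‖z‖ := by
  rw [norm_mul, Complex.norm_real]
  exact mul_le_of_le_one_left (norm_nonneg _) (Real.abs_sin_le_one x)

theorem SpecField.norm_duhamel_le {γ : ℝ → Ed d → ℂ} {Γ : Ed d → ℝ} (h : SpecField γ Γ)
    (t : ℝ) (η : Ed d) : ‖duhamel γ t η‖ ≤ |t| * Γ η := by
  have h1 : ‖duhamel γ t η‖ ≤ Γ η * (volume.real (Set.Ioc 0 t)) :=
    norm_setIntegral_le_of_norm_le_const (by simp) fun σ _ =>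
      (norm_sin_mul_le _ _).trans (h.le σ η)
  refine h1.trans ?_
  rw [mul_comm]
  refine mul_le_mul_of_nonneg_right ?_ (h.nonneg η)
  simp only [Measure.real, Real.volume_Ioc, sub_zero]
  rcases le_total 0 t with h0 | h0
  · rw [ENNReal.toReal_ofReal h0]; exact le_abs_self t
  · simp [ENNReal.ofReal_of_nonpos h0]

theorem SpecField.integrable_duhamel {γ : ℝ → Ed d → ℂ} {Γ : Ed d → ℝ} (h : SpecField γ Γ)
    (t : ℝ) : Integrable (duhamel γ t) :=
  (h.int.const_mul |t|).mono'
    ((measurable_duhamel h.meas).comp measurable_prodMk_left).aestronglyMeasurable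
    (Eventually.of_forall (h.norm_duhamel_le t))

theorem SpecField.integral_fourierInv_duhamel_mul {γ : ℝ → Ed d → ℂ} {Γ : Ed d → ℝ}
    (h : SpecField γ Γ) (t : ℝ) {g : Ed d → ℂ} (hg : Integrable g) :
    ∫ x, 𝓕⁻ (duhamel γ t) x * g x = ∫ σ in Set.Ioc 0 t, ∫ η,
      (Real.sin (4 * Real.pi ^ 2 * (t - σ) * ‖η‖ ^ 2) : ℂ) * γ σ η * 𝓕⁻ g η := by
  rw [integral_fourierInv_mul_flip (h.integrable_duhamel t) hg]
  simp only [duhamel, ← integral_mul_const]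
  rw [integral_integral_swap]
  have hc : Continuous (𝓕⁻ g) := by
    rw [fourierInv_eq_fourier_neg]; exact continuous_fourier_of_integrable hg.comp_neg
  have hγm : Measurable fun p : Ed d × ℝ => γ p.2 p.1 :=
    h.meas.comp (measurable_snd.prodMk measurable_fst)
  have hi : Integrable (fun _ : ℝ => (1 : ℝ)) (volume.restrict (Set.Ioc 0 t)) :=
    integrableOn_const (by simp)
  refine ((h.int.mul_prod hi).mul_const (∫ x, ‖g x‖)).mono' ?_ ?_
  · refine Measurable.aestronglyMeasurable ?_
    refine Measurable.mul (Measurable.mul (by fun_prop) hγm) (hc.measurable.comp measurable_fst)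
  · refine Eventually.of_forall fun p => ?_
    change ‖_ * _ * _‖ ≤ _
    rw [norm_mul, mul_one]
    exact mul_le_mul ((norm_sin_mul_le _ _).trans (h.le _ _)) (norm_fourierInv_le g _)
      (norm_nonneg _) (h.nonneg _)

theorem ofReal_sin_eq_phase (τ : ℝ) (η : Ed d) :
    (Real.sin (4 * Real.pi ^ 2 * τ * ‖η‖ ^ 2) : ℂ) =
      (phase (4 * Real.pi ^ 2 * τ) η - phase (-(4 * Real.pi ^ 2 * τ)) η) / (2 * Complex.I) := by
  rw [phase, phase, Complex.ofReal_sin, Complex.sin]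
  have h1 : ∀ x : ℝ, Complex.I * ((-x * ‖η‖ ^ 2 : ℝ) : ℂ) = -((x * ‖η‖ ^ 2 : ℝ) : ℂ) * Complex.I :=
    fun x => by push_cast; ring
  have h2 : ∀ x : ℝ, Complex.I * ((x * ‖η‖ ^ 2 : ℝ) : ℂ) = ((x * ‖η‖ ^ 2 : ℝ) : ℂ) * Complex.I :=
    fun x => by ring
  rw [h1, h2]
  field_simp
  ring_nf
  rw [Complex.I_sq]
  ring

theorem integral_sin_mul_eq_inner {f : Ed d → ℂ} (hf : Integrable f) (hf2 : MemLp (𝓕⁻ f) 2 volume)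
    {g : Ed d → ℂ} (hg : Integrable g) (hg2 : MemLp g 2 volume) (σ t : ℝ) :
    ∫ η, (Real.sin (4 * Real.pi ^ 2 * (t - σ) * ‖η‖ ^ 2) : ℂ) * f η * 𝓕⁻ g η =
      ((starRingEnd ℂ) (inner ℂ (evol d (-(4 * Real.pi ^ 2)) σ (toL2 (𝓕⁻ f)))
          (evol d (-(4 * Real.pi ^ 2)) t (toL2 fun x => (starRingEnd ℂ) (g x)))) -
        (starRingEnd ℂ) (inner ℂ (evol d (4 * Real.pi ^ 2) σ (toL2 (𝓕⁻ f)))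
          (evol d (4 * Real.pi ^ 2) t (toL2 fun x => (starRingEnd ℂ) (g x))))) /
        (2 * Complex.I) := by
  have hgc : Integrable fun x => (starRingEnd ℂ) (g x) := by
    simpa using (LinearIsometryEquiv.integrable_comp_iff Complex.conjLIE).2 hg
  have hgc2 : MemLp (fun x => (starRingEnd ℂ) (g x)) 2 volume :=
    hg2.of_le (continuous_star.comp_aestronglyMeasurable hg2.1)
      (Eventually.of_forall fun x => by simp)
  have hfa := fourier_toL2_fourierInv_ae_eq hf hf2
  have hga := fourier_toL2_ae_eq hgc hgc2
  have key : ∀ θ : ℝ, (starRingEnd ℂ) (inner ℂ (evol d θ σ (toL2 (𝓕⁻ f)))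
      (evol d θ t (toL2 fun x => (starRingEnd ℂ) (g x)))) =
      ∫ η, phase (-(θ * (t - σ))) η * (f η * 𝓕⁻ g η) := fun θ => by
    rw [inner_evol hfa hga, ← integral_conj]
    refine integral_congr_ae (Eventually.of_forall fun η => ?_)
    simp only [map_mul, conj_phase, Complex.conj_conj, ← fourierInv_eq_conj_fourier]
  have hc : Continuous (𝓕⁻ g) := by
    rw [fourierInv_eq_fourier_neg]; exact continuous_fourier_of_integrable hg.comp_neg
  have hi : Integrable fun η => f η * 𝓕⁻ g η :=
    hf.mul_bdd (c := ∫ x, ‖g x‖) hc.aestronglyMeasurable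
      (Eventually.of_forall (norm_fourierInv_le g))
  have hip : ∀ c, Integrable fun η => phase c η * (f η * 𝓕⁻ g η) := fun c =>
    hi.bdd_mul (c := 1) (continuous_phase c).aestronglyMeasurable
      (Eventually.of_forall fun η => (norm_phase c η).le)
  rw [key, key, ← integral_sub (hip _) (hip _), ← integral_div]
  refine integral_congr_ae (Eventually.of_forall fun η => ?_)
  simp only [ofReal_sin_eq_phase]
  rw [show -(-(4 * Real.pi ^ 2) * (t - σ)) = 4 * Real.pi ^ 2 * (t - σ) by ring]
  ring

end

section

variable {d : ℕ}

open FourierTransform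

theorem Nice.conj {g : ℝ → Ed d → ℂ} (hg : Nice g) : Nice fun t x => (starRingEnd ℂ) (g t x) := by
  obtain ⟨M, hM0, hM⟩ := hg.bdd
  obtain ⟨R, hR0, hR⟩ := hg.supp
  refine ⟨continuous_star.measurable.comp hg.meas, ⟨M, hM0, fun s x => ?_⟩,
    ⟨R, hR0, fun s x h => hR s x fun h0 => h ?_⟩⟩
  · rw [RCLike.norm_conj]; exact hM s x
  · simp [h0]

theorem toL2_zero : toL2 (fun _ : Ed d => (0 : ℂ)) = 0 := by
  rw [toL2_eq (MemLp.zero' : MemLp (fun _ : Ed d => (0 : ℂ)) 2 volume)]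
  rfl

theorem Dispersive.integrable_vfield_of_lintegral {H : Type*} [NormedAddCommGroup H]
    [InnerProductSpace ℂ H] {σ C₀ : ℝ}
    {V : ℝ → Lp ℂ 2 (volume : Measure (Ed d)) →L[ℂ] H} (hV : Dispersive σ C₀ V)
    {F : ℝ → Ed d → ℂ} (hF : Measurable (Function.uncurry F))
    (hF2 : ∀ s, MemLp (F s) 2 volume) (hF1 : ∫⁻ s, eLpNorm (F s) 2 volume < ∞) :
    Integrable (vfield V F) :=
  ⟨(hV.stronglyMeasurable_vfield hF hF2).aestronglyMeasurable,
    (lintegral_mono fun s => hV.enorm_vfield_le F s).trans_lt hF1⟩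

theorem SpecField.integrable_fourierInv_duhamel_mul {γ : ℝ → Ed d → ℂ} {Γ : Ed d → ℝ}
    (h : SpecField γ Γ) {g : ℝ → Ed d → ℂ} (hg : Nice g) :
    Integrable fun p : ℝ × Ed d => 𝓕⁻ (duhamel γ p.1) p.2 * g p.1 p.2 := by
  obtain ⟨R, hR0, hR⟩ := hg.supp
  have hm : Measurable fun p : ℝ × Ed d => 𝓕⁻ (duhamel γ p.1) p.2 :=
    measurable_fourierInv_left (measurable_duhamel h.meas)
  have hΓ : 0 ≤ ∫ η, Γ η := integral_nonneg h.nonneg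
  have hgm : Measurable fun p : ℝ × Ed d => g p.1 p.2 := hg.meas
  refine (hg.integrable.norm.const_mul (R * ∫ η, Γ η)).mono' (hm.mul hgm).aestronglyMeasurable
    (Eventually.of_forall fun p => ?_)
  rw [norm_mul]
  by_cases hp : g p.1 p.2 = 0
  · simp only [hp, norm_zero, mul_zero]; positivity
  · refine mul_le_mul_of_nonneg_right ?_ (norm_nonneg _)
    calc _ ≤ ∫ η, ‖duhamel γ p.1 η‖ := norm_fourierInv_le _ _
      _ ≤ ∫ η, |p.1| * Γ η := integral_mono (h.integrable_duhamel _).norm (h.int.const_mul _)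
          (h.norm_duhamel_le p.1)
      _ = |p.1| * ∫ η, Γ η := integral_const_mul _ _
      _ ≤ _ := mul_le_mul_of_nonneg_right (hR _ _ hp).1 hΓ

theorem SpecField.integral_fourierInv_duhamel_mul_eq {γ : ℝ → Ed d → ℂ} {Γ : Ed d → ℝ}
    (h : SpecField γ Γ) {A : Set ℝ} (hA : MeasurableSet A) (hA0 : ∀ σ ∈ A, 0 < σ)
    (hA2 : ∀ σ ∈ A, MemLp (𝓕⁻ (γ σ)) 2 volume)
    (hA1 : ∫⁻ σ, eLpNorm (cut (A ×ˢ Set.univ) (fun σ => 𝓕⁻ (γ σ)) σ) 2 volume < ∞)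
    {g : ℝ → Ed d → ℂ} (hg : Nice g)
    (hgA : ∀ t x, g t x ≠ 0 → ∀ᵐ σ, σ ∈ Set.Ioc 0 t → σ ∈ A) :
    ∫ p : ℝ × Ed d, 𝓕⁻ (duhamel γ p.1) p.2 * g p.1 p.2 =
      ((starRingEnd ℂ) (retard (evol d (-(4 * Real.pi ^ 2)))
          (cut (A ×ˢ Set.univ) fun σ => 𝓕⁻ (γ σ)) fun t x => (starRingEnd ℂ) (g t x)) -
        (starRingEnd ℂ) (retard (evol d (4 * Real.pi ^ 2))
          (cut (A ×ˢ Set.univ) fun σ => 𝓕⁻ (γ σ)) fun t x => (starRingEnd ℂ) (g t x))) /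
        (2 * Complex.I) := by
  classical
  set F := cut (A ×ˢ Set.univ) fun σ => 𝓕⁻ (γ σ) with hF
  set g' : ℝ → Ed d → ℂ := fun t x => (starRingEnd ℂ) (g t x) with hg'
  have hFin : ∀ σ ∈ A, F σ = 𝓕⁻ (γ σ) := fun σ hσ => by
    funext x; rw [hF, cut_apply, if_pos ⟨hσ, trivial⟩]
  have hFout : ∀ σ, σ ∉ A → F σ = fun _ => 0 := fun σ hσ => by
    funext x; rw [hF, cut_apply, if_neg fun h => hσ h.1]
  have hFm : Measurable (Function.uncurry F) :=
    (measurable_fourierInv_left h.meas).indicator (hA.prod MeasurableSet.univ)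
  have hF2 : ∀ σ, MemLp (F σ) 2 volume := fun σ => by
    by_cases hσ : σ ∈ A
    · rw [hFin σ hσ]; exact hA2 σ hσ
    · rw [hFout σ hσ]; exact MemLp.zero'
  have hπ : (4 * Real.pi ^ 2 : ℝ) ≠ 0 := by positivity
  have hintg : ∀ θ : ℝ, θ ≠ 0 → Integrable fun p : ℝ × ℝ =>
      (starRingEnd ℂ) (inner ℂ (vfield (evol d θ) F p.1) (vfield (evol d θ) g' p.2)) :=
    fun θ hθ => by
      have := integrable_inner_prod
        ((dispersive_evol hθ).integrable_vfield_of_lintegral hFm hF2 hA1)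
        ((dispersive_evol hθ).integrable_vfield hg.conj)
      simpa using (LinearIsometryEquiv.integrable_comp_iff Complex.conjLIE).2 this
  set K : ℝ × ℝ → ℂ := fun p =>
    ((starRingEnd ℂ) (inner ℂ (vfield (evol d (-(4 * Real.pi ^ 2))) F p.1)
        (vfield (evol d (-(4 * Real.pi ^ 2))) g' p.2)) -
      (starRingEnd ℂ) (inner ℂ (vfield (evol d (4 * Real.pi ^ 2)) F p.1)
        (vfield (evol d (4 * Real.pi ^ 2)) g' p.2))) / (2 * Complex.I) with hK
  have hKi : Integrable K := ((hintg _ (neg_ne_zero.2 hπ)).sub (hintg _ hπ)).div_const _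
  have hKg : ∀ σ t, (∀ x, g t x = 0) → K (σ, t) = 0 := fun σ t ht => by
    have : g' t = fun _ => 0 := by funext x; simp [hg', ht]
    simp only [hK, vfield, this, toL2_zero, map_zero, inner_zero_right, sub_self, zero_div]
  have hKA : ∀ σ t, σ ∉ A → K (σ, t) = 0 := fun σ t hσ => by
    simp only [hK, vfield, hFout σ hσ, toL2_zero, map_zero, inner_zero_left, sub_self, zero_div]
  have hgi : ∀ t, Integrable (g t) := fun t => memLp_one_iff_integrable.1 (hg.memLp t 1)
  have hstep : ∀ t, ∫ x, 𝓕⁻ (duhamel γ t) x * g t x = ∫ σ, triangle.indicator K (σ, t) := by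
    intro t
    by_cases ht : ∀ x, g t x = 0
    · have : ∀ σ, triangle.indicator K (σ, t) = 0 := fun σ => by
        rw [Set.indicator_apply]; split_ifs
        · exact hKg σ t ht
        · rfl
      simp [ht, this]
    · push Not at ht
      obtain ⟨x₀, hx₀⟩ := ht
      rw [h.integral_fourierInv_duhamel_mul t (hgi t), ← integral_indicator measurableSet_Ioc]
      refine integral_congr_ae ?_
      have hne : ∀ᵐ σ : ℝ, σ ≠ t := by simp [ae_iff]
      filter_upwards [hgA t x₀ hx₀, hne] with σ hσ hσt
      by_cases hσA : σ ∈ A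
      · by_cases hlt : σ < t
        · rw [Set.indicator_of_mem (show σ ∈ Set.Ioc 0 t from ⟨hA0 σ hσA, hlt.le⟩),
            Set.indicator_of_mem (show (σ, t) ∈ triangle from hlt),
            integral_sin_mul_eq_inner (h.integrable σ) (hA2 σ hσA) (hgi t) (hg.memLp t 2)]
          simp only [hK, vfield, hFin σ hσA, hg']
        · rw [Set.indicator_of_notMem (fun hc => hσt (le_antisymm hc.2 (not_lt.1 hlt))),
            Set.indicator_of_notMem (show (σ, t) ∉ triangle from hlt)]
      · rw [Set.indicator_of_notMem fun hc => hσA (hσ hc), Set.indicator_apply, hKA σ t hσA,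
          ite_self]
  have hI1 := h.integrable_fourierInv_duhamel_mul hg
  rw [Measure.volume_eq_prod] at hI1
  have hretard : ∀ θ : ℝ, (starRingEnd ℂ) (retard (evol d θ) F g') = ∫ p in triangle,
      (starRingEnd ℂ) (inner ℂ (vfield (evol d θ) F p.1) (vfield (evol d θ) g' p.2)) := fun θ => by
    rw [retard, ← integral_conj]
  rw [Measure.volume_eq_prod, integral_prod _ hI1]
  simp only [hstep]
  rw [← integral_prod_symm _ (by
      rw [← Measure.volume_eq_prod]; exact hKi.indicator measurableSet_triangle),
    ← Measure.volume_eq_prod, integral_indicator measurableSet_triangle, hretard, hretard,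
    ← integral_sub (hintg _ (neg_ne_zero.2 hπ)).integrableOn (hintg _ hπ).integrableOn,
    ← integral_div]

end

section

variable {d : ℕ}

open FourierTransform

theorem nrm_conj (a b : ℝ) (g : ℝ → Ed d → ℂ) :
    nrm a b (fun t x => (starRingEnd ℂ) (g t x)) = nrm a b g := by
  have : ∀ z : ℂ, ‖(starRingEnd ℂ) z‖ₑ = ‖z‖ₑ := fun z => by
    rw [← ofReal_norm, RCLike.norm_conj, ofReal_norm]
  simp only [nrm, this]

theorem eLpNorm_two_le_of_bound {f : Ed d → ℂ} {M b : ℝ} (hM : ∀ x, ‖f x‖ ≤ M)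
    (hb2 : b ≤ 2) : eLpNorm f 2 volume ≤
      (ENNReal.ofReal M ^ (2 - b)) ^ (1 / 2 : ℝ) * (∫⁻ x, ‖f x‖ₑ ^ b) ^ (1 / 2 : ℝ) := by
  rw [eLpNorm_eq_lintegral_rpow_enorm_toReal (by norm_num) (by norm_num), ENNReal.toReal_ofNat,
    ← ENNReal.mul_rpow_of_nonneg _ _ (by norm_num)]
  refine ENNReal.rpow_le_rpow ?_ (by norm_num)
  rw [← lintegral_const_mul' _ _ (by finiteness)]
  refine lintegral_mono fun x => ?_
  rcases eq_or_ne (f x) 0 with h0 | h0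
  · simp [h0]
  · have h1 : ‖f x‖ₑ ≠ 0 := by simpa using h0
    calc ‖f x‖ₑ ^ (2 : ℝ) = ‖f x‖ₑ ^ (2 - b) * ‖f x‖ₑ ^ b := by
          rw [← ENNReal.rpow_add _ _ h1 enorm_ne_top]; congr 1; ring
      _ ≤ _ := by
          refine mul_le_mul' (ENNReal.rpow_le_rpow ?_ (by linarith)) le_rfl
          rw [← ofReal_norm]; exact ENNReal.ofReal_le_ofReal (hM x)

theorem rpow_half_le_one_add {x : ℝ≥0∞} {e : ℝ} (he : 1 / 2 ≤ e) :
    x ^ (1 / 2 : ℝ) ≤ 1 + x ^ e := by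
  rcases le_total x 1 with h | h
  · exact (ENNReal.rpow_le_one h (by norm_num)).trans le_self_add
  · exact (ENNReal.rpow_le_rpow_of_exponent_le h he).trans le_add_self

theorem exists_mixedNorm_fourierInv_duhamel_le (hd : 1 ≤ d) {Q R : ℝ≥0∞} (hQ : 2 ≤ Q) (hR : 2 ≤ R)
    {a b a' b' : ℝ} (ha : 1 ≤ a) (ha2 : a ≤ 2) (hb : 1 ≤ b) (hb2 : b ≤ 2)
    (hab : 1 - 1 / a = (d / 2 : ℝ) * (1 / b - 1 / 2))
    (ha' : 1 ≤ a') (ha2' : a' ≤ 2) (hb' : 1 ≤ b') (hb2' : b' ≤ 2)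
    (hab' : 1 - 1 / a' = (d / 2 : ℝ) * (1 / b' - 1 / 2))
    (h2 : d = 2 → 1 < b) (h2' : d = 2 → 1 < b')
    (haQ : 1 / a' = 1 - 1 / Q.toReal) (hbR : 1 / b' = 1 - 1 / R.toReal) :
    ∃ C : ℝ≥0∞, C ≠ ∞ ∧ ∀ (γ : ℝ → Ed d → ℂ) (Γ : Ed d → ℝ), SpecField γ Γ →
      ∀ I : Set ℝ, I.OrdConnected → I ⊆ Set.Ici (0 : ℝ) → (0 : ℝ) ∈ I →
        mixedNorm Q I (fun t => eLpNorm (𝓕⁻ (duhamel γ t)) R volume) ≤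
          C * (∫⁻ σ in I, (∫⁻ x, ‖𝓕⁻ (γ σ) x‖ₑ ^ b) ^ (a / b)) ^ (1 / a) := by
  have ha0 : 0 < a := by linarith
  have hb0 : 0 < b := by linarith
  have hπ : (4 * Real.pi ^ 2 : ℝ) ≠ 0 := by positivity
  obtain ⟨C₁, hC₁, h₁⟩ := (dispersive_evol (d := d) (neg_ne_zero.2 hπ)).exists_enorm_retard_le hd
    (by positivity) ha ha2 hb hb2 hab ha' ha2' hb' hb2' hab' h2 h2'
  obtain ⟨C₂, hC₂, h₂⟩ := (dispersive_evol (d := d) hπ).exists_enorm_retard_le hd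
    (by positivity) ha ha2 hb hb2 hab ha' ha2' hb' hb2' hab' h2 h2'
  refine ⟨4 * (C₁ + C₂) + 1, by finiteness, fun γ Γ h I hI hI0 h0I => ?_⟩
  have hIm : MeasurableSet I := hI.measurableSet
  set J : ℝ → ℝ≥0∞ := fun σ => ∫⁻ x, ‖𝓕⁻ (γ σ) x‖ₑ ^ b with hJ
  have hGm := measurable_fourierInv_left h.meas
  have hJm : Measurable J := measurable_lintegral_enorm_rpow hGm b
  set N := (∫⁻ σ in I, J σ ^ (a / b)) ^ (1 / a) with hN
  rcases eq_or_ne N ∞ with hNi | hNi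
  · rw [hNi, ENNReal.mul_top (by positivity)]; exact le_top
  have hNi' : ∫⁻ σ in I, J σ ^ (a / b) ≠ ∞ := fun hc => hNi (by
    rw [hN, hc, ENNReal.top_rpow_of_pos (by positivity)])
  have hJae : ∀ᵐ σ, σ ∈ I → J σ < ∞ := by
    rw [← ae_restrict_iff' hIm]
    filter_upwards [ae_lt_top (hJm.pow_const (a / b)) hNi'] with σ hσ
    rw [lt_top_iff_ne_top]
    intro hc
    rw [hc, ENNReal.top_rpow_of_pos (by positivity)] at hσ
    exact lt_irrefl _ hσ
  have hGM : ∀ σ x, ‖𝓕⁻ (γ σ) x‖ ≤ ∫ η, Γ η := fun σ x =>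
    (norm_fourierInv_le _ _).trans (integral_mono (h.integrable σ).norm h.int (h.le σ))
  set M := ∫ η, Γ η
  set M' : ℝ≥0∞ := (ENNReal.ofReal M ^ (2 - b)) ^ (1 / 2 : ℝ) with hM'
  have hM'f : M' ≠ ∞ := ENNReal.rpow_ne_top_of_nonneg (by norm_num)
    (ENNReal.rpow_ne_top_of_nonneg (by linarith) ENNReal.ofReal_ne_top)
  have hmain : mixedNorm Q I (fun t => eLpNorm (𝓕⁻ (duhamel γ t)) R volume) ≤
      4 * ((C₁ + C₂) * N) := by
    refine mixedNorm_le_of_dual (measurable_fourierInv_left (measurable_duhamel h.meas)) hQ hR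
      (by linarith) (by linarith) haQ hbR hIm fun g hg hgI => ?_
    obtain ⟨T, hT0, hT⟩ := hg.supp
    set A : Set ℝ := I ∩ (Set.Ioc 0 T ∩ {σ | J σ < ∞}) with hA
    have hAm : MeasurableSet A :=
      hIm.inter (measurableSet_Ioc.inter (measurableSet_lt hJm measurable_const))
    have hA0 : ∀ σ ∈ A, 0 < σ := fun σ hσ => hσ.2.1.1
    have hA2 : ∀ σ ∈ A, MemLp (𝓕⁻ (γ σ)) 2 volume := fun σ hσ => by
      refine ⟨(hGm.comp measurable_prodMk_left).aestronglyMeasurable, ?_⟩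
      refine (eLpNorm_two_le_of_bound (hGM σ) hb2).trans_lt ?_
      exact ENNReal.mul_lt_top (lt_top_iff_ne_top.2 hM'f)
        (ENNReal.rpow_lt_top_of_nonneg (by norm_num) hσ.2.2.ne)
    set F := cut (A ×ˢ Set.univ) (fun σ => 𝓕⁻ (γ σ)) with hF
    have hFin : ∀ σ ∈ A, F σ = 𝓕⁻ (γ σ) := fun σ hσ => by
      classical
      funext x; rw [hF, cut_apply, if_pos ⟨hσ, trivial⟩]
    have hFout : ∀ σ, σ ∉ A → F σ = fun _ => 0 := fun σ hσ => by
      classical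
      funext x; rw [hF, cut_apply, if_neg fun h => hσ h.1]
    have hFm : Measurable (Function.uncurry F) := hGm.indicator (hAm.prod MeasurableSet.univ)
    have hF2 : ∀ σ, MemLp (F σ) 2 volume := fun σ => by
      by_cases hσ : σ ∈ A
      · rw [hFin σ hσ]; exact hA2 σ hσ
      · rw [hFout σ hσ]; exact MemLp.zero'
    have hF1 : ∫⁻ σ, eLpNorm (F σ) 2 volume < ∞ := by
      have hbd : ∀ σ, eLpNorm (F σ) 2 volume ≤ M' * ((Set.Ioc 0 T).indicator (fun _ => 1) σ +
          I.indicator (fun σ => J σ ^ (a / b)) σ) := fun σ => by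
        by_cases hσ : σ ∈ A
        · rw [hFin σ hσ, Set.indicator_of_mem hσ.2.1, Set.indicator_of_mem hσ.1]
          refine (eLpNorm_two_le_of_bound (hGM σ) hb2).trans (mul_le_mul_right ?_ M')
          refine rpow_half_le_one_add ?_
          rw [div_le_div_iff₀ two_pos hb0]; linarith
        · rw [hFout σ hσ]; simp
      refine (lintegral_mono hbd).trans_lt ?_
      rw [lintegral_const_mul' _ _ hM'f, lintegral_add_left (measurable_const.indicator
        measurableSet_Ioc), lintegral_indicator measurableSet_Ioc, lintegral_indicator hIm,
        setLIntegral_const]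
      refine ENNReal.mul_lt_top (lt_top_iff_ne_top.2 hM'f)
        (ENNReal.add_lt_top.2 ⟨by simp, lt_top_iff_ne_top.2 hNi'⟩)
    have hFN : nrm a b F ≤ N := by
      rw [nrm, hN]
      refine ENNReal.rpow_le_rpow ?_ (by positivity)
      rw [← lintegral_indicator hIm]
      refine lintegral_mono fun σ => ?_
      by_cases hσ : σ ∈ A
      · rw [hFin σ hσ, Set.indicator_of_mem hσ.1]
      · rw [hFout σ hσ]
        have : (∫⁻ _ : Ed d, ‖(0 : ℂ)‖ₑ ^ b) ^ (a / b) = 0 := by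
          simp [hb0, div_pos ha0 hb0]
        rw [this]; exact bot_le
    have hret : ∀ {θ : ℝ} (hθ : θ ≠ 0) {C : ℝ≥0∞},
        (∀ F G : ℝ → Ed d → ℂ, Nice F → Nice G →
          ‖retard (evol d θ) F G‖ₑ ≤ C * (nrm a b F * nrm a' b' G)) →
        ‖(starRingEnd ℂ) (retard (evol d θ) F fun t x => (starRingEnd ℂ) (g t x))‖ₑ ≤
          C * (N * nrm a' b' g) := fun {θ} hθ {C} hC => by
      rw [← ofReal_norm, RCLike.norm_conj, ofReal_norm]
      refine (dispersive_evol hθ).enorm_retard_le_of_cut hFm hF2 hF1 hg.conj fun S hS hSF => ?_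
      refine (hC _ _ hSF hg.conj).trans (mul_le_mul_right ?_ C)
      rw [nrm_conj]
      exact mul_le_mul_left ((nrm_cut_le ha0.le hb0.le S F).trans hFN) _
    rw [h.integral_fourierInv_duhamel_mul_eq hAm hA0 hA2 hF1 hg fun t x hgx => ?_]
    · have hdiv : ∀ z w : ℂ, ‖(z - w) / (2 * Complex.I)‖ₑ ≤ ‖z‖ₑ + ‖w‖ₑ := fun z w => by
        rw [← ofReal_norm, ← ofReal_norm, ← ofReal_norm, ← ENNReal.ofReal_add (norm_nonneg _)
          (norm_nonneg _)]
        refine ENNReal.ofReal_le_ofReal ?_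
        rw [norm_div, norm_mul, Complex.norm_I, mul_one, RCLike.norm_ofNat]
        have := norm_sub_le z w
        have := norm_nonneg (z - w)
        linarith
      refine (hdiv _ _).trans ((add_le_add (hret (neg_ne_zero.2 hπ) h₁) (hret hπ h₂)).trans_eq ?_)
      ring
    · filter_upwards [hJae] with σ hσ hσt
      have hσI : σ ∈ I := hI.out h0I (hgI t x hgx) ⟨hσt.1.le, hσt.2⟩
      exact ⟨hσI, ⟨hσt.1, hσt.2.trans ((le_abs_self t).trans (hT t x hgx).1)⟩, hσ hσI⟩
  refine hmain.trans ?_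
  rw [← mul_assoc]
  exact mul_le_mul_left le_self_add _

end

section

variable {d : ℕ}

open FourierTransform

theorem FT_eq_fourier (f : Ed d → ℂ) (ξ : Ed d) : FT d f ξ = 𝓕 f ((2 * Real.pi)⁻¹ • ξ) := by
  rw [FT, Real.fourier_eq']
  refine integral_congr_ae (Eventually.of_forall fun x => ?_)
  simp only [inner_smul_right, smul_eq_mul]
  congr 2
  have : (Real.pi : ℂ) ≠ 0 := by exact_mod_cast Real.pi_ne_zero
  push_cast
  field_simp

theorem FTinv_eq_fourierInv (g : Ed d → ℂ) (x : Ed d) :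
    FTinv d g x = 𝓕⁻ (fun η => g ((2 * Real.pi) • η)) x := by
  rw [FTinv, Real.fourierInv_eq']
  have h := Measure.integral_comp_smul (volume : Measure (Ed d))
    (fun ξ => Complex.exp (Complex.I * (⟪x, ξ⟫ : ℝ)) * g ξ) (2 * Real.pi)
  rw [finrank_euclideanSpace, Fintype.card_fin] at h
  rw [abs_of_nonneg (by positivity), Complex.real_smul, Complex.ofReal_inv] at h
  rw [← h]
  refine integral_congr_ae (Eventually.of_forall fun η => ?_)
  simp only [inner_smul_right, smul_eq_mul]
  congr 2
  rw [real_inner_comm]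
  push_cast
  ring

theorem two_pi_inv_smul_smul (η : Ed d) : (2 * Real.pi)⁻¹ • (2 * Real.pi) • η = η :=
  inv_smul_smul₀ (by positivity) η

theorem norm_two_pi_smul (η : Ed d) : ‖(2 * Real.pi) • η‖ = 2 * Real.pi * ‖η‖ := by
  rw [norm_smul, Real.norm_eq_abs, abs_of_nonneg (by positivity)]

theorem rieszD_eq (s : ℝ) (f : Ed d → ℂ) :
    rieszD d s f = 𝓕⁻ fun η => (((2 * Real.pi * ‖η‖) ^ s : ℝ) : ℂ) * 𝓕 f η := by
  funext x
  rw [rieszD, FTinv_eq_fourierInv]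
  simp only [FT_eq_fourier, two_pi_inv_smul_smul, norm_two_pi_smul]

/-- The symbol of `sin(tΔ)/Δ` in the normalization of Mathlib's Fourier transform. -/
def sinSymbol (t : ℝ) (η : Ed d) : ℝ :=
  Real.sin (4 * Real.pi ^ 2 * t * ‖η‖ ^ 2) / (2 * Real.pi * ‖η‖) ^ 2

theorem sinLapDivLap_eq (t : ℝ) (f : Ed d → ℂ) :
    sinLapDivLap d t f = 𝓕⁻ fun η => (sinSymbol t η : ℂ) * 𝓕 f η := by
  funext x
  rw [sinLapDivLap, FTinv_eq_fourierInv]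
  simp only [FT_eq_fourier, two_pi_inv_smul_smul, norm_two_pi_smul, sinSymbol]
  have h (η : Ed d) : t * (2 * Real.pi * ‖η‖) ^ 2 = 4 * Real.pi ^ 2 * t * ‖η‖ ^ 2 := by ring
  simp only [h]

theorem abs_sinSymbol_le (t : ℝ) (η : Ed d) : |sinSymbol t η| ≤ |t| := by
  rw [sinSymbol, abs_div, abs_of_nonneg (sq_nonneg (2 * Real.pi * ‖η‖))]
  refine div_le_of_le_mul₀ (sq_nonneg _) (abs_nonneg _) ?_
  refine Real.abs_sin_le_abs.trans_eq ?_
  rw [show 4 * Real.pi ^ 2 * t * ‖η‖ ^ 2 = t * (2 * Real.pi * ‖η‖) ^ 2 by ring, abs_mul,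
    abs_of_nonneg (sq_nonneg (2 * Real.pi * ‖η‖))]

theorem integrable_norm_rpow_majorant (hd : 1 ≤ d) {e : ℝ} (he : -(d : ℝ) < e) :
    Integrable fun η : Ed d => (if ‖η‖ ≤ 1 then ‖η‖ ^ e else ‖η‖ ^ (-(d : ℝ) - 1)) := by
  have : Nonempty (Fin d) := ⟨⟨0, hd⟩⟩
  have : Nontrivial (Ed d) := inferInstance
  refine (integrable_fun_norm_addHaar (volume : Measure (Ed d))
    (f := fun y : ℝ => if y ≤ 1 then y ^ e else y ^ (-(d : ℝ) - 1))).2 ?_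
  rw [finrank_euclideanSpace, Fintype.card_fin, ← Set.Ioc_union_Ioi_eq_Ioi (zero_le_one (α := ℝ))]
  have hcast : ((d - 1 : ℕ) : ℝ) = d - 1 := by rw [Nat.cast_sub hd]; simp
  refine IntegrableOn.union ?_ ?_
  · have h1 : IntegrableOn (fun y : ℝ => y ^ (d - 1 + e : ℝ)) (Set.Ioc 0 1) := by
      rw [← intervalIntegrable_iff_integrableOn_Ioc_of_le zero_le_one]
      exact intervalIntegral.intervalIntegrable_rpow' (by linarith)
    refine h1.congr_fun (fun y hy => ?_) measurableSet_Ioc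
    simp only [if_pos hy.2, smul_eq_mul]
    rw [← Real.rpow_natCast, ← Real.rpow_add hy.1, hcast]
  · have h1 : IntegrableOn (fun y : ℝ => y ^ (-2 : ℝ)) (Set.Ioi 1) :=
      integrableOn_Ioi_rpow_of_lt (by norm_num) one_pos
    refine h1.congr_fun (fun y hy => ?_) measurableSet_Ioi
    have hy1 : (1 : ℝ) < y := hy
    have hy0 : (0 : ℝ) < y := one_pos.trans hy1
    simp only [if_neg (not_le.2 hy1), smul_eq_mul]
    rw [← Real.rpow_natCast, ← Real.rpow_add hy0, hcast]
    congr 1; ring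

theorem hasTemperateGrowth_slice (σ : ℝ) :
    Function.HasTemperateGrowth fun y : Ed d => ((σ, y) : ℝ × Ed d) := by
  have h := (Function.HasTemperateGrowth.const ((σ, 0) : ℝ × Ed d) (E := Ed d)).add
    (ContinuousLinearMap.hasTemperateGrowth (ContinuousLinearMap.inr ℝ ℝ (Ed d)))
  convert h using 1
  funext y
  simp

/-- The spatial slice of a space-time Schwartz function. -/
def sliceMap (σ : ℝ) (F : SchwartzMap (ℝ × Ed d) ℂ) : SchwartzMap (Ed d) ℂ :=
  SchwartzMap.compCLMOfAntilipschitz ℝ (K := 1) (g := fun y : Ed d => ((σ, y) : ℝ × Ed d))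
    (hasTemperateGrowth_slice σ) (AntilipschitzWith.of_le_mul_dist fun x y => by
      simp [Prod.dist_eq]) F

theorem sliceMap_apply (σ : ℝ) (F : SchwartzMap (ℝ × Ed d) ℂ) (y : Ed d) :
    sliceMap σ F y = F (σ, y) := rfl

theorem seminorm_sliceMap_le (k n : ℕ) (σ : ℝ) (F : SchwartzMap (ℝ × Ed d) ℂ) :
    SchwartzMap.seminorm ℂ k n (sliceMap σ F) ≤ SchwartzMap.seminorm ℂ k n F := by
  refine SchwartzMap.seminorm_le_bound ℂ k n _ (apply_nonneg _ _) fun y => ?_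
  have h1 : (sliceMap σ F : Ed d → ℂ) =
      (fun p => F ((σ, 0) + p)) ∘ (ContinuousLinearMap.inr ℝ ℝ (Ed d)) := by
    funext y; simp [sliceMap_apply]
  have h2 : ContDiff ℝ n fun p : ℝ × Ed d => F ((σ, 0) + p) :=
    (F.smooth n).comp (contDiff_const.add contDiff_id)
  rw [h1, ContinuousLinearMap.iteratedFDeriv_comp_right _ h2 _ le_rfl,
    iteratedFDeriv_comp_add_left]
  calc _ ≤ ‖((σ, y) : ℝ × Ed d)‖ ^ k * ‖iteratedFDeriv ℝ n F (σ, y)‖ := by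
        refine mul_le_mul (pow_le_pow_left₀ (norm_nonneg _) (by simp [Prod.norm_def]) k) ?_
          (norm_nonneg _) (by positivity)
        refine (ContinuousMultilinearMap.norm_compContinuousLinearMap_le _ _).trans ?_
        have h3 : ‖ContinuousLinearMap.inr ℝ ℝ (Ed d)‖ ≤ 1 :=
          ContinuousLinearMap.opNorm_le_bound _ zero_le_one fun x => by simp [Prod.norm_def]
        have h4 : ((σ, 0) : ℝ × Ed d) + ContinuousLinearMap.inr ℝ ℝ (Ed d) y = (σ, y) := by simp
        rw [h4]
        refine mul_le_of_le_one_right (norm_nonneg _) ?_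
        exact Finset.prod_le_one (fun _ _ => norm_nonneg _) fun _ _ => h3
    _ ≤ _ := SchwartzMap.le_seminorm ℂ k n F _

theorem exists_pow_mul_norm_fourier_slice_le (F : SchwartzMap (ℝ × Ed d) ℂ) (k : ℕ) :
    ∃ C : ℝ, 0 ≤ C ∧ ∀ σ η, ‖η‖ ^ k * ‖𝓕 (fun y => F (σ, y)) η‖ ≤ C := by
  have hcont : Continuous ((SchwartzMap.seminorm ℂ k 0 : Seminorm ℂ (SchwartzMap (Ed d) ℂ)).comp
      (SchwartzMap.fourierTransformCLM ℂ :
        SchwartzMap (Ed d) ℂ →L[ℂ] SchwartzMap (Ed d) ℂ).toLinearMap) := by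
    have h := (schwartz_withSeminorms ℂ (Ed d) ℂ).continuous_seminorm (k, 0)
    exact h.comp (SchwartzMap.fourierTransformCLM ℂ).continuous
  obtain ⟨s, C, -, hC⟩ := Seminorm.bound_of_continuous (schwartz_withSeminorms ℂ (Ed d) ℂ) _ hcont
  set A : ℝ := ∑ i ∈ s, SchwartzMap.seminorm ℂ i.1 i.2 F with hA
  have hA0 : 0 ≤ A := Finset.sum_nonneg fun i _ => apply_nonneg _ _
  refine ⟨C * A, by positivity, fun σ η => ?_⟩
  have h1 := SchwartzMap.norm_pow_mul_le_seminorm ℂ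
    (SchwartzMap.fourierTransformCLM ℂ (sliceMap σ F)) k η
  have h2 := hC (sliceMap σ F)
  have h3 : (s.sup (schwartzSeminormFamily ℂ (Ed d) ℂ)) (sliceMap σ F) ≤ A := by
    refine Seminorm.finset_sup_apply_le hA0 fun i hi => ?_
    refine (seminorm_sliceMap_le i.1 i.2 σ F).trans ?_
    exact Finset.single_le_sum (f := fun i => SchwartzMap.seminorm ℂ i.1 i.2 F)
      (fun i _ => apply_nonneg _ _) hi
  refine h1.trans (h2.trans ?_)
  exact mul_le_mul_of_nonneg_left h3 C.2

end

section

variable {d : ℕ}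

open FourierTransform

theorem exists_integrable_majorant_slice (hd : 1 ≤ d) {e : ℝ} (he : -(d : ℝ) < e)
    (F : SchwartzMap (ℝ × Ed d) ℂ) :
    ∃ Γ : Ed d → ℝ, Integrable Γ ∧
      ∀ σ η, (2 * Real.pi * ‖η‖) ^ e * ‖𝓕 (fun y => F (σ, y)) η‖ ≤ Γ η := by
  obtain ⟨C₀, hC₀, h₀⟩ := exists_pow_mul_norm_fourier_slice_le F 0
  obtain ⟨N, hN⟩ := exists_nat_ge (e + d + 1)
  obtain ⟨C₁, hC₁, h₁⟩ := exists_pow_mul_norm_fourier_slice_le F N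
  refine ⟨fun η => ((2 * Real.pi) ^ e * (C₀ + C₁)) *
    (if ‖η‖ ≤ 1 then ‖η‖ ^ e else ‖η‖ ^ (-(d : ℝ) - 1)),
    (integrable_norm_rpow_majorant hd he).const_mul _, fun σ η => ?_⟩
  have hpi : 0 ≤ (2 * Real.pi) ^ e := by positivity
  beta_reduce
  rw [Real.mul_rpow (by positivity) (norm_nonneg _), mul_assoc, mul_assoc ((2 * Real.pi) ^ e)]
  refine mul_le_mul_of_nonneg_left ?_ hpi
  have h0 := h₀ σ η
  rw [pow_zero, one_mul] at h0
  have h1 := h₁ σ η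
  split_ifs with h
  · rw [mul_comm]
    exact mul_le_mul_of_nonneg_right (by linarith) (by positivity)
  · have hη : 1 < ‖η‖ := not_le.1 h
    have hη0 : 0 < ‖η‖ := one_pos.trans hη
    have h2 : ‖η‖ ^ e = ‖η‖ ^ (e - N) * ‖η‖ ^ N := by
      rw [← Real.rpow_natCast, ← Real.rpow_add hη0, sub_add_cancel]
    have h3 : ‖η‖ ^ (e - N) ≤ ‖η‖ ^ (-(d : ℝ) - 1) :=
      Real.rpow_le_rpow_of_exponent_le hη.le (by linarith)
    calc _ = ‖η‖ ^ (e - N) * (‖η‖ ^ N * ‖𝓕 (fun y => F (σ, y)) η‖) := by rw [h2, mul_assoc]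
      _ ≤ ‖η‖ ^ (-(d : ℝ) - 1) * (C₀ + C₁) :=
          mul_le_mul h3 (by linarith) (by positivity) (by positivity)
      _ = _ := mul_comm _ _

/-- The family of spectral densities of `|D|^e F(σ, ·)`. -/
def sliceSpec (e : ℝ) (F : SchwartzMap (ℝ × Ed d) ℂ) (σ : ℝ) (η : Ed d) : ℂ :=
  (((2 * Real.pi * ‖η‖) ^ e : ℝ) : ℂ) * 𝓕 (fun y => F (σ, y)) η

theorem exists_specField_sliceSpec (hd : 1 ≤ d) {e : ℝ} (he : -(d : ℝ) < e)
    (F : SchwartzMap (ℝ × Ed d) ℂ) : ∃ Γ, SpecField (sliceSpec e F) Γ := by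
  obtain ⟨Γ, hΓ, h⟩ := exists_integrable_majorant_slice hd he F
  refine ⟨Γ, ⟨?_, hΓ, fun σ η => ?_⟩⟩
  · have h1 : Measurable (Function.uncurry fun σ => 𝓕 (fun y => F (σ, y))) :=
      measurable_fourier_left (γ := fun σ y => F (σ, y)) F.continuous.measurable
    have h2 : Measurable fun p : ℝ × Ed d => (((2 * Real.pi * ‖p.2‖) ^ e : ℝ) : ℂ) := by
      fun_prop
    exact h2.mul h1
  · rw [sliceSpec, norm_mul, Complex.norm_real, Real.norm_eq_abs, abs_of_nonneg (by positivity)]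
    exact h σ η

theorem rieszD_slice (e : ℝ) (F : SchwartzMap (ℝ × Ed d) ℂ) (σ : ℝ) :
    rieszD d e (fun y => F (σ, y)) = 𝓕⁻ (sliceSpec e F σ) := rieszD_eq e _

theorem sliceSpec_zero (F : SchwartzMap (ℝ × Ed d) ℂ) (σ : ℝ) :
    sliceSpec 0 F σ = 𝓕 (fun y => F (σ, y)) := by
  funext η; simp [sliceSpec]

/-- The spectral density of the solution at time `t`. -/
def plateSpec (φ : ℝ → Ed d → ℂ) (t : ℝ) (η : Ed d) : ℂ :=
  ∫ σ in Set.Ioc 0 t, (sinSymbol (t - σ) η : ℂ) * φ σ η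

theorem norm_sinSymbol_mul_le {φ : ℝ → Ed d → ℂ} {Φ : Ed d → ℝ} (h : SpecField φ Φ) {t σ : ℝ}
    (hσ : σ ∈ Set.Ioc 0 t) (η : Ed d) :
    ‖(sinSymbol (t - σ) η : ℂ) * φ σ η‖ ≤ t * Φ η := by
  rw [norm_mul, Complex.norm_real, Real.norm_eq_abs]
  refine mul_le_mul ((abs_sinSymbol_le _ _).trans ?_) (h.le σ η) (norm_nonneg _)
    (hσ.1.le.trans hσ.2)
  rw [abs_of_nonneg (by linarith [hσ.2])]
  linarith [hσ.1]

theorem measurable_sinSymbol_mul {φ : ℝ → Ed d → ℂ} {Φ : Ed d → ℝ} (h : SpecField φ Φ) (t : ℝ) :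
    Measurable fun p : ℝ × Ed d => (sinSymbol (t - p.1) p.2 : ℂ) * φ p.1 p.2 := by
  have h1 : Measurable fun p : ℝ × Ed d => sinSymbol (t - p.1) p.2 :=
    by unfold sinSymbol; fun_prop
  exact (Complex.measurable_ofReal.comp h1).mul h.meas

theorem integrable_prod_sinSymbol {φ : ℝ → Ed d → ℂ} {Φ : Ed d → ℝ} (h : SpecField φ Φ) (t : ℝ) :
    Integrable (fun p : ℝ × Ed d => (sinSymbol (t - p.1) p.2 : ℂ) * φ p.1 p.2)
      ((volume.restrict (Set.Ioc 0 t)).prod volume) := by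
  have h1 : Integrable (fun p : ℝ × Ed d => t * Φ p.2)
      ((volume.restrict (Set.Ioc 0 t)).prod volume) := by
    have : Integrable (fun _ : ℝ => t) (volume.restrict (Set.Ioc 0 t)) := integrable_const t
    exact Integrable.mul_prod (f := fun _ : ℝ => t) (g := Φ) this h.int
  refine h1.mono' (measurable_sinSymbol_mul h t).aestronglyMeasurable ?_
  have h2 : ∀ᵐ σ ∂(volume.restrict (Set.Ioc 0 t)), σ ∈ Set.Ioc 0 t :=
    ae_restrict_mem measurableSet_Ioc
  have h3 := Measure.quasiMeasurePreserving_fst (μ := volume.restrict (Set.Ioc 0 t))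
    (ν := (volume : Measure (Ed d))) |>.ae h2
  filter_upwards [h3] with p hp
  exact norm_sinSymbol_mul_le h hp p.2

theorem integral_sinLapDivLap_eq {φ : ℝ → Ed d → ℂ} {Φ : Ed d → ℝ} (h : SpecField φ Φ)
    {f : ℝ → Ed d → ℂ} (hf : ∀ σ, 𝓕 (f σ) = φ σ) {t : ℝ} (ht : 0 ≤ t) (x : Ed d) :
    ∫ σ in (0 : ℝ)..t, sinLapDivLap d (t - σ) (f σ) x = 𝓕⁻ (plateSpec φ t) x := by
  rw [intervalIntegral.integral_of_le ht]
  simp only [sinLapDivLap_eq, hf]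
  simp only [Real.fourierInv_eq, plateSpec]
  rw [integral_integral_swap]
  · refine integral_congr_ae (Eventually.of_forall fun η => ?_)
    simp only [Circle.smul_def, smul_eq_mul]
    rw [integral_const_mul]
  · have h1 := integrable_prod_sinSymbol h t
    have h2 : AEStronglyMeasurable (Function.uncurry fun σ η =>
        Real.fourierChar ⟪η, x⟫ • ((sinSymbol (t - σ) η : ℂ) * φ σ η))
        ((volume.restrict (Set.Ioc 0 t)).prod volume) := by
      have h3 : Continuous fun p : ℝ × Ed d => (Real.fourierChar ⟪p.2, x⟫ : ℂ) := by fun_prop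
      exact (h3.measurable.mul (measurable_sinSymbol_mul h t)).aestronglyMeasurable
    refine h1.norm.mono' h2 (Eventually.of_forall fun p => ?_)
    simp [Function.uncurry, Circle.norm_smul]

theorem integrable_plateSpec {φ : ℝ → Ed d → ℂ} {Φ : Ed d → ℝ} (h : SpecField φ Φ) (t : ℝ) :
    Integrable (plateSpec φ t) :=
  (integrable_prod_sinSymbol h t).integral_prod_right

theorem continuousAt_plateSpec {φ : ℝ → Ed d → ℂ} {Φ : Ed d → ℝ} (h : SpecField φ Φ)
    (hc : ∀ σ, Continuous (φ σ)) {B : ℝ} (hB : ∀ σ η, ‖φ σ η‖ ≤ B) (t : ℝ) {η : Ed d}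
    (hη : η ≠ 0) : ContinuousAt (plateSpec φ t) η := by
  refine continuousAt_of_dominated (bound := fun _ => |t| * B) ?_ ?_ ?_ ?_
  · refine Eventually.of_forall fun y => ?_
    have := (measurable_sinSymbol_mul h t).comp (measurable_prodMk_right (y := y))
    exact this.aestronglyMeasurable
  · refine Eventually.of_forall fun y => ?_
    refine (ae_restrict_mem measurableSet_Ioc).mono fun σ hσ => ?_
    rw [norm_mul, Complex.norm_real, Real.norm_eq_abs]
    refine mul_le_mul ((abs_sinSymbol_le _ _).trans ?_) (hB σ y) (norm_nonneg _) (abs_nonneg _)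
    rw [abs_of_nonneg (by linarith [hσ.2]), abs_of_nonneg (hσ.1.le.trans hσ.2)]
    linarith [hσ.1]
  · exact integrable_const _
  · refine Eventually.of_forall fun σ => ?_
    refine ContinuousAt.mul ?_ (hc σ).continuousAt
    refine Complex.continuous_ofReal.continuousAt.comp ?_
    unfold sinSymbol
    have : (2 * Real.pi * ‖η‖) ^ 2 ≠ 0 := by
      have := norm_pos_iff.2 hη
      positivity
    refine ContinuousAt.div ?_ ?_ this <;> fun_prop

theorem rpow_mul_plateSpec {e : ℝ} {φ γ : ℝ → Ed d → ℂ}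
    (hγ : ∀ σ η, γ σ η = (((2 * Real.pi * ‖η‖) ^ (e - 2) : ℝ) : ℂ) * φ σ η) (t : ℝ) {η : Ed d}
    (hη : η ≠ 0) :
    (((2 * Real.pi * ‖η‖) ^ e : ℝ) : ℂ) * plateSpec φ t η = duhamel γ t η := by
  rw [plateSpec, duhamel, ← integral_const_mul]
  refine integral_congr_ae (Eventually.of_forall fun σ => ?_)
  simp only [hγ, sinSymbol]
  have h0 : 0 < 2 * Real.pi * ‖η‖ := by
    have := norm_pos_iff.2 hη
    positivity
  have h1 : (2 * Real.pi * ‖η‖) ^ (e - 2) = (2 * Real.pi * ‖η‖) ^ e / (2 * Real.pi * ‖η‖) ^ 2 := by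
    rw [Real.rpow_sub h0, Real.rpow_two]
  rw [h1]
  push_cast
  ring

end

section

variable {d : ℕ}

open FourierTransform

theorem fourierInv_congr_off_zero (hd : 1 ≤ d) {f g : Ed d → ℂ} (h : ∀ η, η ≠ 0 → f η = g η) :
    𝓕⁻ f = 𝓕⁻ g := by
  have : Nonempty (Fin d) := ⟨⟨0, hd⟩⟩
  funext x
  rw [Real.fourierInv_eq, Real.fourierInv_eq]
  refine integral_congr_ae ?_
  have h0 : ∀ᵐ η : Ed d, η ≠ 0 := by
    rw [ae_iff]
    simp
  filter_upwards [h0] with η hη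
  rw [h η hη]

theorem fourier_eq_zero_of_not_integrable {f : Ed d → ℂ} (h : ¬ Integrable f) : 𝓕 f = 0 := by
  funext ξ
  rw [Real.fourier_eq]
  refine integral_undef fun h' => h ?_
  exact (Real.fourierIntegral_convergent_iff ξ).1 h'

theorem sobNorm_fourierInv_plateSpec_le (hd : 1 ≤ d) {e : ℝ} {φ γ : ℝ → Ed d → ℂ} {Φ : Ed d → ℝ}
    (h : SpecField φ Φ) (hc : ∀ σ, Continuous (φ σ)) {B : ℝ} (hB : ∀ σ η, ‖φ σ η‖ ≤ B)
    (hγ : ∀ σ η, γ σ η = (((2 * Real.pi * ‖η‖) ^ (e - 2) : ℝ) : ℂ) * φ σ η) (t : ℝ) (r : ℝ≥0∞) :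
    sobNorm d e r (𝓕⁻ (plateSpec φ t)) ≤ eLpNorm (𝓕⁻ (duhamel γ t)) r volume := by
  rw [sobNorm, rieszD_eq]
  by_cases hi : Integrable (𝓕⁻ (plateSpec φ t))
  · have hi' : Integrable (𝓕 (plateSpec φ t)) := by
      have h1 := hi.comp_neg
      refine h1.congr (Eventually.of_forall fun ξ => ?_)
      beta_reduce
      rw [Real.fourierInv_eq_fourier_neg, neg_neg]
    refine (congrArg (fun u => eLpNorm u r volume) (fourierInv_congr_off_zero hd fun η hη => ?_)).le
    rw [(integrable_plateSpec h t).fourier_fourierInv_eq hi' (continuousAt_plateSpec h hc hB t hη)]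
    exact rpow_mul_plateSpec hγ t hη
  · rw [fourier_eq_zero_of_not_integrable hi]
    have : (𝓕⁻ fun η : Ed d => (((2 * Real.pi * ‖η‖) ^ e : ℝ) : ℂ) * (0 : Ed d → ℂ) η) = 0 := by
      funext x
      simp [Real.fourierInv_eq]
    rw [this, eLpNorm_zero]
    exact zero_le

theorem mixedNorm_mono {q : ℝ≥0∞} (hq : q ≠ 0) {I : Set ℝ} (hI : MeasurableSet I)
    {g g' : ℝ → ℝ≥0∞} (h : ∀ t ∈ I, g t ≤ g' t) : mixedNorm q I g ≤ mixedNorm q I g' := by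
  rw [mixedNorm_eq_eLpNorm hq, mixedNorm_eq_eLpNorm hq]
  refine eLpNorm_mono_enorm_ae ((ae_restrict_mem hI).mono fun t ht => ?_)
  simpa using h t ht

theorem sobNorm_plate_le (hd : 1 ≤ d) (s : ℝ) (r : ℝ≥0∞)
    (F : SchwartzMap (ℝ × Ed d) ℂ) {t : ℝ} (ht : 0 ≤ t) :
    sobNorm d s r (fun x => ∫ σ in (0 : ℝ)..t, sinLapDivLap d (t - σ) (fun y => F (σ, y)) x) ≤
      eLpNorm (𝓕⁻ (duhamel (sliceSpec (s - 2) F) t)) r volume := by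
  have hd' : -(d : ℝ) < 0 := by
    have : (1 : ℝ) ≤ d := by exact_mod_cast hd
    linarith
  obtain ⟨Φ, hΦ⟩ := exists_specField_sliceSpec hd hd' F
  obtain ⟨B, -, hB⟩ := exists_pow_mul_norm_fourier_slice_le F 0
  have h1 : (fun x => ∫ σ in (0 : ℝ)..t, sinLapDivLap d (t - σ) (fun y => F (σ, y)) x) =
      𝓕⁻ (plateSpec (sliceSpec 0 F) t) := by
    funext x
    exact integral_sinLapDivLap_eq hΦ (f := fun σ y => F (σ, y))
      (fun σ => (sliceSpec_zero F σ).symm) ht x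
  rw [h1]
  refine sobNorm_fourierInv_plateSpec_le hd hΦ (B := B) (fun σ => ?_) (fun σ η => ?_)
    (fun σ η => ?_) t r
  · rw [sliceSpec_zero]
    exact continuous_fourier_of_integrable (sliceMap σ F).integrable
  · rw [sliceSpec_zero]
    simpa using hB σ η
  · rw [sliceSpec_zero]; rfl

theorem Admissible.toReal_relations {q r : ℝ≥0∞} (h : Admissible d q r) :
    1 / q.toReal ≤ 1 / 2 ∧ 1 / r.toReal ≤ 1 / 2 ∧
      1 / q.toReal = (d / 2 : ℝ) * (1 / 2 - 1 / r.toReal) ∧ (d = 2 → 0 < 1 / r.toReal) := by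
  obtain ⟨hq, hr, hqr, hex⟩ := h
  have key : ∀ p : ℝ≥0∞, 2 ≤ p → 1 / p.toReal ≤ 1 / 2 := fun p hp => by
    by_cases hpi : p = ∞
    · simp [hpi]
    · have := ENNReal.toReal_mono hpi hp
      rw [ENNReal.toReal_ofNat] at this
      exact one_div_le_one_div_of_le two_pos this
  have hq0 : q ≠ 0 := (two_pos.trans_le hq).ne'
  have hr0 : r ≠ 0 := (two_pos.trans_le hr).ne'
  have h1 := congrArg ENNReal.toReal hqr
  rw [ENNReal.toReal_add (ENNReal.div_ne_top (by simp) hq0) (ENNReal.div_ne_top (by simp) hr0),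
    ENNReal.toReal_div, ENNReal.toReal_div, ENNReal.toReal_div, ENNReal.toReal_natCast,
    ENNReal.toReal_ofNat] at h1
  have h2 : 1 / q.toReal = (d / 2 : ℝ) * (1 / 2 - 1 / r.toReal) := by
    rw [div_eq_mul_one_div, div_eq_mul_one_div (d : ℝ) r.toReal] at h1
    linarith
  refine ⟨key q hq, key r hr, h2, fun hd2 => ?_⟩
  by_cases hri : r = ∞
  · refine absurd ⟨?_, hri, hd2⟩ hex
    rw [hri, hd2] at h2
    norm_num at h2
    have hqi : q ≠ ∞ := fun hqi => by rw [hqi] at h2; norm_num at h2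
    have h3 : q.toReal = 2 := by
      rw [← inv_inv q.toReal, h2]
      norm_num
    rw [← ENNReal.ofReal_toReal hqi, h3]
    simp
  · exact one_div_pos.2 (ENNReal.toReal_pos hr0 hri)

theorem toReal_conj_relations {p p' : ℝ≥0∞} (hp : 2 ≤ p) (h : 1 / p + 1 / p' = 1) :
    p' ≠ 0 ∧ p' ≠ ∞ ∧ 1 / p'.toReal = 1 - 1 / p.toReal := by
  have hp0 : p ≠ 0 := (two_pos.trans_le hp).ne'
  have hp'0 : p' ≠ 0 := fun h0 => by simp [h0] at h
  have h1 := congrArg ENNReal.toReal h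
  rw [ENNReal.toReal_add (ENNReal.div_ne_top (by simp) hp0) (ENNReal.div_ne_top (by simp) hp'0),
    ENNReal.toReal_div, ENNReal.toReal_div, ENNReal.toReal_one] at h1
  refine ⟨hp'0, fun hi => ?_, by linarith⟩
  have h2 : 1 / p = 1 := by simpa [hi] using h
  have h3 : p = 1 := by simpa using h2
  rw [h3] at hp
  norm_num at hp

theorem one_le_and_le_two_of_one_div {a x : ℝ} (h : 1 / a = 1 - x) (hx0 : 0 ≤ x) (hx : x ≤ 1 / 2) :
    1 ≤ a ∧ a ≤ 2 := by
  have ha : 0 < a := one_div_pos.1 (by linarith)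
  have h1 : a * (1 - x) = 1 := by rw [← h]; field_simp
  constructor <;> nlinarith

theorem mixedNorm_sobNorm_slice {p' : ℝ≥0∞} (hp' : p' ≠ ∞) {r' : ℝ≥0∞} (hr0 : r' ≠ 0)
    (hr : r' ≠ ∞) (e : ℝ) (F : SchwartzMap (ℝ × Ed d) ℂ) (I : Set ℝ) :
    mixedNorm p' I (fun σ => sobNorm d e r' (fun y => F (σ, y))) =
      (∫⁻ σ in I, (∫⁻ x, ‖𝓕⁻ (sliceSpec e F σ) x‖ₑ ^ r'.toReal) ^ (p'.toReal / r'.toReal)) ^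
        (1 / p'.toReal) := by
  rw [mixedNorm, if_neg hp']
  congr 1
  refine lintegral_congr fun σ => ?_
  rw [sobNorm, rieszD_slice, eLpNorm_eq_lintegral_rpow_enorm_toReal hr0 hr, ← ENNReal.rpow_mul]
  congr 1
  ring

end

/-- Inhomogeneous Strichartz estimate for the vibrating plate equation.
For `d ≥ 1`, `s - 2 > -d` and admissible pairs `(q,r)`, `(q̃,r̃)`, there is `C > 0` such
that for every interval `I ⊆ [0,∞)` containing `0` and every Schwartz `F` on `ℝ × ℝ^d`:
`‖∫₀ᵗ (sin((t-σ)Δ)/Δ) F(σ,·) dσ‖_{L^q_I Ẇ^{s,r}} ≤ C ‖F‖_{L^{q̃'}_I Ẇ^{s-2,r̃'}}`. -/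
theorem inhomogeneous_strichartz_plate
    (d : ℕ) (hd : 1 ≤ d) (s : ℝ) (hs : -(d : ℝ) < s - 2)
    (q r qt rt qt' rt' : ℝ≥0∞)
    (hadm : Admissible d q r) (hadmt : Admissible d qt rt)
    (hqt' : 1 / qt + 1 / qt' = 1) (hrt' : 1 / rt + 1 / rt' = 1) :
    ∃ C : ℝ, 0 < C ∧
      ∀ I : Set ℝ, I.OrdConnected → I ⊆ Set.Ici (0 : ℝ) → (0 : ℝ) ∈ I →
        ∀ F : SchwartzMap (ℝ × Ed d) ℂ,
          mixedNorm q I (fun t => sobNorm d s r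
              (fun x => ∫ σ in (0:ℝ)..t, sinLapDivLap d (t - σ) (fun y => F (σ, y)) x)) ≤
            ENNReal.ofReal C *
              mixedNorm qt' I (fun σ => sobNorm d (s - 2) rt' (fun y => F (σ, y))) := by
  obtain ⟨hx, hy, hxy, hy2⟩ := hadm.toReal_relations
  obtain ⟨hxt, hyt, hxyt, hyt2⟩ := hadmt.toReal_relations
  obtain ⟨hqt0, hqti, ha⟩ := toReal_conj_relations hadmt.1 hqt'
  obtain ⟨hrt0, hrti, hb⟩ := toReal_conj_relations hadmt.2.1 hrt'
  have ha' : 1 / (1 / (1 - 1 / q.toReal)) = 1 - 1 / q.toReal := one_div_one_div _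
  have hb' : 1 / (1 / (1 - 1 / r.toReal)) = 1 - 1 / r.toReal := one_div_one_div _
  obtain ⟨ha1, ha2⟩ := one_le_and_le_two_of_one_div ha (by positivity) hxt
  obtain ⟨hb1, hb2⟩ := one_le_and_le_two_of_one_div hb (by positivity) hyt
  obtain ⟨ha1', ha2'⟩ := one_le_and_le_two_of_one_div ha' (by positivity) hx
  obtain ⟨hb1', hb2'⟩ := one_le_and_le_two_of_one_div hb' (by positivity) hy
  have hlt : ∀ {b y : ℝ}, 1 / b = 1 - y → 0 < y → 1 ≤ b → 1 < b := fun {b y} h0 h1 h2 => by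
    refine lt_of_le_of_ne h2 fun h3 => ?_
    rw [← h3] at h0
    linarith
  obtain ⟨C, hC, h⟩ := exists_mixedNorm_fourierInv_duhamel_le hd hadm.1 hadm.2.1 ha1 ha2 hb1 hb2
    (by rw [ha, hb]; linarith) ha1' ha2' hb1' hb2' (by rw [ha', hb']; linarith)
    (fun h2 => hlt hb (hyt2 h2) hb1) (fun h2 => hlt hb' (hy2 h2) hb1') ha' hb'
  refine ⟨C.toReal + 1, by positivity, fun I hI hI0 h0 F => ?_⟩
  obtain ⟨Γ, hΓ⟩ := exists_specField_sliceSpec hd hs F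
  have hq0 : q ≠ 0 := (two_pos.trans_le hadm.1).ne'
  refine (mixedNorm_mono hq0 hI.measurableSet fun t ht => sobNorm_plate_le hd s r F (hI0 ht)).trans
    ((h _ Γ hΓ I hI hI0 h0).trans ?_)
  rw [mixedNorm_sobNorm_slice hqti hrt0 hrti]
  refine mul_le_mul' ?_ le_rfl
  rw [ENNReal.le_ofReal_iff_toReal_le hC (by positivity)]
  linarith
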